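/- arXiv:1501.03908 — 5 statements merged into one kernel-verified Lean document; each statement's English description precedes it below -/
import Mathlib

section
/- Let 2 ≤ r ≤ s and let t, t' ∈ [0,1] with t ≠ t'. Then the maps G_t and G_{t'} are inequivalent: there do not exist automorphisms τ of Ω^I_{r,s} and σ of Ω^I_{2r−1,2s} such that G_t(Z) = σ(G_{t'}(τ(Z))) for all Z ∈ Ω^I_{r,s}. Consequently there are uncountably many pairwise inequivalent proper holomorphic maps from Ω^I_{r,s} to Ω^I_{2r−1,2s}. -/
open Matrix
open scoped ComplexOrder

noncomputable section

attribute [local instance] Matrix.normedAddCommGroup Matrix.normedSpace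

/-- The type I classical bounded symmetric domain `Ω^I_{r,s}`. -/
def OmegaI (r s : ℕ) : Set (Matrix (Fin r) (Fin s) ℂ) :=
  {Z | (1 - Z * Zᴴ).PosDef}

/-- Properness of the restriction `Ω₁ → Ω₂`. -/
def IsProperOn {E F : Type*} [TopologicalSpace E] [TopologicalSpace F]
    (f : E → F) (Ω₁ : Set E) (Ω₂ : Set F) : Prop :=
  ∀ K : Set F, K ⊆ Ω₂ → IsCompact K → IsCompact (Ω₁ ∩ f ⁻¹' K)

/-- `τ` is an automorphism of the domain `Ω`: a holomorphic bijection of `Ω` onto itself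
with holomorphic inverse. -/
def IsAutomorphismOf {E : Type*} [NormedAddCommGroup E] [NormedSpace ℂ E]
    (Ω : Set E) (τ : E → E) : Prop :=
  Set.MapsTo τ Ω Ω ∧ DifferentiableOn ℂ τ Ω ∧
    ∃ τinv : E → E, Set.MapsTo τinv Ω Ω ∧ DifferentiableOn ℂ τinv Ω ∧
      (∀ z ∈ Ω, τinv (τ z) = z) ∧ (∀ z ∈ Ω, τ (τinv z) = z)

/-- The one-parameter family `G_t : Ω^I_{r,s} → Ω^I_{2r-1,2s}` of equation (4.4). -/
def Gmap (r s : ℕ) (t : ℝ) (Z : Matrix (Fin r) (Fin s) ℂ) :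
    Matrix (Fin (2 * r - 1)) (Fin (2 * s)) ℂ :=
  Matrix.of fun i j =>
    if hi : (i : ℕ) < r then
      if hj : (j : ℕ) < s then
        (Real.sqrt t : ℂ) * Z ⟨i, hi⟩ ⟨0, by have := j.isLt; omega⟩ *
          Z ⟨0, by have := i.isLt; omega⟩ ⟨j, hj⟩
      else if hj' : (j : ℕ) = s then
        (Real.sqrt (1 - t) : ℂ) * Z ⟨i, hi⟩ ⟨0, by have := j.isLt; omega⟩
      else
        Z ⟨i, hi⟩ ⟨(j : ℕ) - s, by have := j.isLt; omega⟩
    else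
      if hj : (j : ℕ) < s then
        Z ⟨(i : ℕ) - r + 1, by have := i.isLt; omega⟩ ⟨j, hj⟩
      else 0

set_option linter.unusedSectionVars false

section ComplexAnalysis

open Metric Set Filter Topology

variable {E : Type*} [NormedAddCommGroup E] [NormedSpace ℂ E]

/-- The derivative at a fixed point of a holomorphic self-map of a bounded domain has determinant
of modulus at most one. -/
theorem norm_det_fderiv_le_one [FiniteDimensional ℂ E] {Ω : Set E} {f : E → E} {a : E}
    (hΩ : IsOpen Ω) (hb : Bornology.IsBounded Ω) (ha : a ∈ Ω) (hf : MapsTo f Ω Ω)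
    (hd : DifferentiableOn ℂ f Ω) (hfa : f a = a) :
    ‖(fderiv ℂ f a).det‖ ≤ 1 := by
  obtain ⟨ρ, hρ, hρΩ⟩ := Metric.isOpen_iff.1 hΩ a ha
  obtain ⟨R, hR⟩ := hb.subset_closedBall a
  have hit : ∀ n : ℕ, MapsTo f^[n] Ω Ω ∧ DifferentiableOn ℂ f^[n] Ω ∧ f^[n] a = a ∧
      fderiv ℂ f^[n] a = (fderiv ℂ f a) ^ n := by
    intro n
    induction n with
    | zero => exact ⟨fun x hx => hx, differentiableOn_id, rfl, by simp [fderiv_id]; rfl⟩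
    | succ n ih =>
      obtain ⟨h1, h2, h3, h4⟩ := ih
      rw [Function.iterate_succ']
      refine ⟨hf.comp h1, hd.comp h2 h1, by simp [h3, hfa], ?_⟩
      have hfd : DifferentiableAt ℂ f (f^[n] a) := by
        rw [h3]; exact hd.differentiableAt (hΩ.mem_nhds ha)
      rw [fderiv_comp a hfd (h2.differentiableAt (hΩ.mem_nhds ha)), h3, h4, pow_succ']
      rfl
  have hbd : ∀ n : ℕ, (fderiv ℂ f a) ^ n ∈ closedBall (0 : E →L[ℂ] E) (R / ρ) := by
    intro n
    obtain ⟨h1, h2, h3, h4⟩ := hit n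
    rw [mem_closedBall_zero_iff, ← h4]
    refine Complex.norm_fderiv_le_div_of_mapsTo_ball (h2.mono hρΩ) ?_ hρ
    intro x hx
    rw [h3]
    exact hR (h1 (hρΩ hx))
  have : ProperSpace (E →L[ℂ] E) := FiniteDimensional.proper ℂ _
  have hc : Continuous fun T : E →L[ℂ] E => T.det := ContinuousLinearMap.continuous_det
  obtain ⟨C, hC⟩ := (isCompact_closedBall (0 : E →L[ℂ] E) (R / ρ)).exists_bound_of_continuousOn
    hc.continuousOn
  by_contra! h
  obtain ⟨n, hn⟩ := pow_unbounded_of_one_lt C h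
  have h5 := hC _ (hbd n)
  have h6 : ((fderiv ℂ f a) ^ n).det = (fderiv ℂ f a).det ^ n := by
    simp [ContinuousLinearMap.det, ContinuousLinearMap.toLinearMap_pow, map_pow]
  rw [h6, norm_pow] at h5
  linarith

/-- Difference quotients of a bounded holomorphic function on a disc converge at a controlled
rate. -/
theorem norm_inv_smul_sub_sub_deriv_le {g : ℂ → E} {R C : ℝ} (hR : 0 < R)
    (hg : DifferentiableOn ℂ g (ball 0 R)) (hC : ∀ η ∈ ball (0 : ℂ) R, ‖g η‖ ≤ C)
    {η : ℂ} (hη : η ∈ ball (0 : ℂ) R) (h0 : η ≠ 0) [CompleteSpace E] :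
    ‖η⁻¹ • (g η - g 0) - deriv g 0‖ ≤ 4 * C / R / R * ‖η‖ := by
  have hmem : (0 : ℂ) ∈ ball (0 : ℂ) R := mem_ball_self hR
  have hm : MapsTo g (ball 0 R) (closedBall (g 0) (2 * C)) := by
    intro x hx
    rw [mem_closedBall, dist_eq_norm]
    linarith [norm_sub_le (g x) (g 0), hC x hx, hC 0 hmem]
  have hds : DifferentiableOn ℂ (dslope g 0) (ball 0 R) :=
    (Complex.differentiableOn_dslope (isOpen_ball.mem_nhds hmem)).2 hg
  have hb : ∀ x ∈ ball (0 : ℂ) R, ‖dslope g 0 x‖ ≤ 2 * C / R := fun x hx =>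
    Complex.norm_dslope_le_div_of_mapsTo_ball hg hm hx
  have hm2 : MapsTo (dslope g 0) (ball 0 R) (closedBall (dslope g 0 0) (4 * C / R)) := by
    intro x hx
    rw [mem_closedBall, dist_eq_norm]
    have := norm_sub_le (dslope g 0 x) (dslope g 0 0)
    have h1 := hb x hx
    have h2 := hb 0 hmem
    have : 4 * C / R = 2 * C / R + 2 * C / R := by ring
    linarith
  have := Complex.dist_le_div_mul_dist_of_mapsTo_ball hds hm2 hη
  rw [dist_eq_norm, dist_zero_right, dslope_same, dslope_of_ne _ h0, slope_def_module] at this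
  simpa using this

/-- The derivative of a holomorphic map in a fixed direction is holomorphic along holomorphic
curves. -/
theorem differentiableOn_fderiv_comp_apply {F : Type*} [NormedAddCommGroup F] [NormedSpace ℂ F]
    [CompleteSpace F] {Ω : Set E} {f : E → F} {U : Set ℂ}
    {c : ℂ → E} (hΩ : IsOpen Ω) (hU : IsOpen U) (hf : DifferentiableOn ℂ f Ω)
    (hc : DifferentiableOn ℂ c U) (hcU : MapsTo c U Ω) (w : E) :
    DifferentiableOn ℂ (fun ζ => fderiv ℂ f (c ζ) w) U := by
  intro ζ₀ hζ₀
  refine DifferentiableAt.differentiableWithinAt ?_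
  have hfc : ContinuousAt f (c ζ₀) := (hf.differentiableAt (hΩ.mem_nhds (hcU hζ₀))).continuousAt
  have hcc : ContinuousAt c ζ₀ := (hc.differentiableAt (hU.mem_nhds hζ₀)).continuousAt
  have hnear : ∀ᶠ x in 𝓝 (c ζ₀), x ∈ Ω ∧ ‖f x‖ < ‖f (c ζ₀)‖ + 1 :=
    Filter.Eventually.and (hΩ.mem_nhds (hcU hζ₀))
      (hfc.norm.eventually (Iio_mem_nhds (by linarith)))
  set C := ‖f (c ζ₀)‖ + 1
  have hcont : ContinuousAt (fun q : ℂ × ℂ => c q.1 + q.2 • w) (ζ₀, 0) := by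
    have : ContinuousAt (fun q : ℂ × ℂ => c q.1) (ζ₀, 0) :=
      ContinuousAt.comp (f := fun q : ℂ × ℂ => q.1) (g := c) hcc continuousAt_fst
    fun_prop
  have hnear' : ∀ᶠ q in 𝓝 ((ζ₀, 0) : ℂ × ℂ), q.1 ∈ U ∧ c q.1 + q.2 • w ∈ Ω ∧
      ‖f (c q.1 + q.2 • w)‖ < C := by
    refine Filter.Eventually.and ?_ ?_
    · exact continuousAt_fst.eventually (hU.mem_nhds hζ₀)
    · exact hcont.eventually (p := fun x => x ∈ Ω ∧ ‖f x‖ < C) (by simpa using hnear)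
  obtain ⟨R, hR, hball⟩ := Metric.eventually_nhds_iff_ball.1 hnear'
  have hB : ∀ ζ ∈ ball ζ₀ R, ∀ η ∈ ball (0 : ℂ) R, ζ ∈ U ∧ c ζ + η • w ∈ Ω ∧
      ‖f (c ζ + η • w)‖ < C := by
    intro ζ hζ η hη
    refine hball (ζ, η) ?_
    rw [← ball_prod_same]
    exact ⟨hζ, hη⟩
  have hbU : ball ζ₀ R ⊆ U := fun ζ hζ => (hB ζ hζ 0 (mem_ball_self hR)).1
  let η : ℕ → ℂ := fun n => ((R / 2 / (n + 1) : ℝ) : ℂ)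
  have hηn : ∀ n, ‖η n‖ = R / 2 / (n + 1) := fun n => by
    simp only [η, Complex.norm_real, Real.norm_eq_abs]
    exact abs_of_pos (by positivity)
  have hηR : ∀ n, η n ∈ ball (0 : ℂ) R := fun n => by
    rw [mem_ball_zero_iff, hηn]
    have : R / 2 / (n + 1) ≤ R / 2 :=
      div_le_self (by linarith) (by linarith [n.cast_nonneg (α := ℝ)])
    linarith
  have hη0 : ∀ n, η n ≠ 0 := fun n => by
    rw [← norm_pos_iff, hηn]; positivity
  have hηt : Tendsto (fun n => ‖η n‖) atTop (𝓝 0) := by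
    simp_rw [hηn, div_eq_mul_inv (R / 2)]
    simpa using (tendsto_one_div_add_atTop_nhds_zero_nat (𝕜 := ℝ)).const_mul (R / 2)
  have hder : ∀ ζ ∈ ball ζ₀ R, fderiv ℂ f (c ζ) w = deriv (fun η : ℂ => f (c ζ + η • w)) 0 := by
    intro ζ hζ
    have h1 : HasDerivAt (fun η : ℂ => c ζ + η • w) w 0 := by
      simpa using ((hasDerivAt_id (0 : ℂ)).smul_const w).const_add (c ζ)
    have h2 : HasFDerivAt f (fderiv ℂ f (c ζ)) (c ζ + (0 : ℂ) • w) := by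
      rw [zero_smul, add_zero]
      exact (hf.differentiableAt (hΩ.mem_nhds (hcU (hbU hζ)))).hasFDerivAt
    exact (h2.comp_hasDerivAt (0 : ℂ) h1).deriv.symm
  have hlim : TendstoUniformlyOn
      (fun n ζ => (η n)⁻¹ • (f (c ζ + η n • w) - f (c ζ)))
      (fun ζ => fderiv ℂ f (c ζ) w) atTop (ball ζ₀ R) := by
    rw [Metric.tendstoUniformlyOn_iff]
    intro ε hε
    have ht : Tendsto (fun n => 4 * C / R / R * ‖η n‖) atTop (𝓝 0) := by
      simpa using hηt.const_mul (4 * C / R / R)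
    filter_upwards [ht.eventually (Iio_mem_nhds hε)] with n hn ζ hζ
    rw [dist_comm, dist_eq_norm, hder ζ hζ]
    refine lt_of_le_of_lt ?_ hn
    have := norm_inv_smul_sub_sub_deriv_le (g := fun η : ℂ => f (c ζ + η • w)) hR (C := C) ?_
      (fun x hx => (hB ζ hζ x hx).2.2.le) (hηR n) (hη0 n)
    · simpa using this
    · refine hf.comp (by fun_prop) fun x hx => (hB ζ hζ x hx).2.1
  refine (hlim.tendstoLocallyUniformlyOn.differentiableOn (Eventually.of_forall fun n => ?_)
    isOpen_ball).differentiableAt (isOpen_ball.mem_nhds (mem_ball_self hR))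
  have hcb : DifferentiableOn ℂ c (ball ζ₀ R) := hc.mono hbU
  refine DifferentiableOn.const_smul (DifferentiableOn.sub ?_ ?_) _
  · exact hf.comp (hcb.add_const _) fun x hx => (hB x hx _ (hηR n)).2.1
  · exact hf.comp hcb fun x hx => hcU (hbU hx)

/-- The Jacobian determinant of a holomorphic map is holomorphic along holomorphic curves. -/
theorem differentiableOn_det_fderiv_comp [FiniteDimensional ℂ E] {Ω : Set E} {f : E → E}
    {U : Set ℂ} {c : ℂ → E} (hΩ : IsOpen Ω) (hU : IsOpen U) (hf : DifferentiableOn ℂ f Ω)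
    (hc : DifferentiableOn ℂ c U) (hcU : MapsTo c U Ω) :
    DifferentiableOn ℂ (fun ζ => (fderiv ℂ f (c ζ)).det) U := by
  have : CompleteSpace E := FiniteDimensional.complete ℂ E
  let b := Module.finBasis ℂ E
  have h : ∀ ζ, (fderiv ℂ f (c ζ)).det = Matrix.det (Matrix.of fun i j =>
      LinearMap.toContinuousLinearMap (b.coord i) (fderiv ℂ f (c ζ) (b j))) := by
    intro ζ
    rw [ContinuousLinearMap.det, ← LinearMap.det_toMatrix b]
    congr 1
    ext i j
    simp [LinearMap.toMatrix_apply]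
  simp_rw [h, Matrix.det_apply, Matrix.of_apply]
  have := fun j => differentiableOn_fderiv_comp_apply hΩ hU hf hc hcU (b j)
  fun_prop

end ComplexAnalysis

section Domain

variable {m n : Type*} [Fintype m] [Fintype n]

theorem star_dotProduct_self (u : m → ℂ) :
    star u ⬝ᵥ u = ((‖WithLp.toLp 2 u‖ ^ 2 : ℝ) : ℂ) := by
  rw [EuclideanSpace.norm_sq_eq, dotProduct]
  push_cast
  refine Finset.sum_congr rfl fun i _ => ?_
  simpa using Complex.conj_mul' (u i)

theorem norm_toLp_star (u : m → ℂ) : ‖WithLp.toLp 2 (star u)‖ = ‖WithLp.toLp 2 u‖ := by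
  simp [EuclideanSpace.norm_eq]

variable [DecidableEq m]

/-- A matrix acting on row vectors, as a continuous linear map of Euclidean spaces depending
linearly on the matrix. -/
def rowOp : Matrix m n ℂ →ₗ[ℂ] (EuclideanSpace ℂ m →L[ℂ] EuclideanSpace ℂ n) :=
  LinearMap.toContinuousLinearMap.toLinearMap ∘ₗ
    (Matrix.toEuclideanLin (𝕜 := ℂ) (m := n) (n := m)).toLinearMap ∘ₗ
    (Matrix.transposeLinearEquiv m n ℂ ℂ).toLinearMap

theorem rowOp_apply (Z : Matrix m n ℂ) (u : m → ℂ) :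
    rowOp Z (WithLp.toLp 2 u) = WithLp.toLp 2 (u ᵥ* Z) := by
  simp [rowOp, mulVec_transpose]

theorem star_dotProduct_one_sub_mulVec (Z : Matrix m n ℂ) (u : m → ℂ) :
    star u ⬝ᵥ ((1 - Z * Zᴴ) *ᵥ u) =
      ((‖WithLp.toLp 2 u‖ ^ 2 - ‖rowOp Z (WithLp.toLp 2 (star u))‖ ^ 2 : ℝ) : ℂ) := by
  rw [Complex.ofReal_sub, ← star_dotProduct_self u, rowOp_apply, ← norm_toLp_star,
    ← star_dotProduct_self, sub_mulVec, one_mulVec, dotProduct_sub, ← mulVec_mulVec,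
    dotProduct_mulVec (star u), star_star, star_vecMul, star_star]

theorem isHermitian_one_sub_mul_conjTranspose (Z : Matrix m n ℂ) :
    (1 - Z * Zᴴ).IsHermitian :=
  isHermitian_one.sub (isHermitian_mul_conjTranspose_self Z)

theorem posDef_one_sub_mul_conjTranspose_iff (Z : Matrix m n ℂ) :
    (1 - Z * Zᴴ).PosDef ↔ ‖rowOp Z‖ < 1 := by
  rw [posDef_iff_dotProduct_mulVec]
  simp only [isHermitian_one_sub_mul_conjTranspose, true_and, star_dotProduct_one_sub_mulVec,
    Complex.zero_lt_real, sub_pos]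
  constructor
  · intro h
    rcases isEmpty_or_nonempty m with hm | hm
    · have : rowOp Z = 0 := by ext1 x; rw [Subsingleton.elim x 0]; simp
      simp [this]
    have hne : (Metric.sphere (0 : EuclideanSpace ℂ m) 1).Nonempty := by
      refine ⟨EuclideanSpace.single (Classical.arbitrary m) 1, by simp⟩
    obtain ⟨x, hx, hmax⟩ := (isCompact_sphere (0 : EuclideanSpace ℂ m) 1).exists_isMaxOn hne
      (rowOp Z).continuous.norm.continuousOn
    have hx1 : ‖x‖ = 1 := by simpa using hx
    refine lt_of_le_of_lt (ContinuousLinearMap.opNorm_le_of_unit_norm (norm_nonneg (rowOp Z x))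
      fun y hy => hmax (by simpa using hy)) ?_
    have hx0 : star (x.ofLp) ≠ 0 := by
      intro h0
      have : x = 0 := by
        ext i
        simpa using congrArg star (congrFun h0 i)
      simp [this] at hx1
    have h2 := h hx0
    rw [norm_toLp_star, star_star] at h2
    change ‖rowOp Z x‖ ^ 2 < ‖x‖ ^ 2 at h2
    rw [hx1] at h2
    nlinarith [norm_nonneg (rowOp Z x)]
  · intro h u hu
    have h1 : 0 < ‖WithLp.toLp 2 u‖ := by simpa using hu
    have h2 := (rowOp Z).le_opNorm (WithLp.toLp 2 (star u))
    rw [norm_toLp_star] at h2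
    have h3 : ‖rowOp Z (WithLp.toLp 2 (star u))‖ < ‖WithLp.toLp 2 u‖ := by nlinarith
    gcongr

theorem posSemidef_one_sub_mul_conjTranspose (Z : Matrix m n ℂ)
    (h : ∀ u, ‖rowOp Z u‖ ≤ ‖u‖) : (1 - Z * Zᴴ).PosSemidef := by
  rw [posSemidef_iff_dotProduct_mulVec]
  refine ⟨isHermitian_one_sub_mul_conjTranspose Z, fun u => ?_⟩
  have := h (WithLp.toLp 2 (star u))
  rw [norm_toLp_star] at this
  rw [star_dotProduct_one_sub_mulVec, Complex.zero_le_real, sub_nonneg]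
  gcongr

theorem rowOp_injective : Function.Injective (rowOp (m := m) (n := n)) :=
  (LinearMap.toContinuousLinearMap.injective).comp
    ((Matrix.toEuclideanLin (𝕜 := ℂ) (m := n) (n := m)).injective.comp
      (Matrix.transposeLinearEquiv m n ℂ ℂ).injective)

theorem mem_OmegaI {r s : ℕ} {Z : Matrix (Fin r) (Fin s) ℂ} : Z ∈ OmegaI r s ↔ ‖rowOp Z‖ < 1 :=
  posDef_one_sub_mul_conjTranspose_iff Z

theorem OmegaI_eq_preimage (r s : ℕ) : OmegaI r s = rowOp ⁻¹' Metric.ball 0 1 := by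
  ext Z
  simp [mem_OmegaI]

theorem continuous_rowOp : Continuous (rowOp (m := m) (n := n)) :=
  LinearMap.continuous_of_finiteDimensional _

theorem isOpen_OmegaI (r s : ℕ) : IsOpen (OmegaI r s) := by
  rw [OmegaI_eq_preimage]
  exact Metric.isOpen_ball.preimage continuous_rowOp

theorem isBounded_OmegaI (r s : ℕ) : Bornology.IsBounded (OmegaI r s) := by
  obtain ⟨K, -, hK⟩ := LinearMap.exists_antilipschitzWith
    (rowOp (m := Fin r) (n := Fin s)) (LinearMap.ker_eq_bot.2 rowOp_injective)
  rw [OmegaI_eq_preimage]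
  exact hK.isBounded_preimage Metric.isBounded_ball

theorem zero_mem_OmegaI (r s : ℕ) : (0 : Matrix (Fin r) (Fin s) ℂ) ∈ OmegaI r s := by
  simp [mem_OmegaI]

/-- Schwarz lemma for holomorphic discs in the type I domain. -/
theorem norm_rowOp_le_of_mapsTo {r s : ℕ} {ψ : ℂ → Matrix (Fin r) (Fin s) ℂ}
    (hd : DifferentiableOn ℂ ψ (Metric.ball 0 1))
    (hm : Set.MapsTo ψ (Metric.ball 0 1) (OmegaI r s)) (h0 : ψ 0 = 0) {ζ : ℂ} (hζ : ‖ζ‖ < 1) :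
    ‖rowOp (ψ ζ)‖ ≤ ‖ζ‖ := by
  have hr : DifferentiableOn ℂ (fun ζ => rowOp (ψ ζ)) (Metric.ball 0 1) :=
    (rowOp (m := Fin r) (n := Fin s)).toContinuousLinearMap.differentiable
      |>.comp_differentiableOn hd
  refine Complex.norm_le_norm_of_mapsTo_ball (f := fun ζ => rowOp (ψ ζ)) hr
    (fun x hx => ?_) (by simp [h0]) hζ
  simpa using (mem_OmegaI.1 (hm hx)).le

/-- The diagonal entry `((1 - ZZᴴ)⁻¹)ᵢᵢ`. -/
def leftEntry (i : m) (Z : Matrix m n ℂ) : ℝ := ((1 - Z * Zᴴ)⁻¹ : Matrix m m ℂ) i i |>.re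

/-- The diagonal entry `(Zᴴ(1 - ZZᴴ)⁻¹Z)ⱼⱼ`. -/
def rightEntry (j : n) (Z : Matrix m n ℂ) : ℝ := (Zᴴ * (1 - Z * Zᴴ)⁻¹ * Z : Matrix n n ℂ) j j |>.re

theorem leftEntry_nonneg {Z : Matrix m n ℂ} (hZ : (1 - Z * Zᴴ).PosDef) (i : m) :
    0 ≤ leftEntry i Z :=
  (Complex.le_def.1 (hZ.inv.posSemidef.diag_nonneg (i := i))).1

theorem rightEntry_nonneg {Z : Matrix m n ℂ} (hZ : (1 - Z * Zᴴ).PosDef) (j : n) :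
    0 ≤ rightEntry j Z :=
  (Complex.le_def.1 ((hZ.inv.posSemidef.conjTranspose_mul_mul_same Z).diag_nonneg (i := j))).1

theorem sq_norm_inv_mulVec_le {Z : Matrix m n ℂ} {ρ : ℝ} (hZ : ‖rowOp Z‖ ≤ ρ) (hρ : ρ < 1)
    (a : m → ℂ) :
    (1 - ρ ^ 2) * ‖WithLp.toLp 2 ((1 - Z * Zᴴ)⁻¹ *ᵥ a)‖ ^ 2 ≤
      (star a ⬝ᵥ ((1 - Z * Zᴴ)⁻¹ *ᵥ a)).re := by
  have hp : (1 - Z * Zᴴ).PosDef := (posDef_one_sub_mul_conjTranspose_iff Z).2 (hZ.trans_lt hρ)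
  set u := (1 - Z * Zᴴ)⁻¹ *ᵥ a with hu
  have ha : a = (1 - Z * Zᴴ) *ᵥ u := by
    rw [hu, mulVec_mulVec, mul_nonsing_inv _ ((isUnit_iff_isUnit_det _).1 hp.isUnit), one_mulVec]
  have h1 : star a ⬝ᵥ u = star u ⬝ᵥ ((1 - Z * Zᴴ) *ᵥ u) := by
    conv_lhs => rw [ha, star_mulVec, hp.isHermitian.eq, ← dotProduct_mulVec]
  rw [h1, star_dotProduct_one_sub_mulVec, Complex.ofReal_re]
  have h2 := (rowOp Z).le_of_opNorm_le hZ (WithLp.toLp 2 (star u))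
  rw [norm_toLp_star] at h2
  have h3 : ‖rowOp Z (WithLp.toLp 2 (star u))‖ ^ 2 ≤ (ρ * ‖WithLp.toLp 2 u‖) ^ 2 := by gcongr
  linarith [mul_pow ρ ‖WithLp.toLp 2 u‖ 2]

theorem leftEntry_le {Z : Matrix m n ℂ} {ρ : ℝ} (hZ : ‖rowOp Z‖ ≤ ρ) (hρ0 : 0 ≤ ρ) (hρ : ρ < 1)
    (i : m) : leftEntry i Z ≤ 1 / (1 - ρ ^ 2) := by
  have h := sq_norm_inv_mulVec_le hZ hρ (Pi.single i 1)
  have he : star (Pi.single i 1 : m → ℂ) ⬝ᵥ ((1 - Z * Zᴴ)⁻¹ *ᵥ Pi.single i 1) =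
      ((1 - Z * Zᴴ)⁻¹ : Matrix m m ℂ) i i := by simp
  have h2 : leftEntry i Z ≤ ‖WithLp.toLp 2 ((1 - Z * Zᴴ)⁻¹ *ᵥ Pi.single i 1)‖ := by
    refine (Complex.re_le_norm _).trans ?_
    rw [mulVec_single_one]
    exact PiLp.norm_apply_le (WithLp.toLp 2 ((1 - Z * Zᴴ)⁻¹.col i)) i
  rw [he] at h
  change _ ≤ leftEntry i Z at h
  have h3 : 0 < 1 - ρ ^ 2 := by nlinarith
  have h0 := leftEntry_nonneg ((posDef_one_sub_mul_conjTranspose_iff Z).2 (hZ.trans_lt hρ)) i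
  rw [le_div_iff₀ h3]
  set x := ‖WithLp.toLp 2 ((1 - Z * Zᴴ)⁻¹ *ᵥ (Pi.single i 1 : m → ℂ))‖
  have h4 : (1 - ρ ^ 2) * leftEntry i Z ^ 2 ≤ leftEntry i Z :=
    (mul_le_mul_of_nonneg_left (pow_le_pow_left₀ h0 h2 2) h3.le).trans h
  by_contra! hc
  nlinarith

theorem rightEntry_le [DecidableEq n] {Z : Matrix m n ℂ} {ρ : ℝ} (hZ : ‖rowOp Z‖ ≤ ρ)
    (hρ0 : 0 ≤ ρ) (hρ : ρ < 1) (j : n) : rightEntry j Z ≤ ρ ^ 2 / (1 - ρ ^ 2) := by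
  have hp := (posDef_one_sub_mul_conjTranspose_iff Z).2 (hZ.trans_lt hρ)
  set a := Z *ᵥ Pi.single j 1 with ha
  have h := sq_norm_inv_mulVec_le hZ hρ a
  set u := (1 - Z * Zᴴ)⁻¹ *ᵥ a with hu
  have he : star a ⬝ᵥ u = (Zᴴ * (1 - Z * Zᴴ)⁻¹ * Z : Matrix n n ℂ) j j := by
    rw [hu, ha, star_mulVec, ← dotProduct_mulVec, mulVec_mulVec, mulVec_mulVec]
    simp
  have h1 : star u ⬝ᵥ a = star ((Zᴴ * (1 - Z * Zᴴ)⁻¹ * Z : Matrix n n ℂ) j j) := by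
    rw [← he, star_dotProduct]
  have h2 : rightEntry j Z ≤ ρ * ‖WithLp.toLp 2 u‖ := by
    have h3 := (rowOp Z).le_of_opNorm_le hZ (WithLp.toLp 2 (star u))
    rw [norm_toLp_star, rowOp_apply] at h3
    refine le_trans ?_ h3
    refine (Complex.re_le_norm _).trans ?_
    rw [← norm_star, ← h1, ha, dotProduct_mulVec, dotProduct_single_one]
    exact PiLp.norm_apply_le (WithLp.toLp 2 (star u ᵥ* Z)) j
  rw [he] at h
  change _ ≤ rightEntry j Z at h
  have h3 : 0 < 1 - ρ ^ 2 := by nlinarith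
  have h0 := rightEntry_nonneg hp j
  rw [le_div_iff₀ h3]
  have h4 : rightEntry j Z ^ 2 ≤ ρ ^ 2 * ‖WithLp.toLp 2 u‖ ^ 2 := by
    rw [← mul_pow]; exact pow_le_pow_left₀ h0 h2 2
  have h5 : (1 - ρ ^ 2) * rightEntry j Z ^ 2 ≤ ρ ^ 2 * rightEntry j Z := by
    have := mul_le_mul_of_nonneg_left h4 h3.le
    have h6 := mul_le_mul_of_nonneg_left h (sq_nonneg ρ)
    nlinarith
  by_contra! hc
  nlinarith [sq_nonneg ρ]

end Domain

section MatrixCalculus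

variable {E : Type*} [NormedAddCommGroup E] [NormedSpace ℂ E] {U : Set E}
variable {l m n : Type*} [Fintype l] [Fintype m] [Fintype n]

theorem differentiableOn_matrix {f : E → Matrix m n ℂ} :
    DifferentiableOn ℂ f U ↔ ∀ i j, DifferentiableOn ℂ (fun x => f x i j) U :=
  differentiableOn_pi.trans (forall_congr' fun _ => differentiableOn_pi)

theorem DifferentiableOn.matrix_mul {f : E → Matrix l m ℂ} {g : E → Matrix m n ℂ}
    (hf : DifferentiableOn ℂ f U) (hg : DifferentiableOn ℂ g U) :
    DifferentiableOn ℂ (fun x => f x * g x) U := by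
  rw [differentiableOn_matrix] at *
  intro i j
  simp only [mul_apply]
  have := hf i
  have := fun k => hg k j
  fun_prop

theorem DifferentiableOn.matrix_det [DecidableEq m] {f : E → Matrix m m ℂ}
    (hf : DifferentiableOn ℂ f U) : DifferentiableOn ℂ (fun x => (f x).det) U := by
  rw [differentiableOn_matrix] at hf
  simp only [det_apply]
  refine DifferentiableOn.fun_sum fun σ _ => DifferentiableOn.const_smul ?_ _
  exact fun x hx => (HasFDerivWithinAt.finsetProd (g := fun i x => f x (σ i) i) fun i _ =>
    (hf (σ i) i x hx).hasFDerivWithinAt).differentiableWithinAt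

theorem DifferentiableOn.matrix_inv [DecidableEq m] {f : E → Matrix m m ℂ}
    (hf : DifferentiableOn ℂ f U) (h : ∀ x ∈ U, IsUnit (f x).det) :
    DifferentiableOn ℂ (fun x => (f x)⁻¹) U := by
  simp only [inv_def, Ring.inverse_eq_inv']
  refine (hf.matrix_det.inv fun x hx => (h x hx).ne_zero).smul ?_
  rw [differentiableOn_matrix] at hf
  refine differentiableOn_matrix.2 fun i j => ?_
  simp only [adjugate_apply]
  refine DifferentiableOn.matrix_det (differentiableOn_matrix.2 fun i' j' => ?_)
  by_cases h' : i' = j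
  · subst h'; simp
  · simpa [updateRow_ne h'] using hf i' j'

theorem det_mul_mul [DecidableEq m] [DecidableEq n] (A : Matrix m m ℂ) (B : Matrix n n ℂ)
    (L : Matrix m n ℂ →L[ℂ] Matrix m n ℂ) (h : ∀ V, L V = A * V * B) :
    L.det = A.det ^ Fintype.card n * B.det ^ Fintype.card m := by
  let e : Matrix m n ℂ ≃ₗ[ℂ] (n × m → ℂ) :=
    LinearEquiv.ofBijective ⟨⟨vec, fun _ _ => rfl⟩, fun _ _ => rfl⟩ vec_bijective
  have h1 : e.toLinearMap ∘ₗ L.toLinearMap ∘ₗ e.symm.toLinearMap =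
      Matrix.toLin' (kroneckerMap (fun x y => x * y) Bᵀ A) := by
    refine LinearMap.ext fun v => ?_
    obtain ⟨V, rfl⟩ := e.surjective v
    have h2 : e (L V) = kroneckerMap (fun x y => x * y) Bᵀ A *ᵥ e V := by
      rw [h]
      change vec (A * V * B) = kroneckerMap (fun x y => x * y) Bᵀ A *ᵥ vec V
      rw [kronecker_mulVec_vec, transpose_transpose]
    simpa using h2
  rw [ContinuousLinearMap.det, ← LinearMap.det_conj _ e, h1, LinearMap.det_toLin',
    det_kronecker, det_transpose, mul_comm]

theorem fderiv_apply_of_eqOn {f : Matrix m n ℂ → Matrix m n ℂ} {A : Matrix m n ℂ → Matrix m m ℂ}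
    {B : Matrix n n ℂ} {c z : Matrix m n ℂ} {Ω : Set (Matrix m n ℂ)} (hΩ : IsOpen Ω) (hz : z ∈ Ω)
    (hf : ∀ Z ∈ Ω, f Z = c + A Z * (Z - z) * B) (hA : DifferentiableOn ℂ A Ω)
    (V : Matrix m n ℂ) : fderiv ℂ f z V = A z * V * B := by
  have hd : DifferentiableOn ℂ f Ω := by
    refine DifferentiableOn.congr ?_ hf
    exact ((hA.matrix_mul (differentiableOn_id.sub_const z)).matrix_mul
      (differentiableOn_const B)).const_add c
  have h1 : HasDerivAt (fun ζ : ℂ => z + ζ • V) V 0 := by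
    have h0 := ((hasDerivAt_id (0 : ℂ)).smul_const V).const_add z
    rw [one_smul] at h0
    exact h0
  have h2 : HasFDerivAt f (fderiv ℂ f z) (z + (0 : ℂ) • V) := by
    rw [zero_smul, add_zero]
    exact (hd.differentiableAt (hΩ.mem_nhds hz)).hasFDerivAt
  have h3 := h2.comp_hasDerivAt (0 : ℂ) h1
  have hm : z + (0 : ℂ) • V ∈ Ω := by simpa using hz
  have h4 : (f ∘ fun ζ : ℂ => z + ζ • V) =ᶠ[nhds 0]
      fun ζ => c + ζ • (A (z + ζ • V) * V * B) := by
    filter_upwards [h1.continuousAt.eventually (hΩ.mem_nhds hm)] with ζ hζ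
    simp [hf _ hζ]
  have h5 : DifferentiableAt ℂ (fun ζ : ℂ => A (z + ζ • V) * V * B) 0 := by
    have hU : IsOpen ((fun ζ : ℂ => z + ζ • V) ⁻¹' Ω) := hΩ.preimage (by fun_prop)
    have h6 : DifferentiableOn ℂ (fun ζ : ℂ => A (z + ζ • V)) ((fun ζ : ℂ => z + ζ • V) ⁻¹' Ω) :=
      hA.comp (by fun_prop) fun x hx => hx
    exact ((h6.matrix_mul (differentiableOn_const V)).matrix_mul
      (differentiableOn_const B)).differentiableAt (hU.mem_nhds hm)
  have h7 : HasDerivAt (fun ζ : ℂ => c + ζ • (A (z + ζ • V) * V * B)) (A z * V * B) 0 := by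
    have h8 := ((hasDerivAt_id (0 : ℂ)).smul h5.hasDerivAt).const_add c
    simp only [id, zero_smul, one_smul, add_zero, zero_add] at h8
    exact h8
  exact (h4.hasDerivAt_iff.1 h3).unique h7

end MatrixCalculus

section Moebius

variable {m n : Type*} [Fintype m] [Fintype n] [DecidableEq m] [DecidableEq n]

/-- The generalized Möbius transformation `Z ↦ (P + ZQ)⁻¹(R + ZS)`. -/
def moebius (P : Matrix m m ℂ) (Q : Matrix n m ℂ) (R : Matrix m n ℂ) (S : Matrix n n ℂ)
    (Z : Matrix m n ℂ) : Matrix m n ℂ :=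
  (P + Z * Q)⁻¹ * (R + Z * S)

/-- The block matrix with rows `(P, R)` and `(Q, S)` preserves the indefinite form of
signature `(m, n)`. -/
structure IsPseudoUnitary (P : Matrix m m ℂ) (Q : Matrix n m ℂ) (R : Matrix m n ℂ)
    (S : Matrix n n ℂ) : Prop where
  left : P * Pᴴ - R * Rᴴ = 1
  right : Q * Qᴴ - S * Sᴴ = -1
  cross : P * Qᴴ = R * Sᴴ

variable {P : Matrix m m ℂ} {Q : Matrix n m ℂ} {R : Matrix m n ℂ} {S : Matrix n n ℂ}
variable {Z : Matrix m n ℂ}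

theorem IsPseudoUnitary.gram (h : IsPseudoUnitary P Q R S) (Z : Matrix m n ℂ) :
    (P + Z * Q) * (P + Z * Q)ᴴ - (R + Z * S) * (R + Z * S)ᴴ = 1 - Z * Zᴴ := by
  have hc : Q * Pᴴ = S * Rᴴ := by
    simpa using congrArg conjTranspose h.cross
  have : (P + Z * Q) * (P + Z * Q)ᴴ - (R + Z * S) * (R + Z * S)ᴴ =
      (P * Pᴴ - R * Rᴴ) + (P * Qᴴ - R * Sᴴ) * Zᴴ + Z * (Q * Pᴴ - S * Rᴴ) +
        Z * (Q * Qᴴ - S * Sᴴ) * Zᴴ := by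
    simp only [conjTranspose_add, conjTranspose_mul]
    simp only [Matrix.mul_add, Matrix.add_mul, Matrix.mul_sub, Matrix.sub_mul, Matrix.mul_assoc]
    abel
  rw [this, h.left, h.right, h.cross, hc]
  simp [sub_eq_add_neg]

theorem IsPseudoUnitary.isUnit_det (h : IsPseudoUnitary P Q R S) (hZ : (1 - Z * Zᴴ).PosDef) :
    IsUnit (P + Z * Q).det := by
  have h1 : ((P + Z * Q) * (P + Z * Q)ᴴ).PosDef := by
    rw [sub_eq_iff_eq_add.1 (h.gram Z)]
    exact hZ.add_posSemidef (posSemidef_self_mul_conjTranspose _)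
  have h2 := (isUnit_iff_isUnit_det _).1 h1.isUnit
  rw [det_mul] at h2
  exact isUnit_of_mul_isUnit_left h2

theorem IsPseudoUnitary.one_sub_moebius (h : IsPseudoUnitary P Q R S)
    (hZ : (1 - Z * Zᴴ).PosDef) :
    1 - moebius P Q R S Z * (moebius P Q R S Z)ᴴ =
      (P + Z * Q)⁻¹ * (1 - Z * Zᴴ) * ((P + Z * Q)⁻¹)ᴴ := by
  have hY := h.isUnit_det hZ
  have h1 : (P + Z * Q)⁻¹ * ((P + Z * Q) * (P + Z * Q)ᴴ) * ((P + Z * Q)⁻¹)ᴴ = 1 := by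
    rw [nonsing_inv_mul_cancel_left _ _ hY, ← conjTranspose_mul, nonsing_inv_mul _ hY,
      conjTranspose_one]
  rw [← h.gram Z, mul_sub, sub_mul, h1, moebius, conjTranspose_mul]
  simp only [Matrix.mul_assoc]

theorem IsPseudoUnitary.posDef_moebius (h : IsPseudoUnitary P Q R S)
    (hZ : (1 - Z * Zᴴ).PosDef) :
    (1 - moebius P Q R S Z * (moebius P Q R S Z)ᴴ).PosDef := by
  rw [h.one_sub_moebius hZ]
  refine hZ.mul_mul_conjTranspose_same ?_
  exact vecMul_injective_of_isUnit
    ((isUnit_iff_isUnit_det _).2 (isUnit_nonsing_inv_det _ (h.isUnit_det hZ)))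

theorem IsPseudoUnitary.inv_one_sub_moebius (h : IsPseudoUnitary P Q R S)
    (hZ : (1 - Z * Zᴴ).PosDef) :
    (1 - moebius P Q R S Z * (moebius P Q R S Z)ᴴ)⁻¹ =
      (P + Z * Q)ᴴ * (1 - Z * Zᴴ)⁻¹ * (P + Z * Q) := by
  have hY := h.isUnit_det hZ
  rw [h.one_sub_moebius hZ, Matrix.mul_inv_rev, Matrix.mul_inv_rev, nonsing_inv_nonsing_inv _ hY,
    conjTranspose_nonsing_inv,
      nonsing_inv_nonsing_inv _ (by rw [det_conjTranspose]; exact hY.star), Matrix.mul_assoc]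

theorem IsPseudoUnitary.conj_inv_one_sub_moebius (h : IsPseudoUnitary P Q R S)
    (hZ : (1 - Z * Zᴴ).PosDef) :
    (moebius P Q R S Z)ᴴ * (1 - moebius P Q R S Z * (moebius P Q R S Z)ᴴ)⁻¹ *
        moebius P Q R S Z =
      (R + Z * S)ᴴ * (1 - Z * Zᴴ)⁻¹ * (R + Z * S) := by
  have hY := h.isUnit_det hZ
  have h1 : (P + Z * Q) * moebius P Q R S Z = R + Z * S :=
    mul_nonsing_inv_cancel_left _ _ hY
  rw [h.inv_one_sub_moebius hZ, ← h1, conjTranspose_mul]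
  simp only [Matrix.mul_assoc]

theorem IsPseudoUnitary.mapsTo {r s : ℕ} {P : Matrix (Fin r) (Fin r) ℂ} {Q R}
    {S : Matrix (Fin s) (Fin s) ℂ} (h : IsPseudoUnitary P Q R S) :
    Set.MapsTo (moebius P Q R S) (OmegaI r s) (OmegaI r s) :=
  fun _ hZ => h.posDef_moebius hZ

theorem IsPseudoUnitary.differentiableOn_inv {r s : ℕ} {P : Matrix (Fin r) (Fin r) ℂ} {Q R}
    {S : Matrix (Fin s) (Fin s) ℂ} (h : IsPseudoUnitary P Q R S) :
    DifferentiableOn ℂ (fun Z => (P + Z * Q)⁻¹) (OmegaI r s) :=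
  ((differentiableOn_id.matrix_mul (differentiableOn_const Q)).const_add P).matrix_inv
    fun _ hZ => h.isUnit_det hZ

theorem IsPseudoUnitary.differentiableOn {r s : ℕ} {P : Matrix (Fin r) (Fin r) ℂ} {Q R}
    {S : Matrix (Fin s) (Fin s) ℂ} (h : IsPseudoUnitary P Q R S) :
    DifferentiableOn ℂ (moebius P Q R S) (OmegaI r s) :=
  h.differentiableOn_inv.matrix_mul
    ((differentiableOn_id.matrix_mul (differentiableOn_const S)).const_add R)

open scoped MatrixOrder in
theorem Matrix.PosDef.exists_conjTranspose_mul_self {A : Matrix m m ℂ} (hA : A.PosDef) :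
    ∃ B : Matrix m m ℂ, Bᴴ * B = A := by
  obtain ⟨B, hB⟩ := CStarAlgebra.nonneg_iff_eq_star_mul_self.mp hA.posSemidef.nonneg
  exact ⟨B, hB.symm⟩

/-- Square roots attached to a point of the type I domain. -/
theorem exists_moebius_data {p : Matrix m n ℂ} (hp : (1 - p * pᴴ).PosDef) :
    ∃ (P : Matrix m m ℂ) (S : Matrix n n ℂ),
      Pᴴ * P * (1 - p * pᴴ) = 1 ∧ Sᴴ * S * (1 - pᴴ * p) = 1 ∧
      P * (1 - p * pᴴ) * Pᴴ = 1 ∧ S * (1 - pᴴ * p) * Sᴴ = 1 ∧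
      Sᴴ * S = 1 + pᴴ * (Pᴴ * P) * p := by
  obtain ⟨P, hP⟩ := hp.inv.exists_conjTranspose_mul_self
  have hM : (1 - p * pᴴ)⁻¹ * (1 - p * pᴴ) = 1 :=
    nonsing_inv_mul _ ((isUnit_iff_isUnit_det _).1 hp.isUnit)
  have hM' : (1 - p * pᴴ) * (1 - p * pᴴ)⁻¹ = 1 :=
    mul_nonsing_inv _ ((isUnit_iff_isUnit_det _).1 hp.isUnit)
  have hN : (1 + pᴴ * (1 - p * pᴴ)⁻¹ * p).PosDef :=
    PosDef.one.add_posSemidef (hp.inv.posSemidef.conjTranspose_mul_mul_same p)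
  obtain ⟨S, hS⟩ := hN.exists_conjTranspose_mul_self
  have h1 : Pᴴ * P * (1 - p * pᴴ) = 1 := by rw [hP, hM]
  have h2 : Sᴴ * S * (1 - pᴴ * p) = 1 := by
    rw [hS, mul_eq_one_comm]
    have : (1 - pᴴ * p) * (1 + pᴴ * (1 - p * pᴴ)⁻¹ * p) =
        1 - pᴴ * p + pᴴ * ((1 - p * pᴴ) * (1 - p * pᴴ)⁻¹) * p := by
          simp only [Matrix.mul_add, Matrix.mul_sub, Matrix.sub_mul,
            Matrix.mul_assoc, Matrix.mul_one, Matrix.one_mul]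
    rw [this, hM']
    simp
  refine ⟨P, S, h1, h2, ?_, ?_, by rw [hS, hP]⟩
  · rw [mul_eq_one_comm, ← Matrix.mul_assoc, h1]
  · rw [mul_eq_one_comm, ← Matrix.mul_assoc, h2]

theorem norm_det_sq_mul {A B : Matrix m m ℂ} (h : Aᴴ * A * B = 1) : ‖A.det‖ ^ 2 * ‖B.det‖ = 1 := by
  have := congrArg (fun X => ‖X.det‖) h
  simp only [det_mul, det_conjTranspose, norm_mul, norm_star, det_one, norm_one] at this
  rw [sq, this]

/-- The domain is homogeneous: there is a Möbius transformation moving the origin to a prescribed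
point, with explicit Jacobian determinant at the origin. -/
theorem exists_moebius_zero {r s : ℕ} {p : Matrix (Fin r) (Fin s) ℂ} (hp : p ∈ OmegaI r s) :
    ∃ P Q R S, IsPseudoUnitary P Q R S ∧ moebius P Q R S 0 = p ∧
      ‖(fderiv ℂ (moebius P Q R S) 0).det‖ ^ 2 = ‖(1 - p * pᴴ).det‖ ^ (r + s) ∧
      Pᴴ * P = 1 + Qᴴ * Q ∧ Sᴴ * S = 1 + Rᴴ * R := by
  obtain ⟨P, S, h1, h2, h3, h4, h5⟩ := exists_moebius_data hp
  have hPU : IsUnit P.det := by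
    have := congrArg det h3
    rw [det_mul, det_mul, det_one, mul_assoc] at this
    exact IsUnit.of_mul_eq_one _ this
  have hr : IsPseudoUnitary P (S * pᴴ) (P * p) S := by
    refine ⟨?_, ?_, ?_⟩
    · rw [← h3, conjTranspose_mul]
      simp only [Matrix.mul_sub, Matrix.sub_mul, Matrix.mul_assoc, Matrix.mul_one]
    · rw [← h4, conjTranspose_mul, conjTranspose_conjTranspose]
      simp only [Matrix.mul_sub, Matrix.sub_mul, Matrix.mul_assoc, Matrix.mul_one]
      abel
    · rw [conjTranspose_mul, conjTranspose_conjTranspose]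
      simp only [Matrix.mul_assoc]
  refine ⟨P, S * pᴴ, P * p, S, hr, ?_, ?_, ?_, ?_⟩
  rotate_left 2
  · have h1' : (1 - p * pᴴ) * (Pᴴ * P) = 1 := mul_eq_one_comm.1 h1
    have e1 : (S * pᴴ)ᴴ * (S * pᴴ) = p * (Sᴴ * S) * pᴴ := by
      simp only [conjTranspose_mul, conjTranspose_conjTranspose, Matrix.mul_assoc]
    have e2 : 1 + p * (1 + pᴴ * (Pᴴ * P) * p) * pᴴ = 1 + p * pᴴ +
        (Pᴴ * P - (1 - p * pᴴ) * (Pᴴ * P)) * (p * pᴴ) := by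
      simp only [Matrix.mul_add, Matrix.add_mul, Matrix.sub_mul,
        Matrix.mul_assoc, Matrix.mul_one, Matrix.one_mul]
      abel
    have e3 : (Pᴴ * P) * (p * pᴴ) = Pᴴ * P - 1 := by
      rw [← h1]
      simp only [Matrix.mul_sub, Matrix.mul_assoc, Matrix.mul_one]
      abel
    rw [e1, h5, e2, h1', Matrix.sub_mul, e3, Matrix.one_mul]
    abel
  · rw [h5, conjTranspose_mul]
    simp only [Matrix.mul_assoc]
  · simp [moebius, nonsing_inv_mul_cancel_left _ _ hPU]
  have h6 : ∀ Z ∈ OmegaI r s, moebius P (S * pᴴ) (P * p) S Z =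
      p + (P + Z * (S * pᴴ))⁻¹ * (Z - 0) * (S * (1 - pᴴ * p)) := by
    intro Z hZ
    have hY := hr.isUnit_det hZ
    have : P * p + Z * S = (P + Z * (S * pᴴ)) * p + Z * (S * (1 - pᴴ * p)) := by
      simp only [Matrix.add_mul, Matrix.mul_sub, Matrix.mul_assoc, Matrix.mul_one]
      abel
    rw [moebius, this, Matrix.mul_add, nonsing_inv_mul_cancel_left _ _ hY, sub_zero,
      Matrix.mul_assoc]
  have h7 := det_mul_mul _ _ _ (fderiv_apply_of_eqOn (isOpen_OmegaI r s) (zero_mem_OmegaI r s) h6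
    hr.differentiableOn_inv)
  have h8 : (P + (0 : Matrix (Fin r) (Fin s) ℂ) * (S * pᴴ))⁻¹ = P⁻¹ := by simp
  rw [h7, h8, Fintype.card_fin, Fintype.card_fin, det_nonsing_inv, Ring.inverse_eq_inv']
  have h9 := norm_det_sq_mul h1
  have h10 := norm_det_sq_mul h2
  have h11 : (1 - pᴴ * p).det = (1 - p * pᴴ).det := det_one_sub_mul_comm _ _
  rw [h11] at h10
  simp only [det_mul, norm_mul, norm_pow, norm_inv, h11]
  set a := ‖P.det‖
  set b := ‖S.det‖
  set d := ‖(1 - p * pᴴ).det‖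
  have ha : (a⁻¹) ^ 2 = d := by
    rw [inv_pow]; exact inv_eq_of_mul_eq_one_right h9
  have hb : (b * d) ^ 2 = d := by linear_combination d * h10
  calc ((a⁻¹) ^ s * (b * d) ^ r) ^ 2 = ((a⁻¹) ^ 2) ^ s * ((b * d) ^ 2) ^ r := by ring
    _ = _ := by rw [ha, hb]; ring

/-- The domain is homogeneous: there is a Möbius transformation moving a prescribed point to the
origin, with explicit Jacobian determinant at that point. -/
theorem exists_moebius_eq_zero {r s : ℕ} {p : Matrix (Fin r) (Fin s) ℂ} (hp : p ∈ OmegaI r s) :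
    ∃ P Q R S, IsPseudoUnitary P Q R S ∧ moebius P Q R S p = 0 ∧
      ‖(fderiv ℂ (moebius P Q R S) p).det‖ ^ 2 * ‖(1 - p * pᴴ).det‖ ^ (r + s) = 1 := by
  obtain ⟨P, S, h1, h2, h3, h4, h5⟩ := exists_moebius_data hp
  have h1' : (1 - p * pᴴ) * (Pᴴ * P) = 1 := mul_eq_one_comm.1 h1
  have hr : IsPseudoUnitary Pᴴ (-(pᴴ * Pᴴ)) (-(p * Sᴴ)) Sᴴ := by
    refine ⟨?_, ?_, ?_⟩
    · have e1 : Pᴴ * Pᴴᴴ - -(p * Sᴴ) * (-(p * Sᴴ))ᴴ = Pᴴ * P - p * (Sᴴ * S) * pᴴ := by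
        simp only [conjTranspose_neg, conjTranspose_mul, conjTranspose_conjTranspose]
        simp only [Matrix.mul_neg, Matrix.neg_mul, Matrix.mul_assoc, neg_neg]
      rw [e1, h5]
      have e2 : Pᴴ * P - p * (1 + pᴴ * (Pᴴ * P) * p) * pᴴ =
        (1 - p * pᴴ) * (Pᴴ * P) - p * pᴴ + p * pᴴ * (Pᴴ * P * (1 - p * pᴴ)) := by
          simp only [Matrix.mul_add, Matrix.add_mul, Matrix.mul_sub, Matrix.sub_mul,
            Matrix.mul_assoc, Matrix.mul_one, Matrix.one_mul]
          abel
      rw [e2, h1, h1']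
      simp only [Matrix.mul_one]
      abel
    · simp only [conjTranspose_neg, conjTranspose_mul, conjTranspose_conjTranspose, h5]
      simp only [Matrix.mul_neg, Matrix.neg_mul, Matrix.mul_assoc, neg_neg]
      abel
    · have e1 : Pᴴ * (-(pᴴ * Pᴴ))ᴴ = - (1 * (Pᴴ * P) * p) := by
        simp only [conjTranspose_neg, conjTranspose_mul, conjTranspose_conjTranspose]
        simp only [Matrix.mul_neg, Matrix.mul_assoc, Matrix.one_mul]
      have e2 : -(p * Sᴴ) * Sᴴᴴ = -(p + p * pᴴ * (Pᴴ * P) * p) := by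
        rw [conjTranspose_conjTranspose, Matrix.neg_mul, Matrix.mul_assoc, h5]
        simp only [Matrix.mul_add, Matrix.mul_assoc, Matrix.mul_one]
      have e3 : p + p * pᴴ * (Pᴴ * P) * p =
          ((1 - p * pᴴ) * (Pᴴ * P)) * p + p * pᴴ * (Pᴴ * P) * p := by
        rw [h1', Matrix.one_mul]
      rw [e1, e2, e3]
      simp only [Matrix.sub_mul, Matrix.mul_assoc, Matrix.one_mul]
      abel
  refine ⟨Pᴴ, -(pᴴ * Pᴴ), -(p * Sᴴ), Sᴴ, hr, ?_, ?_⟩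
  · simp [moebius]
  have h6 : ∀ Z ∈ OmegaI r s, moebius Pᴴ (-(pᴴ * Pᴴ)) (-(p * Sᴴ)) Sᴴ Z =
      0 + (Pᴴ + Z * -(pᴴ * Pᴴ))⁻¹ * (Z - p) * Sᴴ := by
    intro Z hZ
    have : -(p * Sᴴ) + Z * Sᴴ = (Z - p) * Sᴴ := by
      simp only [Matrix.sub_mul]
      abel
    rw [moebius, this, zero_add, Matrix.mul_assoc]
  have h7 := det_mul_mul _ _ _ (fderiv_apply_of_eqOn (isOpen_OmegaI r s) hp h6
    hr.differentiableOn_inv)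
  have h8 : (Pᴴ + p * -(pᴴ * Pᴴ))⁻¹ = P := by
    refine inv_eq_left_inv ?_
    rw [← h3]
    simp only [Matrix.mul_add, Matrix.mul_sub, Matrix.sub_mul, Matrix.mul_neg,
      Matrix.mul_assoc, Matrix.mul_one]
    abel
  rw [h7, h8, Fintype.card_fin, Fintype.card_fin]
  have h9 := norm_det_sq_mul h1
  have h10 := norm_det_sq_mul h2
  have h11 : (1 - pᴴ * p).det = (1 - p * pᴴ).det := det_one_sub_mul_comm _ _
  rw [h11] at h10
  simp only [det_conjTranspose, norm_mul, norm_pow, norm_star]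
  set a := ‖P.det‖
  set b := ‖S.det‖
  set d := ‖(1 - p * pᴴ).det‖
  calc (a ^ s * b ^ r) ^ 2 * d ^ (r + s) = (a ^ 2 * d) ^ s * (b ^ 2 * d) ^ r := by ring
    _ = _ := by rw [h9, h10]; simp

end Moebius

section Jacobian

theorem det_fderiv_comp {E : Type*} [NormedAddCommGroup E] [NormedSpace ℂ E] {f g : E → E} {z : E}
    (hg : DifferentiableAt ℂ g (f z)) (hf : DifferentiableAt ℂ f z) :
    (fderiv ℂ (g ∘ f) z).det = (fderiv ℂ g (f z)).det * (fderiv ℂ f z).det := by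
  rw [fderiv_comp z hg hf]
  exact LinearMap.det_comp _ _

theorem det_fderiv_mul_det_fderiv_eq_one {E : Type*} [NormedAddCommGroup E] [NormedSpace ℂ E]
    {f g : E → E} {z : E} (hg : DifferentiableAt ℂ g (f z)) (hf : DifferentiableAt ℂ f z)
    (h : g ∘ f =ᶠ[nhds z] id) : (fderiv ℂ g (f z)).det * (fderiv ℂ f z).det = 1 := by
  rw [← det_fderiv_comp hg hf, h.fderiv_eq, fderiv_id]
  exact LinearMap.det_id

variable {r s : ℕ}

/-- Schwarz–Pick inequality for Jacobian determinants of self-maps of the type I domain. -/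
theorem norm_det_fderiv_sq_mul_le {f : Matrix (Fin r) (Fin s) ℂ → Matrix (Fin r) (Fin s) ℂ}
    (hf : Set.MapsTo f (OmegaI r s) (OmegaI r s)) (hd : DifferentiableOn ℂ f (OmegaI r s))
    {z : Matrix (Fin r) (Fin s) ℂ} (hz : z ∈ OmegaI r s) :
    ‖(fderiv ℂ f z).det‖ ^ 2 * ‖(1 - z * zᴴ).det‖ ^ (r + s) ≤
      ‖(1 - f z * (f z)ᴴ).det‖ ^ (r + s) := by
  obtain ⟨P, Q, R, S, hφ, hφ0, hφd, -, -⟩ := exists_moebius_zero hz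
  obtain ⟨P', Q', R', S', hχ, hχ0, hχd⟩ := exists_moebius_eq_zero (hf hz)
  set φ := moebius P Q R S
  set χ := moebius P' Q' R' S'
  have hΩ := isOpen_OmegaI r s
  have h0 := zero_mem_OmegaI r s
  have d1 : DifferentiableAt ℂ φ 0 := hφ.differentiableOn.differentiableAt (hΩ.mem_nhds h0)
  have d2 : DifferentiableAt ℂ f (φ 0) := by
    rw [hφ0]; exact hd.differentiableAt (hΩ.mem_nhds hz)
  have d3 : DifferentiableAt ℂ χ ((f ∘ φ) 0) := by
    rw [Function.comp_apply, hφ0]; exact hχ.differentiableOn.differentiableAt (hΩ.mem_nhds (hf hz))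
  have h1 := norm_det_fderiv_le_one hΩ (isBounded_OmegaI r s) h0
    (hχ.mapsTo.comp (hf.comp hφ.mapsTo))
    (hχ.differentiableOn.comp (hd.comp hφ.differentiableOn hφ.mapsTo) (hf.comp hφ.mapsTo))
    (by change χ (f (φ 0)) = 0; rw [hφ0, hχ0])
  rw [det_fderiv_comp d3 (d2.comp 0 d1), det_fderiv_comp d2 d1, Function.comp_apply, hφ0,
    norm_mul, norm_mul] at h1
  set a := ‖(fderiv ℂ χ (f z)).det‖
  set b := ‖(fderiv ℂ f z).det‖
  set c := ‖(fderiv ℂ φ 0).det‖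
  have h2 : (a * (b * c)) ^ 2 ≤ 1 := pow_le_one₀ (by positivity) h1
  rw [← hφd]
  set e := ‖(1 - f z * (f z)ᴴ).det‖ ^ (r + s)
  have he : 0 ≤ e := by positivity
  calc b ^ 2 * c ^ 2 = (a ^ 2 * e) * (b ^ 2 * c ^ 2) := by rw [hχd, one_mul]
    _ = e * (a * (b * c)) ^ 2 := by ring
    _ ≤ e * 1 := by gcongr
    _ = e := mul_one e

/-- Transformation law of `det (1 - ZZᴴ)` under automorphisms of the type I domain. -/
theorem IsAutomorphismOf.norm_det_fderiv_sq_mul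
    {f : Matrix (Fin r) (Fin s) ℂ → Matrix (Fin r) (Fin s) ℂ}
    (hf : IsAutomorphismOf (OmegaI r s) f) {z : Matrix (Fin r) (Fin s) ℂ}
    (hz : z ∈ OmegaI r s) :
    ‖(fderiv ℂ f z).det‖ ^ 2 * ‖(1 - z * zᴴ).det‖ ^ (r + s) =
      ‖(1 - f z * (f z)ᴴ).det‖ ^ (r + s) := by
  obtain ⟨hm, hd, g, hgm, hgd, hgf, hfg⟩ := hf
  have hΩ := isOpen_OmegaI r s
  have h1 := norm_det_fderiv_sq_mul_le hm hd hz
  have h2 := norm_det_fderiv_sq_mul_le hgm hgd (hm hz)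
  rw [hgf z hz] at h2
  have h3 : (fderiv ℂ g (f z)).det * (fderiv ℂ f z).det = 1 := by
    exact det_fderiv_mul_det_fderiv_eq_one
      (hgd.differentiableAt (hΩ.mem_nhds (hm hz))) (hd.differentiableAt (hΩ.mem_nhds hz))
      (by filter_upwards [hΩ.mem_nhds hz] with x hx using hgf x hx)
  have h4 := congrArg norm h3
  rw [norm_mul, norm_one] at h4
  refine le_antisymm h1 ?_
  set a := ‖(fderiv ℂ g (f z)).det‖
  set b := ‖(fderiv ℂ f z).det‖
  have h5 := mul_le_mul_of_nonneg_left h2 (sq_nonneg b)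
  calc _ = (a * b) ^ 2 * ‖(1 - f z * (f z)ᴴ).det‖ ^ (r + s) := by rw [h4]; ring
    _ = b ^ 2 * (a ^ 2 * ‖(1 - f z * (f z)ᴴ).det‖ ^ (r + s)) := by ring
    _ ≤ _ := h5

end Jacobian

section BlockMap

variable {m n : Type*} [Fintype m] [Fintype n] [DecidableEq m] [DecidableEq n]

/-- The family `Gmap` written in block form, with a redundant zero row. -/
def blockMap (i : m) (j : n) (t : ℝ) (Z : Matrix m n ℂ) : Matrix (m ⊕ m) (n ⊕ n) ℂ :=
  fromBlocks ((√t : ℂ) • (Z * single j i (1 : ℂ) * Z))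
    (Z * (1 - single j j (1 : ℂ) + single j j (√(1 - t) : ℂ)))
    ((1 - single i i (1 : ℂ)) * Z) 0

theorem sq_ofReal_sqrt {t : ℝ} (ht : 0 ≤ t) : (√t : ℂ) * (√t : ℂ) = t := by
  rw [← Complex.ofReal_mul, Real.mul_self_sqrt ht]

theorem one_sub_fromBlocks (A : Matrix m m ℂ) (B : Matrix m n ℂ) (C : Matrix n m ℂ)
    (D : Matrix n n ℂ) : 1 - fromBlocks A B C D = fromBlocks (1 - A) (-B) (-C) (1 - D) := by
  rw [← fromBlocks_one, sub_eq_add_neg, fromBlocks_neg, fromBlocks_add]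
  simp only [zero_add, sub_eq_add_neg]

theorem one_sub_blockMap_mul_conjTranspose (i : m) (j : n) {t : ℝ} (h0 : 0 ≤ t) (h1 : t ≤ 1)
    (Z : Matrix m n ℂ) :
    1 - blockMap i j t Z * (blockMap i j t Z)ᴴ =
      fromBlocks ((1 - Z * Zᴴ) + (t : ℂ) • (Z * single j i (1 : ℂ) * (1 - Z * Zᴴ) *
        single i j (1 : ℂ) * Zᴴ))
        ((√t : ℂ) • (Z * single j i (1 : ℂ) * (1 - Z * Zᴴ) * (1 - single i i (1 : ℂ))))
        ((√t : ℂ) • ((1 - single i i (1 : ℂ)) * (1 - Z * Zᴴ) * single i j (1 : ℂ) * Zᴴ))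
        (single i i (1 : ℂ) + (1 - single i i (1 : ℂ)) * (1 - Z * Zᴴ) *
          (1 - single i i (1 : ℂ))) := by
  have hT : (1 - single j j (1 : ℂ) + single j j (√(1 - t) : ℂ)) *
      (1 - single j j (1 : ℂ) + single j j (√(1 - t) : ℂ)) = 1 - (t : ℂ) • single j j (1 : ℂ) := by
    simp only [Matrix.mul_add, Matrix.add_mul, Matrix.mul_sub, Matrix.sub_mul,
      single_mul_single_same,
      sq_ofReal_sqrt (sub_nonneg.2 h1), smul_single, smul_eq_mul,
      mul_one, one_mul]
    ext a b
    simp only [Matrix.sub_apply, Matrix.add_apply, single_apply]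
    split_ifs <;> push_cast <;> ring
  have hTs : (1 - single j j (1 : ℂ) + single j j (√(1 - t) : ℂ))ᴴ =
      1 - single j j (1 : ℂ) + single j j (√(1 - t) : ℂ) := by
    simp [conjTranspose_single]
  have hji : Z * (single j i (1 : ℂ) * (single i j (1 : ℂ) * Zᴴ)) =
      Z * (single j j (1 : ℂ) * Zᴴ) := by
    rw [← Matrix.mul_assoc (single j i (1 : ℂ)), single_mul_single_same, mul_one]
  rw [blockMap, fromBlocks_conjTranspose, fromBlocks_multiply, one_sub_fromBlocks]
  congr 1
  · rw [conjTranspose_mul Z (1 - single j j (1 : ℂ) + single j j (√(1 - t) : ℂ)), hTs,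
      ← Matrix.mul_assoc, Matrix.mul_assoc Z (1 - single j j (1 : ℂ) + single j j (√(1 - t) : ℂ)),
        hT]
    simp only [conjTranspose_smul, conjTranspose_mul, conjTranspose_single, star_one,
      Complex.star_def, Complex.conj_ofReal, Matrix.smul_mul, Matrix.mul_smul, smul_smul,
      sq_ofReal_sqrt h0, Matrix.mul_sub, Matrix.sub_mul, Matrix.mul_assoc, Matrix.mul_one,
      smul_sub, hji]
    abel
  · have h2 : single j i (1 : ℂ) * (1 - Z * Zᴴ) * (1 - single i i (1 : ℂ)) =
        -(single j i (1 : ℂ) * (Z * Zᴴ) * (1 - single i i (1 : ℂ))) := by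
      have : single j i (1 : ℂ) * (1 - single i i (1 : ℂ)) = 0 := by simp [Matrix.mul_sub]
      rw [Matrix.mul_sub (single j i (1 : ℂ)), Matrix.sub_mul, Matrix.mul_one, this, zero_sub]
    simp only [conjTranspose_mul, conjTranspose_single, star_one,
      conjTranspose_sub, conjTranspose_one, conjTranspose_zero, Matrix.mul_zero, add_zero]
    rw [Matrix.mul_assoc Z _ (1 - Z * Zᴴ), Matrix.mul_assoc Z _ (1 - single i i (1 : ℂ)), h2,
      Matrix.mul_neg, smul_neg, Matrix.smul_mul]
    simp only [Matrix.mul_assoc]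
  · have h2 : (1 - single i i (1 : ℂ)) * (1 - Z * Zᴴ) * single i j (1 : ℂ) =
        -((1 - single i i (1 : ℂ)) * (Z * Zᴴ) * single i j (1 : ℂ)) := by
      have : (1 - single i i (1 : ℂ)) * single i j (1 : ℂ) = 0 := by simp [Matrix.sub_mul]
      rw [Matrix.mul_sub _ 1 (Z * Zᴴ), Matrix.sub_mul, Matrix.mul_one, this, zero_sub]
    simp only [conjTranspose_smul, conjTranspose_mul, conjTranspose_single, star_one,
      Complex.star_def, Complex.conj_ofReal, Matrix.zero_mul, add_zero]
    rw [h2, Matrix.neg_mul, smul_neg, Matrix.mul_smul]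
    simp only [Matrix.mul_assoc]
  · simp only [conjTranspose_mul, conjTranspose_sub, conjTranspose_one, conjTranspose_single,
      star_one, Matrix.zero_mul, add_zero]
    simp only [Matrix.mul_sub, Matrix.sub_mul, Matrix.mul_assoc, Matrix.mul_one, Matrix.one_mul,
      single_mul_single_same, mul_one]
    abel

theorem det_single_add_compl (i : m) {M : Matrix m m ℂ} (hM : IsUnit M.det) :
    (single i i (1 : ℂ) + (1 - single i i (1 : ℂ)) * M * (1 - single i i (1 : ℂ))).det = M.det *
      M⁻¹ i i := by
  set E : Matrix m m ℂ := single i i (1 : ℂ) with hE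
  have hEE : E * E = E := by simp [hE]
  have hQE : (1 - E) * E = 0 := by simp [Matrix.sub_mul, hEE]
  have hEQ : E * (1 - E) = 0 := by simp [Matrix.mul_sub, hEE]
  have h1 : (1 + (1 - E) * M * E) * (E + (1 - E) * M * (1 - E)) = (1 - E) * M + E := by
    have : (1 + (1 - E) * M * E) * (E + (1 - E) * M * (1 - E)) =
        E + (1 - E) * M * (1 - E) + (1 - E) * M * (E * E) +
          (1 - E) * M * (E * (1 - E)) * M * (1 - E) := by noncomm_ring
    rw [this, hEE, hEQ]
    noncomm_ring
  have h2 : (1 + (1 - E) * M * E).det = 1 := by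
    rw [det_one_add_mul_comm, ← Matrix.mul_assoc, hEQ]
    simp
  have h3 : (1 - E) * M + E = M.updateRow i (Pi.single i 1) := by
    ext a b
    by_cases hab : a = i
    · subst hab
      simp [hE, Matrix.sub_mul, single_apply, Pi.single_apply, eq_comm]
    · simp [hE, Matrix.sub_mul, Ne.symm hab, single_mul_apply_of_ne, hab]
  have h4 := congrArg det h1
  rw [det_mul, h2, one_mul, h3, ← adjugate_apply] at h4
  rw [h4, inv_def, Matrix.smul_apply, smul_eq_mul, ← mul_assoc, Ring.mul_inverse_cancel _ hM,
    one_mul]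

theorem det_one_sub_blockMap (i : m) (j : n) {t : ℝ} (h0 : 0 ≤ t) (h1 : t ≤ 1)
    {Z : Matrix m n ℂ} (hZ : (1 - Z * Zᴴ).PosDef) :
    (1 - blockMap i j t Z * (blockMap i j t Z)ᴴ).det =
      (1 - Z * Zᴴ).det ^ 2 *
        ((1 - Z * Zᴴ : Matrix m m ℂ)⁻¹ i i +
          (t : ℂ) * (Zᴴ * (1 - Z * Zᴴ)⁻¹ * Z : Matrix n n ℂ) j j) := by
  rw [one_sub_blockMap_mul_conjTranspose i j h0 h1]
  generalize 1 - Z * Zᴴ = M at hZ ⊢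
  have hM : IsUnit M.det := (isUnit_iff_isUnit_det _).1 hZ.isUnit
  have hm : M⁻¹ i i ≠ 0 := hZ.inv.diag_pos.ne'
  have hN := det_single_add_compl i hM
  set E : Matrix m m ℂ := single i i (1 : ℂ) with hE
  set N := E + (1 - E) * M * (1 - E) with hNdef
  have hNU : IsUnit N.det := by
    rw [hN]; exact hM.mul hm.isUnit
  have := N.invertibleOfIsUnitDet hNU
  rw [det_fromBlocks₂₂, invOf_eq_nonsing_inv, hN]
  have hEE : E * E = E := by simp [hE]
  have hQE : (1 - E) * E = 0 := by simp [Matrix.sub_mul, hEE]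
  have hEME : E * M⁻¹ * E = M⁻¹ i i • E := by
    rw [hE, single_mul_mul_single]; simp [smul_single]
  have hU : N * ((1 - E) * M⁻¹ * E) = - (M⁻¹ i i • ((1 - E) * M * E)) := by
    have e1 : (1 - E) * M⁻¹ * E = M⁻¹ * E - M⁻¹ i i • E := by
      rw [Matrix.sub_mul, Matrix.sub_mul, hEME, Matrix.one_mul]
    have e2 : N * ((1 - E) * M⁻¹ * E) = (1 - E) * M * ((1 - E) * M⁻¹ * E) := by
      have : N * ((1 - E) * M⁻¹ * E) = E * M⁻¹ * E - (E * E) * M⁻¹ * E + (1 - E) * M * (1 - E) *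
        (1 - E) * M⁻¹ * E := by
        rw [hNdef]; noncomm_ring
      rw [this, hEE, sub_self, zero_add]
      have : (1 - E) * (1 - E) = 1 - E := by rw [Matrix.mul_sub, hQE]; simp
      rw [Matrix.mul_assoc _ (1 - E) (1 - E), this]
      simp only [Matrix.mul_assoc]
    rw [e2, e1, Matrix.mul_sub, Matrix.mul_assoc, mul_nonsing_inv_cancel_left _ _ hM, hQE, zero_sub,
      Matrix.mul_smul]
  have hNi : N⁻¹ * ((1 - E) * M * E) = - ((M⁻¹ i i)⁻¹ • ((1 - E) * M⁻¹ * E)) := by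
    have : (1 - E) * M * E = N * (- ((M⁻¹ i i)⁻¹ • ((1 - E) * M⁻¹ * E))) := by
      rw [Matrix.mul_neg, Matrix.mul_smul, hU, smul_neg, neg_neg, smul_smul, inv_mul_cancel₀ hm,
        one_smul]
    rw [this, nonsing_inv_mul_cancel_left _ _ hNU]
  have hS : M * E - M * (1 - E) * N⁻¹ * ((1 - E) * M * E) = (M⁻¹ i i)⁻¹ • E := by
    have e1 : M * (1 - E) * N⁻¹ * ((1 - E) * M * E) = - ((M⁻¹ i i)⁻¹ • (M * ((1 - E) * (1 - E) *
      M⁻¹ * E))) := by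
      rw [Matrix.mul_assoc _ N⁻¹, hNi]
      simp only [Matrix.mul_neg, Matrix.mul_smul, Matrix.mul_assoc]
    have : (1 - E) * (1 - E) = 1 - E := by rw [Matrix.mul_sub, hQE]; simp
    rw [e1, this, Matrix.sub_mul, Matrix.sub_mul, hEME, Matrix.mul_sub, Matrix.one_mul,
      mul_nonsing_inv_cancel_left _ _ hM, Matrix.mul_smul, smul_sub, smul_smul,
      inv_mul_cancel₀ hm, one_smul]
    abel
  have hEij : single i j (1 : ℂ) = E * single i j (1 : ℂ) := by simp [hE]
  have hSchur : M + (t : ℂ) • (Z * single j i (1 : ℂ) * M * single i j (1 : ℂ) * Zᴴ) -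
      ((√t : ℂ) • (Z * single j i (1 : ℂ) * M * (1 - E))) * N⁻¹ *
        ((√t : ℂ) • ((1 - E) * M * single i j (1 : ℂ) * Zᴴ)) =
      M + ((t : ℂ) * (M⁻¹ i i)⁻¹) • (Z * single j j (1 : ℂ) * Zᴴ) := by
    have e1 : (Z * single j i (1 : ℂ) * M * single i j (1 : ℂ) * Zᴴ) -
        (Z * single j i (1 : ℂ) * M * (1 - E)) * N⁻¹ * ((1 - E) * M * single i j (1 : ℂ) * Zᴴ) =
        Z * single j i (1 : ℂ) * (M * E - M * (1 - E) * N⁻¹ * ((1 - E) * M * E)) *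
          single i j (1 : ℂ) * Zᴴ := by
      conv_lhs => rw [hEij]
      rw [Matrix.mul_sub (Z * single j i (1 : ℂ)), Matrix.sub_mul _ _ (single i j (1 : ℂ)),
        Matrix.sub_mul _ _ Zᴴ]
      simp only [Matrix.mul_assoc]
    have e2 : Z * single j i (1 : ℂ) * E * single i j (1 : ℂ) = Z * single j j (1 : ℂ) := by
      rw [Matrix.mul_assoc, ← hEij, Matrix.mul_assoc, single_mul_single_same, mul_one]
    rw [hS] at e1
    simp only [Matrix.smul_mul, Matrix.mul_smul, smul_smul] at e1 ⊢
    rw [e2] at e1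
    rw [sq_ofReal_sqrt h0, add_sub_assoc, ← smul_sub, e1, smul_smul]
  rw [hSchur]
  have hrank : ((t : ℂ) * (M⁻¹ i i)⁻¹) • (Z * single j j (1 : ℂ) * Zᴴ) =
      (Z * single j j (1 : ℂ)) * (((t : ℂ) * (M⁻¹ i i)⁻¹) • (single j j (1 : ℂ) * Zᴴ)) := by
    rw [Matrix.mul_smul, ← Matrix.mul_assoc,
      Matrix.mul_assoc Z (single j j (1 : ℂ)) (single j j (1 : ℂ)),
      single_mul_single_same, mul_one]
  have hdet : (M + ((t : ℂ) * (M⁻¹ i i)⁻¹) • (Z * single j j (1 : ℂ) * Zᴴ)).det =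
      M.det * (1 + (t : ℂ) * (M⁻¹ i i)⁻¹ * (Zᴴ * M⁻¹ * Z) j j) := by
    have e1 : M + ((t : ℂ) * (M⁻¹ i i)⁻¹) • (Z * single j j (1 : ℂ) * Zᴴ) =
        M * (1 + (M⁻¹ * Z * single j j (1 : ℂ)) * (((t : ℂ) * (M⁻¹ i i)⁻¹) • (single j j (1 : ℂ) *
          Zᴴ))) := by
      rw [hrank, Matrix.mul_add, Matrix.mul_one, Matrix.mul_assoc M⁻¹, Matrix.mul_assoc M⁻¹,
        mul_nonsing_inv_cancel_left _ _ hM]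
    rw [e1, det_mul, det_one_add_mul_comm]
    have e2 : (((t : ℂ) * (M⁻¹ i i)⁻¹) • (single j j (1 : ℂ) * Zᴴ)) * (M⁻¹ * Z *
      single j j (1 : ℂ)) =
        single j j ((t : ℂ) * (M⁻¹ i i)⁻¹ * (Zᴴ * M⁻¹ * Z) j j) := by
      have : single j j (1 : ℂ) * Zᴴ * (M⁻¹ * Z * single j j (1 : ℂ)) =
          single j j (1 : ℂ) * (Zᴴ * M⁻¹ * Z) * single j j (1 : ℂ) := by
        simp only [Matrix.mul_assoc]
      rw [Matrix.smul_mul, this, single_mul_mul_single, smul_single]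
      simp
    rw [e2]
    have e3 : ∀ c : ℂ, 1 + single j j c = diagonal (Function.update (1 : n → ℂ) j (1 + c)) := by
      intro c
      ext a b
      by_cases hab : a = b
      · subst hab
        by_cases haj : a = j
        · subst haj; simp
        · simp [haj, Ne.symm haj]
      · simp [hab, single_apply]
        intro h1 h2; exact absurd (h1.symm.trans h2) hab
    rw [e3, det_diagonal, Finset.prod_update_of_mem (Finset.mem_univ j)]
    simp
  rw [hdet]
  field_simp

end BlockMap

section BlockMapPos

variable {m n : Type*} [Fintype m] [Fintype n] [DecidableEq m] [DecidableEq n]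

theorem ofReal_leftEntry {Z : Matrix m n ℂ} (hZ : (1 - Z * Zᴴ).PosDef) (i : m) :
    ((1 - Z * Zᴴ)⁻¹ : Matrix m m ℂ) i i = leftEntry i Z := by
  have h := Complex.le_def.1 (hZ.inv.posSemidef.diag_nonneg (i := i))
  exact Complex.ext rfl h.2.symm

theorem ofReal_rightEntry {Z : Matrix m n ℂ} (hZ : (1 - Z * Zᴴ).PosDef) (j : n) :
    (Zᴴ * (1 - Z * Zᴴ)⁻¹ * Z : Matrix n n ℂ) j j = rightEntry j Z := by
  have h := Complex.le_def.1
    ((hZ.inv.posSemidef.conjTranspose_mul_mul_same Z).diag_nonneg (i := j))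
  exact Complex.ext rfl h.2.symm

theorem leftEntry_pos {Z : Matrix m n ℂ} (hZ : (1 - Z * Zᴴ).PosDef) (i : m) :
    0 < leftEntry i Z :=
  (Complex.lt_def.1 (hZ.inv.diag_pos (i := i))).1

theorem norm_det_one_sub_blockMap (i : m) (j : n) {t : ℝ} (h0 : 0 ≤ t) (h1 : t ≤ 1)
    {Z : Matrix m n ℂ} (hZ : (1 - Z * Zᴴ).PosDef) :
    ‖(1 - blockMap i j t Z * (blockMap i j t Z)ᴴ).det‖ =
      ‖(1 - Z * Zᴴ).det‖ ^ 2 * (leftEntry i Z + t * rightEntry j Z) := by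
  rw [det_one_sub_blockMap i j h0 h1 hZ, ofReal_leftEntry hZ, ofReal_rightEntry hZ, norm_mul,
    norm_pow, ← Complex.ofReal_mul, ← Complex.ofReal_add, Complex.norm_real, Real.norm_of_nonneg
      (add_nonneg (leftEntry_nonneg hZ i) (mul_nonneg h0 (rightEntry_nonneg hZ j)))]

theorem fromRows_mul_mul_conjTranspose {l : Type*} (A B : Matrix l m ℂ) (M : Matrix m m ℂ) :
    fromRows A B * M * (fromRows A B)ᴴ =
      fromBlocks (A * M * Aᴴ) (A * M * Bᴴ) (B * M * Aᴴ) (B * M * Bᴴ) := by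
  rw [fromRows_mul, conjTranspose_fromRows_eq_fromCols_conjTranspose, fromRows_mul_fromCols]

theorem posDef_one_sub_blockMap (i : m) (j : n) {t : ℝ} (h0 : 0 ≤ t) (h1 : t ≤ 1)
    {Z : Matrix m n ℂ} (hZ : (1 - Z * Zᴴ).PosDef) :
    (1 - blockMap i j t Z * (blockMap i j t Z)ᴴ).PosDef := by
  have hps : (1 - blockMap i j t Z * (blockMap i j t Z)ᴴ).PosSemidef := by
    have e : 1 - blockMap i j t Z * (blockMap i j t Z)ᴴ =
        (fromRows 1 0 : Matrix (m ⊕ m) m ℂ) * (1 - Z * Zᴴ) * (fromRows 1 0 : Matrix (m ⊕ m) m ℂ)ᴴ +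
        (fromRows 0 1 : Matrix (m ⊕ m) m ℂ) * diagonal (Pi.single i (1 : ℂ)) *
          (fromRows 0 1 : Matrix (m ⊕ m) m ℂ)ᴴ +
        fromRows ((√t : ℂ) • (Z * single j i (1 : ℂ))) (1 - single i i (1 : ℂ)) * (1 - Z * Zᴴ) *
          (fromRows ((√t : ℂ) • (Z * single j i (1 : ℂ))) (1 - single i i (1 : ℂ)))ᴴ := by
      rw [one_sub_blockMap_mul_conjTranspose i j h0 h1, diagonal_single]
      simp only [fromRows_mul_mul_conjTranspose, fromBlocks_add, conjTranspose_smul,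
        conjTranspose_mul,
        conjTranspose_single, star_one, Complex.star_def, Complex.conj_ofReal, Matrix.smul_mul,
        Matrix.mul_smul, smul_smul, sq_ofReal_sqrt h0, conjTranspose_sub, conjTranspose_one,
        conjTranspose_zero, Matrix.mul_zero, Matrix.zero_mul, Matrix.mul_one, Matrix.one_mul,
        add_zero, zero_add]
      simp only [Matrix.mul_assoc]
    rw [e]
    refine ((hZ.posSemidef.mul_mul_conjTranspose_same _).add
      (PosSemidef.mul_mul_conjTranspose_same (PosSemidef.diagonal ?_) _)).add
      (hZ.posSemidef.mul_mul_conjTranspose_same _)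
    exact Pi.single_nonneg.2 zero_le_one
  rw [hps.posDef_iff_det_ne_zero, ← norm_ne_zero_iff, norm_det_one_sub_blockMap i j h0 h1 hZ]
  refine (mul_pos (pow_pos (norm_pos_iff.2 hZ.det_pos.ne') 2) ?_).ne'
  exact add_pos_of_pos_of_nonneg (leftEntry_pos hZ i) (mul_nonneg h0 (rightEntry_nonneg hZ j))

end BlockMapPos

section Reindex

variable {m n m' n' : Type*} [Fintype m] [Fintype n] [Fintype m'] [Fintype n']
variable [DecidableEq m] [DecidableEq n] [DecidableEq m'] [DecidableEq n']

theorem one_sub_submatrix_mul_conjTranspose (A : Matrix m n ℂ) {ρ : m' → m}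
    (hρ : Function.Injective ρ) (κ : n' ≃ n) :
    1 - A.submatrix ρ κ * (A.submatrix ρ κ)ᴴ = (1 - A * Aᴴ).submatrix ρ ρ := by
  rw [conjTranspose_submatrix, submatrix_mul_equiv, submatrix_sub, Pi.sub_apply, Pi.sub_apply,
    submatrix_one _ hρ]

theorem det_one_sub_submatrix_mul_conjTranspose (A : Matrix m n ℂ) {ρ : m' → m}
    (hρ : Function.Injective ρ) (κ : n' ≃ n) (h : ∀ a ∉ Set.range ρ, A a = 0) :
    (1 - A.submatrix ρ κ * (A.submatrix ρ κ)ᴴ).det = (1 - A * Aᴴ).det := by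
  rw [det_one_sub_mul_comm, det_one_sub_mul_comm A]
  have : (A.submatrix ρ κ)ᴴ * A.submatrix ρ κ = (Aᴴ * A).submatrix κ κ := by
    ext a b
    simp only [mul_apply, submatrix_apply, conjTranspose_apply]
    refine Finset.sum_of_injOn ρ hρ.injOn (fun _ _ => Finset.mem_coe.2 (Finset.mem_univ _))
      (fun c _ hc => ?_) fun _ _ => rfl
    have h1 := congrFun (h c fun ⟨x, hx⟩ => hc ⟨x, Finset.mem_coe.2 (Finset.mem_univ _), hx⟩)
    simp [h1]
  rw [this, ← det_submatrix_equiv_self κ (1 - Aᴴ * A), submatrix_sub, Pi.sub_apply, Pi.sub_apply,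
    submatrix_one_equiv]

end Reindex

section Gmap

variable {r s : ℕ}

/-- Row index of `Gmap` in the block form. -/
def rowIdx (r : ℕ) (a : Fin (2 * r - 1)) : Fin r ⊕ Fin r :=
  if h : (a : ℕ) < r then Sum.inl ⟨a, h⟩
  else Sum.inr ⟨(a : ℕ) - r + 1, by have := a.isLt; omega⟩

/-- Column index of `Gmap` in the block form. -/
def colIdx (s : ℕ) : Fin (2 * s) ≃ Fin s ⊕ Fin s :=
  (finCongr (two_mul s)).trans finSumFinEquiv.symm

theorem colIdx_of_lt (b : Fin (2 * s)) (h : (b : ℕ) < s) : colIdx s b = Sum.inl ⟨b, h⟩ := by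
  rw [colIdx, Equiv.trans_apply, Equiv.symm_apply_eq]
  ext; simp

theorem colIdx_of_le (b : Fin (2 * s)) (h : ¬ (b : ℕ) < s) :
    colIdx s b = Sum.inr ⟨(b : ℕ) - s, by have := b.isLt; omega⟩ := by
  rw [colIdx, Equiv.trans_apply, Equiv.symm_apply_eq]
  ext; simp; omega

theorem rowIdx_injective : Function.Injective (rowIdx r) := by
  intro a b h
  unfold rowIdx at h
  split_ifs at h with h1 h2 h2
  · exact Fin.ext (by simpa using h)
  · simp only [Sum.inr.injEq, Fin.mk.injEq] at h
    exact Fin.ext (by omega)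

theorem notMem_range_rowIdx (hr : 0 < r) {a : Fin r ⊕ Fin r} (ha : a ∉ Set.range (rowIdx r)) :
    a = Sum.inr ⟨0, hr⟩ := by
  by_contra hne
  apply ha
  rcases a with ⟨a, h⟩ | ⟨a, h⟩
  · exact ⟨⟨a, by omega⟩, by simp [rowIdx, h]⟩
  · have h0 : a ≠ 0 := fun h0 => hne (by subst h0; rfl)
    refine ⟨⟨r + a - 1, by omega⟩, ?_⟩
    rw [rowIdx, dif_neg (by simp; omega)]
    congr 2
    simp
    omega

theorem Gmap_eq_submatrix (hr : 0 < r) (hs : 0 < s) (t : ℝ) (Z : Matrix (Fin r) (Fin s) ℂ) :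
    Gmap r s t Z = (blockMap ⟨0, hr⟩ ⟨0, hs⟩ t Z).submatrix (rowIdx r) (colIdx s) := by
  have e1 : ∀ a b, (Z * single (⟨0, hs⟩ : Fin s) (⟨0, hr⟩ : Fin r) (1 : ℂ) * Z) a b = Z a ⟨0, hs⟩ *
    Z ⟨0, hr⟩ b := by
    intro a b
    rw [mul_apply, Finset.sum_eq_single ⟨0, hr⟩]
    · simp
    · intro c _ hc
      simp [hc]
    · simp
  ext a b
  rw [submatrix_apply, blockMap, Gmap, of_apply]
  by_cases ha : (a : ℕ) < r
  · rw [rowIdx, dif_pos ha, dif_pos ha]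
    by_cases hb : (b : ℕ) < s
    · rw [dif_pos hb, colIdx_of_lt b hb, fromBlocks_apply₁₁, Matrix.smul_apply, e1, smul_eq_mul,
        mul_assoc]
    · rw [dif_neg hb, colIdx_of_le b hb, fromBlocks_apply₁₂, Matrix.mul_add, Matrix.mul_sub,
        Matrix.mul_one, Matrix.add_apply, Matrix.sub_apply]
      by_cases hb' : (b : ℕ) = s
      · have : (⟨(b : ℕ) - s, by have := b.isLt; omega⟩ : Fin s) = ⟨0, hs⟩ :=
          Fin.ext (by simp [hb'])
        rw [dif_pos hb', this]
        simp [mul_comm]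
      · have : (⟨(b : ℕ) - s, by have := b.isLt; omega⟩ : Fin s) ≠ ⟨0, hs⟩ := by
          simp only [ne_eq, Fin.mk.injEq]; omega
        rw [dif_neg hb', mul_single_apply_of_ne _ _ _ _ _ this,
          mul_single_apply_of_ne _ _ _ _ _ this]
        simp
  · rw [rowIdx, dif_neg ha, dif_neg ha]
    by_cases hb : (b : ℕ) < s
    · rw [dif_pos hb, colIdx_of_lt b hb, fromBlocks_apply₂₁, Matrix.sub_mul, Matrix.one_mul,
        Matrix.sub_apply, single_mul_apply_of_ne _ _ _ _ _ (by simp), sub_zero]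
    · rw [dif_neg hb, colIdx_of_le b hb, fromBlocks_apply₂₂, Matrix.zero_apply]

theorem norm_det_one_sub_Gmap (hr : 0 < r) (hs : 0 < s) {t : ℝ} (h0 : 0 ≤ t) (h1 : t ≤ 1)
    {Z : Matrix (Fin r) (Fin s) ℂ} (hZ : Z ∈ OmegaI r s) :
    ‖(1 - Gmap r s t Z * (Gmap r s t Z)ᴴ).det‖ =
      ‖(1 - Z * Zᴴ).det‖ ^ 2 * (leftEntry ⟨0, hr⟩ Z + t * rightEntry ⟨0, hs⟩ Z) := by
  rw [Gmap_eq_submatrix hr hs, det_one_sub_submatrix_mul_conjTranspose _ rowIdx_injective,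
    norm_det_one_sub_blockMap _ _ h0 h1 hZ]
  intro a ha
  rw [notMem_range_rowIdx hr ha]
  ext (b | b)
  · simp [blockMap, Matrix.sub_mul]
  · simp [blockMap]

theorem Gmap_mapsTo (hr : 0 < r) (hs : 0 < s) {t : ℝ} (h0 : 0 ≤ t) (h1 : t ≤ 1) :
    Set.MapsTo (Gmap r s t) (OmegaI r s) (OmegaI (2 * r - 1) (2 * s)) := by
  intro Z hZ
  change (1 - Gmap r s t Z * (Gmap r s t Z)ᴴ).PosDef
  rw [Gmap_eq_submatrix hr hs, one_sub_submatrix_mul_conjTranspose _ rowIdx_injective]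
  exact (posDef_one_sub_blockMap _ _ h0 h1 hZ).submatrix rowIdx_injective

theorem Gmap_differentiable (t : ℝ) : Differentiable ℂ (Gmap r s t) := by
  have h : ∀ (a : Fin r) (b : Fin s), Differentiable ℂ fun Z : Matrix (Fin r) (Fin s) ℂ => Z a b :=
    fun a b => differentiable_pi.1 (differentiable_pi.1 differentiable_id a) b
  refine differentiable_pi.2 fun a => differentiable_pi.2 fun b => ?_
  simp only [Gmap, of_apply]
  split_ifs
  · exact ((h _ _).const_mul _).mul (h _ _)
  · exact (h _ _).const_mul _
  · exact h _ _
  · exact h _ _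
  · exact differentiable_const _

theorem norm_det_one_sub_Gmap_eq_zero (hr : 0 < r) (hs : 0 < s) {t : ℝ} (h0 : 0 ≤ t) (h1 : t ≤ 1)
    {Z : Matrix (Fin r) (Fin s) ℂ} (hZ : Z ∈ closure (OmegaI r s)) (hd : (1 - Z * Zᴴ).det = 0) :
    (1 - Gmap r s t Z * (Gmap r s t Z)ᴴ).det = 0 := by
  let F : Matrix (Fin r) (Fin s) ℂ → ℝ := fun Z => ‖(1 - Gmap r s t Z * (Gmap r s t Z)ᴴ).det‖
  let H : Matrix (Fin r) (Fin s) ℂ → ℝ := fun Z => ‖(1 - Z * Zᴴ).det *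
    ((1 - Z * Zᴴ).adjugate ⟨0, hr⟩ ⟨0, hr⟩ +
      (t : ℂ) * (Zᴴ * (1 - Z * Zᴴ).adjugate * Z) ⟨0, hs⟩ ⟨0, hs⟩)‖
  have hF : Continuous F := by
    have := (Gmap_differentiable (r := r) (s := s) t).continuous
    fun_prop
  have hH : Continuous H := by fun_prop
  have hFH : Set.EqOn F H (OmegaI r s) := by
    intro Y hY
    have hU : (1 - Y * Yᴴ).det ≠ 0 := hY.det_pos.ne'
    have h2 : (1 - Y * Yᴴ).adjugate = (1 - Y * Yᴴ).det • (1 - Y * Yᴴ)⁻¹ := by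
      rw [inv_def, smul_smul, Ring.mul_inverse_cancel _ hU.isUnit, one_smul]
    change F Y = ‖_‖
    rw [h2, Matrix.mul_smul, Matrix.smul_mul, Matrix.smul_apply, Matrix.smul_apply,
      ofReal_leftEntry hY, ofReal_rightEntry hY]
    have h3 : (1 - Y * Yᴴ).det * ((1 - Y * Yᴴ).det • (leftEntry ⟨0, hr⟩ Y : ℂ) +
        t * (1 - Y * Yᴴ).det • (rightEntry ⟨0, hs⟩ Y : ℂ)) = (1 - Y * Yᴴ).det ^ 2 *
        ((leftEntry ⟨0, hr⟩ Y + t * rightEntry ⟨0, hs⟩ Y : ℝ) : ℂ) := by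
      push_cast [smul_eq_mul]; ring
    rw [h3, norm_mul, norm_pow, Complex.norm_real, Real.norm_of_nonneg
      (add_nonneg (leftEntry_nonneg hY _) (mul_nonneg h0 (rightEntry_nonneg hY _)))]
    exact norm_det_one_sub_Gmap hr hs h0 h1 hY
  have h2 : F Z = H Z := hFH.closure hF hH hZ
  simpa [F, H, hd] using h2

theorem Gmap_isProperOn (hr : 0 < r) (hs : 0 < s) {t : ℝ} (h0 : 0 ≤ t) (h1 : t ≤ 1) :
    IsProperOn (Gmap r s t) (OmegaI r s) (OmegaI (2 * r - 1) (2 * s)) := by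
  intro K hK hKc
  have hcont := (Gmap_differentiable (r := r) (s := s) t).continuous
  have h2 : OmegaI r s ∩ Gmap r s t ⁻¹' K = closure (OmegaI r s) ∩ Gmap r s t ⁻¹' K := by
    refine Set.Subset.antisymm (Set.inter_subset_inter_left _ subset_closure) ?_
    rintro Z ⟨hZ, hZK⟩
    refine ⟨?_, hZK⟩
    have hn : ‖rowOp Z‖ ≤ 1 :=
      closure_minimal (t := {Z : Matrix (Fin r) (Fin s) ℂ | ‖rowOp Z‖ ≤ 1})
        (fun Y hY => (mem_OmegaI.1 hY).le)
        (isClosed_le continuous_rowOp.norm continuous_const) hZ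
    have hps := posSemidef_one_sub_mul_conjTranspose Z fun u =>
      ((rowOp Z).le_opNorm u).trans (mul_le_of_le_one_left (norm_nonneg u) hn)
    refine hps.posDef_iff_det_ne_zero.2 fun hd => ?_
    have h3 : (1 - Gmap r s t Z * (Gmap r s t Z)ᴴ).PosDef := hK hZK
    exact h3.det_pos.ne' (norm_det_one_sub_Gmap_eq_zero hr hs h0 h1 hZ hd)
  rw [h2]
  have : ProperSpace (Matrix (Fin r) (Fin s) ℂ) := FiniteDimensional.proper ℂ _
  refine (isBounded_OmegaI r s).isCompact_closure.inter_right ?_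
  exact hKc.isClosed.preimage hcont

end Gmap

section Coisometry

/-- The matrix whose columns are the vectors of an orthonormal basis. -/
def colMatrix {n : Type*} [Fintype n] (b : OrthonormalBasis n ℂ (EuclideanSpace ℂ n)) :
    Matrix n n ℂ :=
  of fun i j => b j i

section

variable {n : Type*} [Fintype n] [DecidableEq n]

theorem colMatrix_conjTranspose_mul_self (b : OrthonormalBasis n ℂ (EuclideanSpace ℂ n)) :
    (colMatrix b)ᴴ * colMatrix b = 1 := by
  ext i j
  have h := orthonormal_iff_ite.1 b.orthonormal i j
  rw [EuclideanSpace.inner_eq_star_dotProduct, dotProduct_comm] at h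
  rw [one_apply, ← h]
  rfl

theorem colMatrix_mul_conjTranspose_self (b : OrthonormalBasis n ℂ (EuclideanSpace ℂ n)) :
    colMatrix b * (colMatrix b)ᴴ = 1 :=
  mul_eq_one_comm.1 (colMatrix_conjTranspose_mul_self b)

/-- Singular value decomposition of a square complex matrix. -/
theorem exists_mul_colMatrix_eq (B : Matrix n n ℂ) :
    ∃ (v b : OrthonormalBasis n ℂ (EuclideanSpace ℂ n)) (d : n → ℂ),
      B * colMatrix v = colMatrix b * diagonal d := by
  have hA : (Bᴴ * B).IsHermitian := isHermitian_conjTranspose_mul_self B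
  let v := hA.eigenvectorBasis
  let w : n → EuclideanSpace ℂ n := fun i => WithLp.toLp 2 (B *ᵥ (v i).ofLp)
  have hw : ∀ i j, i ≠ j → inner ℂ (w i) (w j) = 0 := by
    intro i j hij
    have h1 := orthonormal_iff_ite.1 v.orthonormal i j
    rw [EuclideanSpace.inner_eq_star_dotProduct, dotProduct_comm, if_neg hij] at h1
    rw [EuclideanSpace.inner_eq_star_dotProduct, dotProduct_comm]
    change star (B *ᵥ (v i).ofLp) ⬝ᵥ B *ᵥ (v j).ofLp = 0
    rw [star_mulVec, ← dotProduct_mulVec, mulVec_mulVec, hA.mulVec_eigenvectorBasis j,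
      dotProduct_smul]
    change _ • (star (v i).ofLp ⬝ᵥ (v j).ofLp) = 0
    rw [h1, smul_zero]
  let u : n → EuclideanSpace ℂ n := fun i => ((‖w i‖ : ℂ)⁻¹) • w i
  have hu : Orthonormal ℂ (Set.domRestrict {i | w i ≠ 0} u) := by
    refine ⟨fun i => ?_, fun i j hij => ?_⟩
    · have hi : ‖w i‖ ≠ 0 := norm_ne_zero_iff.2 i.2
      change ‖((‖w i‖ : ℂ)⁻¹) • w i‖ = 1
      rw [norm_smul, norm_inv, Complex.norm_real, norm_norm, inv_mul_cancel₀ hi]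
    · change inner ℂ (((‖w i‖ : ℂ)⁻¹) • w i) (((‖w j‖ : ℂ)⁻¹) • w j) = 0
      rw [inner_smul_left, inner_smul_right, hw i j fun h => hij (Subtype.ext h)]
      simp
  obtain ⟨b, hb⟩ := hu.exists_orthonormalBasis_extension_of_card_eq (by simp)
  refine ⟨v, b, fun i => (‖w i‖ : ℂ), ?_⟩
  have hwb : ∀ i, w i = (‖w i‖ : ℂ) • b i := by
    intro i
    by_cases hi : w i = 0
    · rw [hi]; simp
    · have : (‖w i‖ : ℂ) ≠ 0 := by exact_mod_cast norm_ne_zero_iff.2 hi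
      rw [hb i hi]
      change w i = (‖w i‖ : ℂ) • (((‖w i‖ : ℂ)⁻¹) • w i)
      rw [smul_smul, mul_inv_cancel₀ this, one_smul]
  ext i j
  have h := congrArg (fun x : EuclideanSpace ℂ n => x i) (hwb j)
  rw [mul_diagonal, mul_comm]
  exact h

end

theorem exists_unitary_trace_mul_eq_zero {r : ℕ} (hr : 2 ≤ r) (B : Matrix (Fin r) (Fin r) ℂ) :
    ∃ U : Matrix (Fin r) (Fin r) ℂ, U * Uᴴ = 1 ∧ (U * B).trace = 0 := by
  obtain ⟨k, rfl⟩ := Nat.exists_eq_add_of_le' hr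
  obtain ⟨v, b, d, h⟩ := exists_mul_colMatrix_eq B
  let σ : Equiv.Perm (Fin (k + 2)) := finRotate (k + 2)
  have hσ : ∀ i, i ≠ σ i := by
    intro i hi
    rw [finRotate_apply] at hi
    simp at hi
  refine ⟨(colMatrix v).submatrix id σ * (colMatrix b)ᴴ, ?_, ?_⟩
  · rw [conjTranspose_mul, conjTranspose_conjTranspose, Matrix.mul_assoc,
      ← Matrix.mul_assoc (colMatrix b)ᴴ, colMatrix_conjTranspose_mul_self, Matrix.one_mul,
      conjTranspose_submatrix, submatrix_mul_equiv, colMatrix_mul_conjTranspose_self]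
    simp
  · have h1 : B = colMatrix b * diagonal d * (colMatrix v)ᴴ := by
      rw [← h, Matrix.mul_assoc, colMatrix_mul_conjTranspose_self, Matrix.mul_one]
    have h2 : (colMatrix v)ᴴ * (colMatrix v).submatrix id σ =
        (1 : Matrix (Fin (k + 2)) (Fin (k + 2)) ℂ).submatrix id σ := by
      rw [← colMatrix_conjTranspose_mul_self v]
      rfl
    have h3 : (colMatrix v).submatrix id σ * (colMatrix b)ᴴ * B =
        (colMatrix v).submatrix id σ * (diagonal d * (colMatrix v)ᴴ) := by
      rw [h1, Matrix.mul_assoc, Matrix.mul_assoc (colMatrix b), ← Matrix.mul_assoc (colMatrix b)ᴴ,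
        colMatrix_conjTranspose_mul_self, Matrix.one_mul]
    rw [h3, trace_mul_comm, Matrix.mul_assoc, h2, trace]
    refine Finset.sum_eq_zero fun i _ => ?_
    rw [diag_apply, diagonal_mul, submatrix_apply]
    exact mul_eq_zero_of_right _ (one_apply_ne (hσ i))

/-- Two vectors of `ℂˢ` lie in the image of the adjoint of some coisometry onto `ℂʳ`. -/
theorem exists_coisometry {r s : ℕ} (hr : 2 ≤ r) (hrs : r ≤ s) (β δ : Fin s → ℂ) :
    ∃ V : Matrix (Fin r) (Fin s) ℂ, V * Vᴴ = 1 ∧ Vᴴ *ᵥ (V *ᵥ β) = β ∧ Vᴴ *ᵥ (V *ᵥ δ) = δ := by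
  let x : Fin 2 → EuclideanSpace ℂ (Fin s) := ![WithLp.toLp 2 β, WithLp.toLp 2 δ]
  let W := Submodule.span ℂ (Set.range x)
  have hW : Module.finrank ℂ W ≤ 2 := by
    have h := finrank_range_le_card (R := ℂ) x
    rwa [Fintype.card_fin] at h
  let b' := stdOrthonormalBasis ℂ W
  let v : Fin s → EuclideanSpace ℂ (Fin s) := fun i =>
    if h : (i : ℕ) < Module.finrank ℂ W then (b' ⟨i, h⟩ : EuclideanSpace ℂ (Fin s)) else 0
  have hv : Orthonormal ℂ (Set.domRestrict {i : Fin s | (i : ℕ) < Module.finrank ℂ W} v) := by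
    have h1 := (b'.orthonormal.comp_linearIsometry W.subtypeₗᵢ).comp
      (fun i : {i : Fin s | (i : ℕ) < Module.finrank ℂ W} => (⟨i.1, i.2⟩ : Fin _))
      (fun i j h => Subtype.ext (Fin.ext (by simpa using h)))
    convert h1 using 1
    ext1 i
    have : (i.1 : ℕ) < Module.finrank ℂ W := i.2
    simp [v, this]
  obtain ⟨b, hb⟩ := hv.exists_orthonormalBasis_extension_of_card_eq (by simp)
  have hbW : ∀ y ∈ W, ∀ i : Fin s, r ≤ (i : ℕ) → inner ℂ (b i) y = 0 := by
    intro y hy i hi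
    have h1 := congrArg (fun z : W => (z : EuclideanSpace ℂ (Fin s))) (b'.sum_repr ⟨y, hy⟩)
    simp only [Submodule.coe_sum, Submodule.coe_smul] at h1
    rw [← h1, inner_sum]
    refine Finset.sum_eq_zero fun j _ => ?_
    have hj : (j : ℕ) < s := by omega
    have h2 : (b' j : EuclideanSpace ℂ (Fin s)) = b ⟨j, hj⟩ := by
      rw [hb ⟨j, hj⟩ j.2]; simp [v]
    rw [inner_smul_right, h2, orthonormal_iff_ite.1 b.orthonormal, if_neg, mul_zero]
    rintro rfl
    have := j.2
    simp at hi
    omega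
  have key : ∀ y ∈ W, ((colMatrix b)ᴴ.submatrix (Fin.castLE hrs) id)ᴴ *ᵥ
      (((colMatrix b)ᴴ.submatrix (Fin.castLE hrs) id) *ᵥ y.ofLp) = y.ofLp := by
    intro y hy
    have h1 : colMatrix b *ᵥ ((colMatrix b)ᴴ *ᵥ y.ofLp) = y.ofLp := by
      rw [mulVec_mulVec, colMatrix_mul_conjTranspose_self, one_mulVec]
    conv_rhs => rw [← h1]
    ext j
    simp only [mulVec, dotProduct]
    refine Finset.sum_of_injOn (Fin.castLE hrs) (Fin.castLE_injective hrs).injOn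
      (fun _ _ => Finset.mem_coe.2 (Finset.mem_univ _)) (fun i _ hi => ?_) fun i _ => ?_
    · have hi' : r ≤ (i : ℕ) := by
        by_contra hlt
        exact hi ⟨⟨i, by omega⟩, by simp, rfl⟩
      have h2 := hbW y hy i hi'
      rw [EuclideanSpace.inner_eq_star_dotProduct, dotProduct_comm] at h2
      exact mul_eq_zero_of_right _ h2
    · congr 1
      simp [conjTranspose_apply]
  refine ⟨(colMatrix b)ᴴ.submatrix (Fin.castLE hrs) id, ?_,
    key (x 0) (Submodule.subset_span ⟨0, rfl⟩), key (x 1) (Submodule.subset_span ⟨1, rfl⟩)⟩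
  have h1 := congrArg (fun A : Matrix (Fin s) (Fin s) ℂ =>
    A.submatrix (Fin.castLE hrs) (Fin.castLE hrs)) (colMatrix_conjTranspose_mul_self b)
  rw [submatrix_one _ (Fin.castLE_injective hrs)] at h1
  rw [← h1, conjTranspose_submatrix, conjTranspose_conjTranspose]
  rfl

theorem exists_coisometry_dotProduct_eq_zero {r s : ℕ} (hr : 2 ≤ r) (hrs : r ≤ s)
    (α γ : Fin r → ℂ) (β δ : Fin s → ℂ) (c : ℂ) :
    ∃ V : Matrix (Fin r) (Fin s) ℂ, V * Vᴴ = 1 ∧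
      star (V *ᵥ β) ⬝ᵥ (V *ᵥ β) = star β ⬝ᵥ β ∧ star (V *ᵥ δ) ⬝ᵥ (V *ᵥ δ) = star δ ⬝ᵥ δ ∧
      star α ⬝ᵥ (V *ᵥ β) + c * (star γ ⬝ᵥ (V *ᵥ δ)) = 0 := by
  obtain ⟨V, hV, hβ, hδ⟩ := exists_coisometry hr hrs β δ
  obtain ⟨U, hU, hUB⟩ := exists_unitary_trace_mul_eq_zero hr
    (vecMulVec (V *ᵥ β) (star α) + c • vecMulVec (V *ᵥ δ) (star γ))
  have hU' : Uᴴ * U = 1 := mul_eq_one_comm.1 hU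
  have hn : ∀ y, Vᴴ *ᵥ (V *ᵥ y) = y →
      star ((U * V) *ᵥ y) ⬝ᵥ ((U * V) *ᵥ y) = star y ⬝ᵥ y := by
    intro y hy
    rw [star_mulVec, ← dotProduct_mulVec, mulVec_mulVec, conjTranspose_mul]
    have : Vᴴ * Uᴴ * (U * V) = Vᴴ * V := by
      rw [Matrix.mul_assoc, ← Matrix.mul_assoc Uᴴ, hU', Matrix.one_mul]
    rw [this, ← mulVec_mulVec, hy]
  refine ⟨U * V, ?_, hn β hβ, hn δ hδ, ?_⟩
  · rw [conjTranspose_mul, Matrix.mul_assoc, ← Matrix.mul_assoc V, hV, Matrix.one_mul, hU]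
  · rw [Matrix.mul_add, Matrix.mul_smul, mul_vecMulVec, mul_vecMulVec, trace_add, trace_smul,
      trace_vecMulVec, trace_vecMulVec, mulVec_mulVec, mulVec_mulVec, smul_eq_mul] at hUB
    rw [dotProduct_comm, dotProduct_comm (star γ), hUB]

end Coisometry

section Curve

variable {m n k : Type*} [Fintype m] [Fintype n] [DecidableEq m] [DecidableEq n]

theorem conjTranspose_mul_smul_one_mul_apply (Y : Matrix m k ℂ) (c : ℂ) (i : k) :
    (Yᴴ * (c • (1 : Matrix m m ℂ)) * Y) i i = c * (star (Y.col i) ⬝ᵥ Y.col i) := by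
  rw [Matrix.mul_smul, Matrix.smul_mul, Matrix.mul_one, Matrix.smul_apply, smul_eq_mul]
  rfl

theorem star_add_smul_dotProduct (a b : m → ℂ) (ζ : ℂ) :
    star (a + ζ • b) ⬝ᵥ (a + ζ • b) = star a ⬝ᵥ a + ζ * (star a ⬝ᵥ b) +
      star (ζ * (star a ⬝ᵥ b)) + ζ * star ζ * (star b ⬝ᵥ b) := by
  rw [star_mul', star_add, star_smul, add_dotProduct, dotProduct_add, dotProduct_add,
    smul_dotProduct, smul_dotProduct, dotProduct_smul, dotProduct_smul, star_dotProduct b a]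
  simp only [smul_eq_mul]
  ring

theorem one_sub_smul_mul_conjTranspose {V : Matrix m n ℂ} (hV : V * Vᴴ = 1) (ζ : ℂ) :
    1 - (ζ • V) * (ζ • V)ᴴ = (1 - ζ * star ζ) • (1 : Matrix m m ℂ) := by
  rw [conjTranspose_smul, Matrix.smul_mul, Matrix.mul_smul, hV, smul_smul, sub_smul, one_smul]

theorem one_sub_mul_star (ζ : ℂ) : 1 - ζ * star ζ = ((1 - ‖ζ‖ ^ 2 : ℝ) : ℂ) := by
  push_cast
  rw [← Complex.mul_conj']
  rfl

theorem posDef_one_sub_smul_mul_conjTranspose {V : Matrix m n ℂ} (hV : V * Vᴴ = 1) {ζ : ℂ}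
    (hζ : ‖ζ‖ < 1) : (1 - (ζ • V) * (ζ • V)ᴴ).PosDef := by
  rw [one_sub_smul_mul_conjTranspose hV, one_sub_mul_star]
  refine PosDef.one.smul ?_
  rw [Complex.zero_lt_real]
  nlinarith [norm_nonneg ζ]

section

variable {P : Matrix m m ℂ} {Q : Matrix n m ℂ} {R : Matrix m n ℂ} {S : Matrix n n ℂ}
variable {V : Matrix m n ℂ} {ζ : ℂ}

theorem inv_one_sub_smul_mul_conjTranspose (hV : V * Vᴴ = 1) (hζ : ‖ζ‖ < 1) :
    (1 - (ζ • V) * (ζ • V)ᴴ)⁻¹ = (1 - ζ * star ζ)⁻¹ • (1 : Matrix m m ℂ) := by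
  have h : 1 - ζ * star ζ ≠ 0 := by
    rw [one_sub_mul_star]
    have : 0 < 1 - ‖ζ‖ ^ 2 := by nlinarith [norm_nonneg ζ]
    exact_mod_cast this.ne'
  refine inv_eq_right_inv ?_
  rw [one_sub_smul_mul_conjTranspose hV, Matrix.smul_mul, Matrix.mul_smul, smul_smul,
    mul_inv_cancel₀ h, one_smul, Matrix.one_mul]

theorem IsPseudoUnitary.leftEntry_moebius (h : IsPseudoUnitary P Q R S) (hV : V * Vᴴ = 1)
    (hζ : ‖ζ‖ < 1) (i : m) :
    (1 - ζ * star ζ) * (leftEntry i (moebius P Q R S (ζ • V)) : ℂ) =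
      star (P.col i + ζ • (V *ᵥ Q.col i)) ⬝ᵥ (P.col i + ζ • (V *ᵥ Q.col i)) := by
  have hZ := posDef_one_sub_smul_mul_conjTranspose hV hζ
  have h0 : 1 - ζ * star ζ ≠ 0 := by
    rw [one_sub_mul_star]
    have : 0 < 1 - ‖ζ‖ ^ 2 := by nlinarith [norm_nonneg ζ]
    exact_mod_cast this.ne'
  rw [← ofReal_leftEntry (h.posDef_moebius hZ), h.inv_one_sub_moebius hZ,
    inv_one_sub_smul_mul_conjTranspose hV hζ, conjTranspose_mul_smul_one_mul_apply,
    mul_inv_cancel_left₀ h0, Matrix.smul_mul]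
  rfl

theorem IsPseudoUnitary.rightEntry_moebius (h : IsPseudoUnitary P Q R S) (hV : V * Vᴴ = 1)
    (hζ : ‖ζ‖ < 1) (j : n) :
    (1 - ζ * star ζ) * (rightEntry j (moebius P Q R S (ζ • V)) : ℂ) =
      star (R.col j + ζ • (V *ᵥ S.col j)) ⬝ᵥ (R.col j + ζ • (V *ᵥ S.col j)) := by
  have hZ := posDef_one_sub_smul_mul_conjTranspose hV hζ
  have h0 : 1 - ζ * star ζ ≠ 0 := by
    rw [one_sub_mul_star]
    have : 0 < 1 - ‖ζ‖ ^ 2 := by nlinarith [norm_nonneg ζ]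
    exact_mod_cast this.ne'
  rw [← ofReal_rightEntry (h.posDef_moebius hZ), h.conj_inv_one_sub_moebius hZ,
    inv_one_sub_smul_mul_conjTranspose hV hζ, conjTranspose_mul_smul_one_mul_apply,
    mul_inv_cancel_left₀ h0, Matrix.smul_mul]
  rfl

end

theorem star_col_dotProduct_col_of_eq {M : Matrix m m ℂ} {N : Matrix n m ℂ}
    (h : Mᴴ * M = 1 + Nᴴ * N) (i : m) :
    star (M.col i) ⬝ᵥ M.col i = 1 + star (N.col i) ⬝ᵥ N.col i := by
  have := congrFun (congrFun h i) i
  rw [Matrix.add_apply, one_apply_eq] at this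
  exact this

/-- Through each point of the domain there is a holomorphic disc along which
`leftEntry + t * rightEntry` grows at least as fast as along the discs through the origin. -/
theorem exists_disc {r s : ℕ} (hr : 2 ≤ r) (hrs : r ≤ s) (i : Fin r) (j : Fin s) {t : ℝ}
    (h0 : 0 ≤ t) (h1 : t ≤ 1) {p : Matrix (Fin r) (Fin s) ℂ} (hp : p ∈ OmegaI r s) :
    ∃ ω : ℂ → Matrix (Fin r) (Fin s) ℂ, DifferentiableOn ℂ ω (Metric.ball 0 1) ∧
      Set.MapsTo ω (Metric.ball 0 1) (OmegaI r s) ∧ ω 0 = p ∧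
      ∀ ζ : ℂ, ‖ζ‖ < 1 → (leftEntry i p + t * rightEntry j p) * (1 + t * ‖ζ‖ ^ 2) ≤
        (1 - ‖ζ‖ ^ 2) * (leftEntry i (ω ζ) + t * rightEntry j (ω ζ)) := by
  obtain ⟨P, Q, R, S, h, hφ0, -, hPQ, hSR⟩ := exists_moebius_zero hp
  obtain ⟨V, hV, hβ, hδ, hcross⟩ := exists_coisometry_dotProduct_eq_zero hr hrs (P.col i) (R.col j)
    (Q.col i) (S.col j) (t : ℂ)
  have hmaps : Set.MapsTo (fun ζ : ℂ => ζ • V) (Metric.ball 0 1) (OmegaI r s) := fun ζ hζ =>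
    posDef_one_sub_smul_mul_conjTranspose hV (mem_ball_zero_iff.1 hζ)
  refine ⟨fun ζ => moebius P Q R S (ζ • V), ?_, h.mapsTo.comp hmaps, by simpa using hφ0,
    fun ζ hζ => ?_⟩
  · exact h.differentiableOn.comp (differentiableOn_id.smul_const V) hmaps
  have hα := star_col_dotProduct_col_of_eq hPQ i
  have hδ' := star_col_dotProduct_col_of_eq hSR j
  have l0 := h.leftEntry_moebius hV (ζ := 0) (by simp) i
  have r0 := h.rightEntry_moebius hV (ζ := 0) (by simp) j
  rw [zero_smul, zero_smul, hφ0, add_zero, zero_mul, sub_zero, one_mul] at l0 r0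
  have l1 := h.leftEntry_moebius hV hζ i
  have r1 := h.rightEntry_moebius hV hζ j
  rw [star_add_smul_dotProduct, hβ] at l1
  rw [star_add_smul_dotProduct, hδ, hδ'] at r1
  have hb := star_dotProduct_self (Q.col i)
  have hc := star_dotProduct_self (R.col j)
  rw [hα, hb] at l0
  rw [hc] at r0
  rw [hα, hb] at l1
  rw [hc] at r1
  set b := ‖WithLp.toLp 2 (Q.col i)‖ ^ 2 with hbdef
  set c := ‖WithLp.toLp 2 (R.col j)‖ ^ 2 with hcdef
  have hb0 : 0 ≤ b := sq_nonneg _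
  have hc0 : 0 ≤ c := sq_nonneg _
  have hz : ζ * star ζ = ((‖ζ‖ ^ 2 : ℝ) : ℂ) := by
    push_cast
    rw [← Complex.mul_conj']
    rfl
  have l0' : leftEntry i p = 1 + b := by exact_mod_cast l0
  have r0' : rightEntry j p = c := by exact_mod_cast r0
  have hstar := congrArg star hcross
  have key : (((1 - ‖ζ‖ ^ 2) * (leftEntry i (moebius P Q R S (ζ • V)) +
      t * rightEntry j (moebius P Q R S (ζ • V))) : ℝ) : ℂ) =
      ((1 + b + ‖ζ‖ ^ 2 * b + t * (c + ‖ζ‖ ^ 2 * (1 + c)) : ℝ) : ℂ) := by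
    rw [star_add, star_mul', star_zero] at hstar
    have ht : star (t : ℂ) = t := Complex.conj_ofReal t
    rw [ht] at hstar
    rw [star_mul'] at l1 r1
    rw [hz] at l1 r1
    push_cast at l1 r1 ⊢
    linear_combination l1 + t * r1 + ζ * hcross + star ζ * hstar
  have key' := Complex.ofReal_injective key
  change _ ≤ (1 - ‖ζ‖ ^ 2) * (leftEntry i (moebius P Q R S (ζ • V)) +
      t * rightEntry j (moebius P Q R S (ζ • V)))
  rw [key', l0', r0']
  have e1 : 0 ≤ b * (1 - t) := mul_nonneg hb0 (by linarith)
  have e2 : 0 ≤ t * c * (1 - t) := mul_nonneg (mul_nonneg h0 hc0) (by linarith)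
  nlinarith [mul_nonneg (sq_nonneg ‖ζ‖) (add_nonneg e1 e2)]

end Curve

section Inequivalence

open Metric

variable {r s : ℕ}

theorem norm_jacobian_mul_eq (hr : 0 < r) (hs : 0 < s) {t t' : ℝ} (ht : t ∈ Set.Icc (0 : ℝ) 1)
    (ht' : t' ∈ Set.Icc (0 : ℝ) 1) {τ σ}
    (hτ : IsAutomorphismOf (OmegaI r s) τ)
    (hσ : IsAutomorphismOf (OmegaI (2 * r - 1) (2 * s)) σ)
    (h : ∀ Z ∈ OmegaI r s, Gmap r s t Z = σ (Gmap r s t' (τ Z)))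
    {Z : Matrix (Fin r) (Fin s) ℂ} (hZ : Z ∈ OmegaI r s) :
    ‖(fderiv ℂ σ (Gmap r s t' (τ Z))).det ^ (r + s) *
        (fderiv ℂ τ Z).det ^ (2 * (2 * r - 1 + 2 * s))‖ ^ 2 *
      (leftEntry ⟨0, hr⟩ (τ Z) + t' * rightEntry ⟨0, hs⟩ (τ Z)) ^
        ((r + s) * (2 * r - 1 + 2 * s)) =
      (leftEntry ⟨0, hr⟩ Z + t * rightEntry ⟨0, hs⟩ Z) ^ ((r + s) * (2 * r - 1 + 2 * s)) := by
  have hτZ : τ Z ∈ OmegaI r s := hτ.1 hZ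
  have h1 := hσ.norm_det_fderiv_sq_mul (Gmap_mapsTo hr hs ht'.1 ht'.2 hτZ)
  rw [← h Z hZ, norm_det_one_sub_Gmap hr hs ht'.1 ht'.2 hτZ,
    norm_det_one_sub_Gmap hr hs ht.1 ht.2 hZ] at h1
  have h2 := hτ.norm_det_fderiv_sq_mul hZ
  have hd : 0 < ‖(1 - Z * Zᴴ).det‖ := norm_pos_iff.2 (PosDef.det_pos hZ).ne'
  rw [norm_mul, norm_pow, norm_pow]
  generalize ‖(fderiv ℂ σ (Gmap r s t' (τ Z))).det‖ = a at *
  generalize ‖(fderiv ℂ τ Z).det‖ = b at *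
  generalize leftEntry ⟨0, hr⟩ (τ Z) + t' * rightEntry ⟨0, hs⟩ (τ Z) = x at *
  generalize leftEntry ⟨0, hr⟩ Z + t * rightEntry ⟨0, hs⟩ Z = y at *
  generalize ‖(1 - τ Z * (τ Z)ᴴ).det‖ = e at *
  generalize ‖(1 - Z * Zᴴ).det‖ = d at *
  generalize 2 * r - 1 + 2 * s = N at *
  generalize r + s = M at *
  refine mul_left_cancel₀ (pow_pos hd (2 * (M * N))).ne' ?_
  calc d ^ (2 * (M * N)) * ((a ^ M * b ^ (2 * N)) ^ 2 * x ^ (M * N))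
      = (a ^ 2) ^ M * x ^ (M * N) * (b ^ 2 * d ^ M) ^ (2 * N) := by ring
    _ = (a ^ 2 * (e ^ 2 * x) ^ N) ^ M := by rw [h2]; ring
    _ = d ^ (2 * (M * N)) * y ^ (M * N) := by rw [h1]; ring

theorem Gmap_not_equivalent_of_lt (hr : 2 ≤ r) (hrs : r ≤ s) {t t' : ℝ}
    (ht : t ∈ Set.Icc (0 : ℝ) 1) (ht' : t' ∈ Set.Icc (0 : ℝ) 1) (htt' : t < t') :
    ¬ ∃ τ σ, IsAutomorphismOf (OmegaI r s) τ ∧ IsAutomorphismOf (OmegaI (2 * r - 1) (2 * s)) σ ∧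
      ∀ Z ∈ OmegaI r s, Gmap r s t Z = σ (Gmap r s t' (τ Z)) := by
  rintro ⟨τ, σ, hτ, hσ, h⟩
  have hr0 : 0 < r := by omega
  have hs0 : 0 < s := by omega
  have hJ := fun Z hZ => norm_jacobian_mul_eq hr0 hs0 ht ht' hτ hσ h (Z := Z) hZ
  obtain ⟨hτm, hτd, τ', hτ'm, hτ'd, hτ'τ, hττ'⟩ := hτ
  have hz := zero_mem_OmegaI r s
  obtain ⟨ω, hωd, hωm, hω0, hω⟩ :=
    exists_disc hr hrs ⟨0, hr0⟩ ⟨0, hs0⟩ ht'.1 ht'.2 (hτm hz)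
  set i : Fin r := ⟨0, hr0⟩
  set j : Fin s := ⟨0, hs0⟩
  let ψ : ℂ → Matrix (Fin r) (Fin s) ℂ := τ' ∘ ω
  have hψd : DifferentiableOn ℂ ψ (ball 0 1) := hτ'd.comp hωd hωm
  have hψm : Set.MapsTo ψ (ball 0 1) (OmegaI r s) := hτ'm.comp hωm
  have hψ0 : ψ 0 = 0 := by
    change τ' (ω 0) = 0
    rw [hω0, hτ'τ 0 hz]
  have hτψ : ∀ ζ ∈ ball (0 : ℂ) 1, τ (ψ ζ) = ω ζ := fun ζ hζ => hττ' _ (hωm hζ)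
  let κ : ℂ → ℂ := fun ζ => (fderiv ℂ σ (Gmap r s t' (ω ζ))).det ^ (r + s) *
        (fderiv ℂ τ (ψ ζ)).det ^ (2 * (2 * r - 1 + 2 * s))
  have hκd : DifferentiableOn ℂ κ (ball 0 1) := by
    refine DifferentiableOn.mul (DifferentiableOn.pow ?_ _) (DifferentiableOn.pow ?_ _)
    · exact differentiableOn_det_fderiv_comp (isOpen_OmegaI _ _) isOpen_ball hσ.2.1
        ((Gmap_differentiable t').comp_differentiableOn hωd)
        ((Gmap_mapsTo hr0 hs0 ht'.1 ht'.2).comp hωm)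
    · exact differentiableOn_det_fderiv_comp (isOpen_OmegaI _ _) isOpen_ball hτd hψd hψm
  generalize hN : (r + s) * (2 * r - 1 + 2 * s) = N at hJ
  have hN0 : N ≠ 0 := by
    rw [← hN]
    exact mul_ne_zero (by omega) (by omega)
  have hκ : ∀ ζ ∈ ball (0 : ℂ) 1,
      ‖κ ζ‖ ^ 2 * (leftEntry i (ω ζ) + t' * rightEntry j (ω ζ)) ^ N =
        (leftEntry i (ψ ζ) + t * rightEntry j (ψ ζ)) ^ N := by
    intro ζ hζ
    have := hJ (ψ ζ) (hψm hζ)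
    rwa [hτψ ζ hζ] at this
  set A := leftEntry i (τ 0) + t' * rightEntry j (τ 0) with hA
  have hApos : 0 < A := add_pos_of_pos_of_nonneg (leftEntry_pos (hτm hz) i)
    (mul_nonneg ht'.1 (rightEntry_nonneg (hτm hz) j))
  have hκ0 : ‖κ 0‖ ^ 2 * A ^ N = 1 := by
    have := hκ 0 (mem_ball_self one_pos)
    rw [hω0, hψ0] at this
    rw [this]
    have h1 : leftEntry i (0 : Matrix (Fin r) (Fin s) ℂ) = 1 := by simp [leftEntry]
    have h2 : rightEntry j (0 : Matrix (Fin r) (Fin s) ℂ) = 0 := by simp [rightEntry]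
    rw [h1, h2, mul_zero, add_zero, one_pow]
  have hq : (1 + t / 4) / (1 + t' / 4) < 1 := by
    rw [div_lt_one (by linarith [ht'.1])]
    linarith
  have hq0 : 0 ≤ (1 + t / 4) / (1 + t' / 4) :=
    div_nonneg (by linarith [ht.1]) (by linarith [ht'.1])
  have hbound : ∀ ζ : ℂ, ‖ζ‖ = 1 / 2 → ‖κ ζ‖ ^ 2 * A ^ N ≤ ((1 + t / 4) / (1 + t' / 4)) ^ N := by
    intro ζ hζ
    have hζ1 : ‖ζ‖ < 1 := by rw [hζ]; norm_num
    have hζb : ζ ∈ ball (0 : ℂ) 1 := mem_ball_zero_iff.2 hζ1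
    have h1 := hω ζ hζ1
    have h2 := norm_rowOp_le_of_mapsTo hψd hψm hψ0 hζ1
    have h3 := leftEntry_le h2 (norm_nonneg ζ) hζ1 i
    have h4 := mul_le_mul_of_nonneg_left (rightEntry_le h2 (norm_nonneg ζ) hζ1 j) ht.1
    rw [hζ] at h1 h3 h4
    have h5 : 0 ≤ leftEntry i (ψ ζ) + t * rightEntry j (ψ ζ) :=
      add_nonneg (leftEntry_nonneg (hψm hζb) i)
        (mul_nonneg ht.1 (rightEntry_nonneg (hψm hζb) j))
    have h6 := hκ ζ hζb
    have hy : leftEntry i (ψ ζ) + t * rightEntry j (ψ ζ) ≤ (1 + t / 4) * (4 / 3) := by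
      norm_num at h3 h4
      linarith
    have hx : A * ((1 + t' / 4) * (4 / 3)) ≤ leftEntry i (ω ζ) + t' * rightEntry j (ω ζ) := by
      norm_num at h1
      linarith
    have ht'0 : 0 < (1 + t' / 4) * (4 / 3) := by linarith [ht'.1]
    rw [← mul_div_mul_right (1 + t / 4) (1 + t' / 4) (by norm_num : (4 / 3 : ℝ) ≠ 0), div_pow,
      le_div_iff₀ (pow_pos ht'0 N), mul_assoc, ← mul_pow]
    calc _ ≤ ‖κ ζ‖ ^ 2 * (leftEntry i (ω ζ) + t' * rightEntry j (ω ζ)) ^ N := by gcongr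
      _ ≤ _ := by
        rw [h6]
        gcongr
  have hmax : ∃ ζ : ℂ, ‖ζ‖ = 1 / 2 ∧ ‖κ 0‖ ≤ ‖κ ζ‖ := by
    have hsub : closedBall (0 : ℂ) (1 / 2) ⊆ ball 0 1 := closedBall_subset_ball (by norm_num)
    obtain ⟨ζ, hζ, hζmax⟩ := Complex.exists_mem_frontier_isMaxOn_norm (f := κ)
      (isBounded_ball (x := (0 : ℂ)) (r := 1 / 2)) ⟨0, mem_ball_self (by norm_num)⟩
      (DifferentiableOn.diffContOnCl_ball hκd hsub)
    rw [frontier_ball 0 (by norm_num), mem_sphere_zero_iff_norm] at hζ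
    exact ⟨ζ, hζ, hζmax (subset_closure (mem_ball_self (by norm_num)))⟩
  obtain ⟨ζ, hζ, hκζ⟩ := hmax
  have h1 : ‖κ 0‖ ^ 2 * A ^ N ≤ ‖κ ζ‖ ^ 2 * A ^ N := by gcongr
  rw [hκ0] at h1
  exact (h1.trans (hbound ζ hζ)).not_gt (pow_lt_one₀ hq0 hq hN0)

theorem Gmap_not_equivalent (hr : 2 ≤ r) (hrs : r ≤ s) {t t' : ℝ}
    (ht : t ∈ Set.Icc (0 : ℝ) 1) (ht' : t' ∈ Set.Icc (0 : ℝ) 1) (htt' : t ≠ t') :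
    ¬ ∃ τ σ, IsAutomorphismOf (OmegaI r s) τ ∧ IsAutomorphismOf (OmegaI (2 * r - 1) (2 * s)) σ ∧
      ∀ Z ∈ OmegaI r s, Gmap r s t Z = σ (Gmap r s t' (τ Z)) := by
  rcases htt'.lt_or_gt with hlt | hlt
  · exact Gmap_not_equivalent_of_lt hr hrs ht ht' hlt
  rintro ⟨τ, σ, ⟨hτm, hτd, τ', hτ'm, hτ'd, hτ'τ, hττ'⟩, ⟨hσm, hσd, σ', hσ'm, hσ'd, hσ'σ, hσσ'⟩, h⟩
  refine Gmap_not_equivalent_of_lt hr hrs ht' ht hlt ⟨τ', σ',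
    ⟨hτ'm, hτ'd, τ, hτm, hτd, hττ', hτ'τ⟩, ⟨hσ'm, hσ'd, σ, hσm, hσd, hσσ', hσ'σ⟩, fun Z hZ => ?_⟩
  rw [h _ (hτ'm hZ), hττ' Z hZ,
    hσ'σ _ (Gmap_mapsTo (by omega) (by omega) ht'.1 ht'.2 hZ)]

theorem isAutomorphismOf_id {E : Type*} [NormedAddCommGroup E] [NormedSpace ℂ E] (Ω : Set E) :
    IsAutomorphismOf Ω id :=
  ⟨Set.mapsTo_id Ω, differentiableOn_id, id, Set.mapsTo_id Ω, differentiableOn_id,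
    fun _ _ => rfl, fun _ _ => rfl⟩

end Inequivalence

/-- Theorem 1.2: the maps `G_t`, `t ∈ [0,1]`, are pairwise inequivalent; consequently there are
uncountably many pairwise inequivalent proper holomorphic maps from `Ω^I_{r,s}` to
`Ω^I_{2r-1,2s}` for `2 ≤ r ≤ s`. -/
theorem Gmap_inequivalent (r s : ℕ) (hr : 2 ≤ r) (hrs : r ≤ s)
    (t t' : ℝ) (ht : t ∈ Set.Icc (0 : ℝ) 1) (ht' : t' ∈ Set.Icc (0 : ℝ) 1) (htt' : t ≠ t') :
    (¬ ∃ τ σ, IsAutomorphismOf (OmegaI r s) τ ∧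
        IsAutomorphismOf (OmegaI (2 * r - 1) (2 * s)) σ ∧
        ∀ Z ∈ OmegaI r s, Gmap r s t Z = σ (Gmap r s t' (τ Z))) ∧
      ∃ S : Set (Matrix (Fin r) (Fin s) ℂ → Matrix (Fin (2 * r - 1)) (Fin (2 * s)) ℂ),
        ¬ S.Countable ∧
        (∀ f ∈ S, Set.MapsTo f (OmegaI r s) (OmegaI (2 * r - 1) (2 * s)) ∧
          DifferentiableOn ℂ f (OmegaI r s) ∧
          IsProperOn f (OmegaI r s) (OmegaI (2 * r - 1) (2 * s))) ∧
        S.Pairwise (fun f g =>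
          ¬ ∃ τ σ, IsAutomorphismOf (OmegaI r s) τ ∧
            IsAutomorphismOf (OmegaI (2 * r - 1) (2 * s)) σ ∧
            ∀ Z ∈ OmegaI r s, f Z = σ (g (τ Z))) := by
  have h := fun (a b : ℝ) ha hb hab => Gmap_not_equivalent (t := a) (t' := b) hr hrs ha hb hab
  have hr0 : 0 < r := by omega
  have hs0 : 0 < s := by omega
  refine ⟨h t t' ht ht' htt', Gmap r s '' Set.Icc 0 1, ?_, ?_, ?_⟩
  · have hinj : Set.InjOn (Gmap r s) (Set.Icc 0 1) := by
      intro a ha b hb hab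
      by_contra hne
      exact h a b ha hb hne ⟨id, id, isAutomorphismOf_id _, isAutomorphismOf_id _,
        fun Z _ => congrFun hab Z⟩
    intro hc
    have := Cardinal.Real.Icc_countable_iff.1
      (Set.countable_of_injective_of_countable_image hinj hc)
    norm_num at this
  · rintro _ ⟨a, ha, rfl⟩
    exact ⟨Gmap_mapsTo hr0 hs0 ha.1 ha.2, (Gmap_differentiable a).differentiableOn,
      Gmap_isProperOn hr0 hs0 ha.1 ha.2⟩
  · rintro _ ⟨a, ha, rfl⟩ _ ⟨b, hb, rfl⟩ hab
    exact h a b ha hb fun hab' => hab (hab' ▸ rfl)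
end
end

section
/- Let 2 ≤ r ≤ s and t ∈ [0,1]. Then G_t maps Ω^I_{r,s} into Ω^I_{2r−1,2s}, i.e. I_{2r−1} − G_t(Z) G_t(Z)ᴴ is positive definite whenever I_r − Z Zᴴ is positive definite, and the restriction G_t : Ω^I_{r,s} → Ω^I_{2r−1,2s} is a proper map (the preimage of every compact subset of Ω^I_{2r−1,2s} is compact). -/
open Matrix
open scoped ComplexOrder

noncomputable section

/-- The Hermitian form of `1 - Z * Zᴴ`, evaluated on row vectors. -/
def rowForm {ι κ : Type*} [Fintype ι] [Fintype κ] (Z : Matrix ι κ ℂ) (x : ι → ℂ) : ℝ :=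
  ∑ i, Complex.normSq (x i) - ∑ j, Complex.normSq ((x ᵥ* Z) j)

theorem dotProduct_star_eq_sum_normSq {ι : Type*} [Fintype ι] (y : ι → ℂ) :
    y ⬝ᵥ star y = ((∑ i, Complex.normSq (y i) : ℝ) : ℂ) := by
  simp [dotProduct, Complex.mul_conj]

theorem star_dotProduct_one_sub_mulVec_s5 {ι κ : Type*} [Fintype ι] [Fintype κ] [DecidableEq ι]
    (Z : Matrix ι κ ℂ) (x : ι → ℂ) :
    star x ⬝ᵥ ((1 - Z * Zᴴ) *ᵥ x) = (rowForm Z (star x) : ℂ) := by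
  have hx := dotProduct_star_eq_sum_normSq (star x)
  have hZ := dotProduct_star_eq_sum_normSq (star x ᵥ* Z)
  rw [star_star] at hx
  rw [star_vecMul, star_star] at hZ
  rw [rowForm, sub_mulVec, one_mulVec, dotProduct_sub, ← mulVec_mulVec, dotProduct_mulVec,
    hx, hZ, Complex.ofReal_sub]

theorem posDef_one_sub_mul_conjTranspose_iff_s5 {ι κ : Type*} [Fintype ι] [Fintype κ]
    [DecidableEq ι] (Z : Matrix ι κ ℂ) :
    (1 - Z * Zᴴ).PosDef ↔ ∀ x, x ≠ 0 → 0 < rowForm Z x := by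
  rw [posDef_iff_dotProduct_mulVec]
  simp only [star_dotProduct_one_sub_mulVec_s5, Complex.zero_lt_real]
  refine ⟨fun h x hx => ?_, fun h => ⟨?_, fun x hx => h _ (star_ne_zero.2 hx)⟩⟩
  · simpa using h.2 (star_ne_zero.2 hx)
  · exact isHermitian_one.sub (isHermitian_mul_conjTranspose_self Z)

theorem rowForm_smul {ι κ : Type*} [Fintype ι] [Fintype κ] (Z : Matrix ι κ ℂ) (c : ℂ)
    (x : ι → ℂ) : rowForm Z (c • x) = Complex.normSq c * rowForm Z x := by
  simp [rowForm, smul_vecMul, Finset.mul_sum, mul_sub]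

/-- The row indices of `Gmap`: an upper block of `n + 1` rows and a lower block of `n` rows. -/
def rowEquiv (n : ℕ) : Fin (n + 1) ⊕ Fin n ≃ Fin (2 * (n + 1) - 1) :=
  finSumFinEquiv.trans (finCongr (by omega))

/-- The column indices of `Gmap`: two blocks of `m` columns. -/
def colEquiv (m : ℕ) : Fin m ⊕ Fin m ≃ Fin (2 * m) :=
  finSumFinEquiv.trans (finCongr (by omega))

section Entries

variable {n m : ℕ} (t : ℝ) (Z : Matrix (Fin (n + 1)) (Fin (m + 1)) ℂ)

theorem Gmap_inl_inl (i : Fin (n + 1)) (j : Fin (m + 1)) :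
    Gmap _ _ t Z (rowEquiv n (.inl i)) (colEquiv _ (.inl j)) =
      (Real.sqrt t : ℂ) * Z i 0 * Z 0 j := by
  simp [Gmap, rowEquiv, colEquiv, i.is_le, j.is_le]

theorem Gmap_inl_inr_zero (i : Fin (n + 1)) :
    Gmap _ _ t Z (rowEquiv n (.inl i)) (colEquiv _ (.inr 0)) =
      (Real.sqrt (1 - t) : ℂ) * Z i 0 := by
  simp [Gmap, rowEquiv, colEquiv, i.is_le]

theorem Gmap_inl_inr_succ (i : Fin (n + 1)) (j : Fin m) :
    Gmap _ _ t Z (rowEquiv n (.inl i)) (colEquiv _ (.inr j.succ)) = Z i j.succ := by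
  have hj : ¬ (j : ℕ) + 1 + (m + 1) ≤ m := by omega
  simp [Gmap, rowEquiv, colEquiv, i.is_le, hj, Fin.succ]

theorem Gmap_inr_inl (k : Fin n) (j : Fin (m + 1)) :
    Gmap _ _ t Z (rowEquiv n (.inr k)) (colEquiv _ (.inl j)) = Z k.succ j := by
  have hk : ¬ n + 1 + (k : ℕ) ≤ n := by omega
  simp [Gmap, rowEquiv, colEquiv, hk, j.is_le, Fin.succ]

theorem Gmap_inr_inr (k : Fin n) (j : Fin (m + 1)) :
    Gmap _ _ t Z (rowEquiv n (.inr k)) (colEquiv _ (.inr j)) = 0 := by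
  have hk : ¬ n + 1 + (k : ℕ) ≤ n := by omega
  have hj : ¬ (j : ℕ) + (m + 1) ≤ m := by omega
  simp [Gmap, rowEquiv, colEquiv, hk, hj]

theorem rowForm_Gmap (ht : t ∈ Set.Icc (0 : ℝ) 1) (v : Fin (2 * (n + 1) - 1) → ℂ) :
    rowForm (Gmap _ _ t Z) v =
      rowForm Z (Fin.cons (Real.sqrt t * ((fun i => v (rowEquiv n (.inl i))) ᵥ* Z) 0)
        fun k => v (rowEquiv n (.inr k))) +
      rowForm Z fun i => v (rowEquiv n (.inl i)) := by
  set u : Fin (n + 1) → ℂ := fun i => v (rowEquiv n (.inl i)) with hu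
  set w : Fin n → ℂ := fun k => v (rowEquiv n (.inr k)) with hw
  set a := (u ᵥ* Z) 0 with ha
  have hinl (j : Fin (m + 1)) : (v ᵥ* Gmap _ _ t Z) (colEquiv _ (.inl j)) =
      ((Fin.cons (Real.sqrt t * a) w : Fin (n + 1) → ℂ) ᵥ* Z) j := by
    simp only [vecMul, dotProduct] at ha ⊢
    rw [← (rowEquiv n).sum_comp, Fintype.sum_sum_type, Fin.sum_univ_succ (n := n)
      (f := fun i => (Fin.cons (Real.sqrt t * a) w : Fin (n + 1) → ℂ) i * Z i j)]
    simp only [Gmap_inl_inl, Gmap_inr_inl, Fin.cons_zero, Fin.cons_succ, ha, Finset.mul_sum,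
      Finset.sum_mul]
    congr 1
    exact Finset.sum_congr rfl fun i _ => by simp only [hu]; ring
  have hzero : (v ᵥ* Gmap _ _ t Z) (colEquiv _ (.inr 0)) = Real.sqrt (1 - t) * a := by
    simp only [vecMul, dotProduct] at ha ⊢
    rw [← (rowEquiv n).sum_comp, Fintype.sum_sum_type]
    simp only [Gmap_inl_inr_zero, Gmap_inr_inr, mul_zero, Finset.sum_const_zero, add_zero, ha,
      Finset.mul_sum]
    exact Finset.sum_congr rfl fun i _ => by simp only [hu]; ring
  have hsucc (j : Fin m) : (v ᵥ* Gmap _ _ t Z) (colEquiv _ (.inr j.succ)) =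
      (u ᵥ* Z) j.succ := by
    simp only [vecMul, dotProduct]
    rw [← (rowEquiv n).sum_comp, Fintype.sum_sum_type]
    simp [Gmap_inl_inr_succ, Gmap_inr_inr, hu]
  have hv : ∑ i, Complex.normSq (v i) =
      ∑ i, Complex.normSq (u i) + ∑ k, Complex.normSq (w k) := by
    rw [← (rowEquiv n).sum_comp, Fintype.sum_sum_type]
  have hG : ∑ j, Complex.normSq ((v ᵥ* Gmap _ _ t Z) j) =
      ∑ j, Complex.normSq (((Fin.cons (Real.sqrt t * a) w : Fin (n + 1) → ℂ) ᵥ* Z) j) +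
        ((1 - t) * Complex.normSq a + ∑ j : Fin m, Complex.normSq ((u ᵥ* Z) j.succ)) := by
    rw [← (colEquiv (m + 1)).sum_comp, Fintype.sum_sum_type]
    congr 1
    · simp only [hinl]
    · rw [Fin.sum_univ_succ, hzero]
      simp only [hsucc, Complex.normSq_mul, Complex.normSq_ofReal,
        Real.mul_self_sqrt (sub_nonneg.2 ht.2)]
  have hx : ∑ i, Complex.normSq ((Fin.cons (Real.sqrt t * a) w : Fin (n + 1) → ℂ) i) =
      t * Complex.normSq a + ∑ k, Complex.normSq (w k) := by
    rw [Fin.sum_univ_succ]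
    simp [Real.mul_self_sqrt ht.1]
  have hZ : ∑ j, Complex.normSq ((u ᵥ* Z) j) =
      Complex.normSq a + ∑ j : Fin m, Complex.normSq ((u ᵥ* Z) j.succ) := by
    rw [Fin.sum_univ_succ]
  unfold rowForm
  rw [hv, hG, hx, hZ]
  ring

end Entries

theorem rowForm_zero {ι κ : Type*} [Fintype ι] [Fintype κ] (Z : Matrix ι κ ℂ) :
    rowForm Z 0 = 0 := by
  simp [rowForm]

theorem Gmap_mem_OmegaI_iff {r s : ℕ} (hr : r ≠ 0) (hs : s ≠ 0) {t : ℝ}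
    (ht : t ∈ Set.Icc (0 : ℝ) 1) (Z : Matrix (Fin r) (Fin s) ℂ) :
    Gmap r s t Z ∈ OmegaI (2 * r - 1) (2 * s) ↔ Z ∈ OmegaI r s := by
  obtain ⟨n, rfl⟩ := Nat.exists_eq_succ_of_ne_zero hr
  obtain ⟨m, rfl⟩ := Nat.exists_eq_succ_of_ne_zero hs
  simp only [OmegaI, Set.mem_ofPred_eq, posDef_one_sub_mul_conjTranspose_iff_s5]
  constructor
  · intro h u hu
    by_contra! hF
    by_cases hu0 : u 0 = 0
    · have hcons : (Fin.cons 0 (Fin.tail u) : Fin (n + 1) → ℂ) = u := by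
        rw [← hu0, Fin.cons_self_tail]
      set v : Fin (2 * (n + 1) - 1) → ℂ :=
        fun i => Sum.elim 0 (Fin.tail u) ((rowEquiv n).symm i) with hv
      have hl : (fun i => v (rowEquiv n (.inl i))) = 0 := by ext; simp [hv]
      have hr : (fun k => v (rowEquiv n (.inr k))) = Fin.tail u := by ext; simp [hv]
      have hGv := rowForm_Gmap t Z ht v
      rw [hl, hr, zero_vecMul, Pi.zero_apply, mul_zero, hcons, rowForm_zero, add_zero] at hGv
      refine (h v fun h0 => hu ?_).not_ge (hGv.trans_le hF)
      rw [← hcons, ← hr, h0]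
      ext i
      cases i using Fin.cases <;> simp
    · set c : ℂ := Real.sqrt t * (u ᵥ* Z) 0 / u 0 with hc
      have hcons : (Fin.cons (Real.sqrt t * (u ᵥ* Z) 0) (c • Fin.tail u) : Fin (n + 1) → ℂ) =
          c • u := by
        ext i
        cases i using Fin.cases with
        | zero => simp [hc, hu0]
        | succ i => simp [Fin.tail]
      set v : Fin (2 * (n + 1) - 1) → ℂ :=
        fun i => Sum.elim u (c • Fin.tail u) ((rowEquiv n).symm i) with hv
      have hl : (fun i => v (rowEquiv n (.inl i))) = u := by ext; simp [hv]
      have hr : (fun k => v (rowEquiv n (.inr k))) = c • Fin.tail u := by ext; simp [hv]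
      have hGv := rowForm_Gmap t Z ht v
      rw [hl, hr, hcons, rowForm_smul] at hGv
      refine (h v fun h0 => hu ?_).not_ge ?_
      · rw [← hl, h0]
        rfl
      · nlinarith [Complex.normSq_nonneg c]
  · intro h v hv
    have hnonneg (x) : 0 ≤ rowForm Z x := by
      by_cases hx : x = 0
      · rw [hx, rowForm_zero]
      · exact (h x hx).le
    rw [rowForm_Gmap t Z ht v]
    by_cases hu : (fun i => v (rowEquiv n (.inl i))) = 0
    · refine add_pos_of_pos_of_nonneg (h _ fun h0 => hv ?_) (hnonneg _)
      ext i
      obtain ⟨i | k, rfl⟩ := (rowEquiv n).surjective i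
      · exact congrFun hu i
      · simpa using congrFun h0 k.succ
    · exact add_pos_of_nonneg_of_pos (hnonneg _) (h _ hu)

theorem normSq_apply_le_one_of_mem_OmegaI {r s : ℕ} {Z : Matrix (Fin r) (Fin s) ℂ}
    (hZ : Z ∈ OmegaI r s) (i : Fin r) (j : Fin s) : Complex.normSq (Z i j) ≤ 1 := by
  have h := (posDef_one_sub_mul_conjTranspose_iff_s5 Z).1 hZ (Pi.single i 1) (by simp)
  have hsum : ∑ k, Complex.normSq ((Pi.single i 1 : Fin r → ℂ) k) = 1 := by
    rw [Finset.sum_eq_single i] <;> simp +contextual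
  rw [rowForm, hsum, single_one_vecMul, sub_pos] at h
  exact (Finset.single_le_sum (f := fun j => Complex.normSq (Z i j))
    (fun _ _ => Complex.normSq_nonneg _) (Finset.mem_univ j)).trans h.le

theorem continuous_Gmap (r s : ℕ) (t : ℝ) : Continuous (Gmap r s t) := by
  refine continuous_matrix fun i j => ?_
  unfold Gmap
  simp only [of_apply]
  split_ifs <;> fun_prop

/-- Each `G_t`, `t ∈ [0,1]`, is a proper holomorphic map from `Ω^I_{r,s}` to
`Ω^I_{2r-1,2s}`. -/
theorem Gmap_mapsTo_and_proper (r s : ℕ) (hr : 2 ≤ r) (hrs : r ≤ s)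
    (t : ℝ) (ht : t ∈ Set.Icc (0 : ℝ) 1) :
    Set.MapsTo (Gmap r s t) (OmegaI r s) (OmegaI (2 * r - 1) (2 * s)) ∧
      IsProperOn (Gmap r s t) (OmegaI r s) (OmegaI (2 * r - 1) (2 * s)) := by
  have hmem := Gmap_mem_OmegaI_iff (r := r) (s := s) (by omega) (by omega) ht
  refine ⟨fun Z hZ => (hmem Z).2 hZ, fun K hK hKc => ?_⟩
  have hpre : Gmap r s t ⁻¹' K ⊆ OmegaI r s := fun Z hZ => (hmem Z).1 (hK hZ)
  rw [Set.inter_eq_right.2 hpre]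
  have hbox : IsCompact (Set.univ.pi fun _ : Fin r => Set.univ.pi fun _ : Fin s =>
      Metric.closedBall (0 : ℂ) 1) :=
    isCompact_univ_pi fun _ => isCompact_univ_pi fun _ => isCompact_closedBall _ _
  refine hbox.of_isClosed_subset (hKc.isClosed.preimage (continuous_Gmap r s t)) ?_
  intro Z hZ i _ j _
  have h := normSq_apply_le_one_of_mem_OmegaI (hpre hZ) i j
  rw [Complex.normSq_eq_norm_sq] at h
  simpa using (sq_le_one_iff₀ (norm_nonneg _)).1 h
end
end

section
/- Let r, s ≥ 1, fix indices i ∈ Fin r, j ∈ Fin s, and fix Z ∈ Matrix (Fin r) (Fin s) ℂ. For w ∈ ℂ let Z(w) be the matrix agreeing with Z except that its (i,j) entry is w, and let Z' ∈ Matrix (Fin (r−1)) (Fin (s−1)) ℂ be obtained from Z by deleting row i and column j. Then there exist a ∈ ℝ and c ∈ ℂ such that for every w ∈ ℂ: det(I_r − Z(w) Z(w)ᴴ) = a + c·w + conj(c·w) − w·conj(w)·det(I_{r−1} − Z' Z'ᴴ). In particular, viewed as a real polynomial in Re w and Im w, the coefficient of (Re w)² equals −det(I_{r−1} − Z' Z'ᴴ).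 -/
open Matrix

noncomputable section

/-- The matrix agreeing with `Z` except that its `(i,j)` entry is `w`. -/
def updEntry {r s : ℕ} (Z : Matrix (Fin r) (Fin s) ℂ) (i : Fin r) (j : Fin s) (w : ℂ) :
    Matrix (Fin r) (Fin s) ℂ :=
  Matrix.of fun a b => if a = i ∧ b = j then w else Z a b

theorem Matrix.det_updateRow_add_smul_updateRow_add_smul {n R : Type*} [Fintype n] [DecidableEq n]
    [CommRing R] (M : Matrix n n R) {p q : n} (hpq : p ≠ q) (u v : n → R) (x y : R) :
    ((M.updateRow p (M p + x • u)).updateRow q (M q + y • v)).det =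
      M.det + x * (M.updateRow p u).det + y * (M.updateRow q v).det
        + x * y * ((M.updateRow p u).updateRow q v).det := by
  have hq (w : n → R) : (M.updateRow p w).updateRow q (M q) = M.updateRow p w := by
    rw [updateRow_comm _ hpq, updateRow_eq_self]
  have hp (w : n → R) : (M.updateRow q w).updateRow p (M p) = M.updateRow q w := by
    rw [updateRow_comm _ hpq.symm, updateRow_eq_self]
  rw [det_updateRow_add, det_updateRow_smul, hq, det_updateRow_add, det_updateRow_smul,
    updateRow_eq_self, updateRow_comm _ hpq, det_updateRow_add, det_updateRow_smul, hp,
    updateRow_comm _ hpq.symm]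
  ring

theorem Matrix.det_one_sub_updateRow_zero_mul_updateRow_zero {R : Type*} [CommRing R] {r s : ℕ}
    (A : Matrix (Fin (r + 1)) (Fin (s + 1)) R) (B : Matrix (Fin (s + 1)) (Fin (r + 1)) R)
    (i : Fin (r + 1)) (j : Fin (s + 1)) :
    (1 - A.updateRow i 0 * B.updateRow j 0).det =
      (1 - A.submatrix i.succAbove j.succAbove * B.submatrix j.succAbove i.succAbove).det := by
  have hrow (k : Fin (r + 1)) :
      (1 - A.updateRow i 0 * B.updateRow j 0 : Matrix _ _ R) i k = (1 : Matrix _ _ R) i k := by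
    simp [Matrix.mul_apply]
  rw [det_succ_row _ i, Finset.sum_eq_single i]
  · rw [hrow, one_apply_eq, Even.neg_one_pow ⟨_, rfl⟩, one_mul, one_mul]
    congr 1
    ext a b
    simp [mul_apply, Fin.sum_univ_succAbove _ j, one_apply]
  · intro k _ hk
    rw [hrow, one_apply_ne hk.symm]
    simp
  · simp

theorem Matrix.exists_det_one_sub_add_single_mul_add_single {R : Type*} [CommRing R] {r s : ℕ}
    (A : Matrix (Fin (r + 1)) (Fin (s + 1)) R) (B : Matrix (Fin (s + 1)) (Fin (r + 1)) R)
    (i : Fin (r + 1)) (j : Fin (s + 1)) :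
    ∃ p q : R, ∀ x y : R,
      (1 - (A + single i j x) * (B + single j i y)).det =
        (1 - A * B).det + x * p + y * q - x * y *
          (1 - A.submatrix i.succAbove j.succAbove * B.submatrix j.succAbove i.succAbove).det := by
  set M := fromBlocks 1 A B 1 with hM
  set u : Fin (r + 1) ⊕ Fin (s + 1) → R := Pi.single (Sum.inr j) 1 with hu
  set v : Fin (r + 1) ⊕ Fin (s + 1) → R := Pi.single (Sum.inl i) 1 with hv
  refine ⟨(M.updateRow (Sum.inl i) u).det, (M.updateRow (Sum.inr j) v).det, fun x y => ?_⟩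
  have hblock : fromBlocks 1 (A + single i j x) (B + single j i y) 1 =
      (M.updateRow (Sum.inl i) (M (Sum.inl i) + x • u)).updateRow (Sum.inr j)
        (M (Sum.inr j) + y • v) := by
    ext (a | a) (b | b) <;>
      simp [hM, hu, hv, updateRow_apply, single_apply, Pi.single_apply] <;> grind
  have hswap : (M.updateRow (Sum.inl i) u).updateRow (Sum.inr j) v =
      (fromBlocks 1 (A.updateRow i 0) (B.updateRow j 0) 1).submatrix
        (Equiv.swap (Sum.inl i) (Sum.inr j)) id := by
    ext a b
    rw [submatrix_apply, Equiv.swap_apply_def]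
    rcases a with a | a <;> rcases b with b | b <;>
      simp [hM, hu, hv, updateRow_apply, one_apply, Pi.single_apply] <;> split_ifs <;>
      simp_all [updateRow_apply, eq_comm]
  rw [← det_fromBlocks_one₂₂, hblock,
    det_updateRow_add_smul_updateRow_add_smul _ Sum.inl_ne_inr, hswap, det_permute,
    Equiv.Perm.sign_swap Sum.inl_ne_inr, det_fromBlocks_one₂₂, hM, det_fromBlocks_one₂₂,
    det_one_sub_updateRow_zero_mul_updateRow_zero]
  simp
  ring

theorem Matrix.conj_det_one_sub_mul_conjTranspose {m n : Type*} [Fintype m] [DecidableEq m]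
    [Fintype n] (Z : Matrix m n ℂ) :
    starRingEnd ℂ (1 - Z * Zᴴ).det = (1 - Z * Zᴴ).det := by
  rw [starRingEnd_apply, ← det_conjTranspose]
  simp

theorem updEntry_eq_add_single {r s : ℕ} (Z : Matrix (Fin r) (Fin s) ℂ) (i : Fin r) (j : Fin s)
    (w : ℂ) : updEntry Z i j w = updEntry Z i j 0 + single i j w := by
  ext a b
  simp only [updEntry, of_apply, Matrix.add_apply, single_apply]
  grind

theorem updEntry_submatrix_succAbove {r s : ℕ} (Z : Matrix (Fin (r + 1)) (Fin (s + 1)) ℂ)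
    (i : Fin (r + 1)) (j : Fin (s + 1)) (w : ℂ) :
    (updEntry Z i j w).submatrix i.succAbove j.succAbove =
      Z.submatrix i.succAbove j.succAbove := by
  ext a b
  simp [updEntry]

/-- Lemma 3.1(1): for the type I generic norm `det(I_r − Z Zᴴ)`, viewed as a function of a
single entry `w` placed at position `(i,j)`, the coefficient of `w ⬝ conj w` (equivalently of
`(Re w)²`) is `−det(I_{r−1} − Z' Z'ᴴ)` where `Z'` is the `(i,j)` minor. -/
theorem genericNorm_typeI_entry_coefficient (r s : ℕ)
    (Z : Matrix (Fin (r + 1)) (Fin (s + 1)) ℂ) (i : Fin (r + 1)) (j : Fin (s + 1)) :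
    ∃ (a : ℝ) (c : ℂ), ∀ w : ℂ,
      (1 - updEntry Z i j w * (updEntry Z i j w)ᴴ).det
        = (a : ℂ) + c * w + (starRingEnd ℂ) (c * w)
          - w * (starRingEnd ℂ) w *
            (1 - Z.submatrix i.succAbove j.succAbove *
              (Z.submatrix i.succAbove j.succAbove)ᴴ).det := by
  set Y := updEntry Z i j 0 with hY
  obtain ⟨p, q, hpq⟩ := exists_det_one_sub_add_single_mul_add_single Y Yᴴ i j
  have hdet (w : ℂ) : (1 - updEntry Z i j w * (updEntry Z i j w)ᴴ).det =
      (1 - Y * Yᴴ).det + w * p + starRingEnd ℂ w * q - w * starRingEnd ℂ w *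
        (1 - Z.submatrix i.succAbove j.succAbove *
          (Z.submatrix i.succAbove j.succAbove)ᴴ).det := by
    rw [updEntry_eq_add_single, ← hY, conjTranspose_add, conjTranspose_single, ← starRingEnd_apply,
      hpq, ← conjTranspose_submatrix, hY, updEntry_submatrix_succAbove]
  have hreal (w : ℂ) : starRingEnd ℂ w * starRingEnd ℂ p + w * starRingEnd ℂ q =
      w * p + starRingEnd ℂ w * q := by
    have h := conj_det_one_sub_mul_conjTranspose (updEntry Z i j w)
    rw [hdet] at h
    simp only [map_add, map_sub, map_mul, conj_det_one_sub_mul_conjTranspose,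
      Complex.conj_conj] at h
    linear_combination h
  have hq : q = starRingEnd ℂ p := by
    have h1 := hreal 1
    have hI := hreal Complex.I
    simp only [map_one, Complex.conj_I] at h1 hI
    linear_combination (-1 / 2 : ℂ) * h1 - Complex.I / 2 * hI +
      (starRingEnd ℂ q - starRingEnd ℂ p - p + q) / 2 * Complex.I_sq
  obtain ⟨a, ha⟩ := Complex.conj_eq_iff_real.mp (conj_det_one_sub_mul_conjTranspose Y)
  refine ⟨a, p, fun w => ?_⟩
  rw [hdet, ha, hq, map_mul]
  ring
end
end

section
/- Let n ≥ 2, fix indices i < j in Fin n, and fix an antisymmetric matrix Z ∈ Matrix (Fin n) (Fin n) ℂ (Zᵀ = −Z). For w ∈ ℂ let Z(w) be the antisymmetric matrix agreeing with Z except that its (i,j) entry is w and its (j,i) entry is −w, and let Z'' ∈ Matrix (Fin (n−2)) (Fin (n−2)) ℂ be obtained from Z by deleting rows i, j and columns i, j. Then there exist coefficients c_{kl} ∈ ℂ for 0 ≤ k, l ≤ 2 with (k,l) ≠ (2,2) such that for every w ∈ ℂ: det(I_n − Z(w) Z(w)ᴴ) = w²·conj(w)²·det(I_{n−2} − Z''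 Z''ᴴ) + Σ_{(k,l) ≠ (2,2)} c_{kl} · w^k · conj(w)^l. -/
open Matrix

noncomputable section

/-- The antisymmetric matrix agreeing with `Z` except that its `(i,j)` entry is `w` and its
`(j,i)` entry is `−w`. -/
def updEntryAsym {n : ℕ} (Z : Matrix (Fin n) (Fin n) ℂ) (i j : Fin n) (w : ℂ) :
    Matrix (Fin n) (Fin n) ℂ :=
  Matrix.of fun a b =>
    if a = i ∧ b = j then w else if a = j ∧ b = i then -w else Z a b

/-- The strictly monotone embedding `Fin m → Fin (m+2)` avoiding exactly `i` and `j`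
(for `i < j`); used to delete rows/columns `i` and `j`. -/
def delTwo {m : ℕ} (i j : Fin (m + 2)) (hij : i < j) : Fin m → Fin (m + 2) :=
  fun k => j.succAbove ((⟨(i : ℕ), by
    have h1 : (i : ℕ) < (j : ℕ) := hij
    have h2 := j.isLt
    omega⟩ : Fin (m + 1)).succAbove k)

section DetExpansion

variable {ι κ R : Type*} [Fintype ι] [DecidableEq ι] [Fintype κ] [DecidableEq κ] [CommRing R]

/-- Expansion of a block determinant in the scalars `d` multiplying part of its upper rows. -/
theorem det_fromBlocks_diagonal_mul_add (d : ι → R) (E A : Matrix ι ι R) (B : Matrix ι κ R)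
    (C : Matrix κ ι R) (D : Matrix κ κ R) :
    (fromBlocks (diagonal d * E + A) B C D).det
      = ∑ S : Finset ι, (∏ s ∈ S, d s) *
          (fromBlocks (of fun a b => if a ∈ S then E a b else A a b)
            (of fun a b => if a ∈ S then 0 else B a b) C D).det := by
  let f := (detRowAlternating (R := R) (n := ι ⊕ κ)).toMultilinearMap.currySum
  let lower : κ → ι ⊕ κ → R := fun a => Sum.elim (C a) (D a)
  let u : ι → ι ⊕ κ → R := fun a => Sum.elim (E a) 0
  let v : ι → ι ⊕ κ → R := fun a => Sum.elim (A a) (B a)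
  have hleft : (fromBlocks (diagonal d * E + A) B C D).det
      = f ((fun a => d a • u a) + v) lower := by
    change _ = Matrix.det _
    congr 1
    ext (a | a) (b | b) <;> simp [u, v, lower, diagonal_mul]
  rw [hleft, MultilinearMap.map_add_univ, _root_.sum_apply]
  refine Finset.sum_congr rfl fun S _ => ?_
  have hS : S.piecewise (fun a => d a • u a) v
      = S.piecewise (fun a => d a • S.piecewise u v a) (S.piecewise u v) := by
    ext a b
    by_cases ha : a ∈ S <;> simp [ha]
  rw [hS, MultilinearMap.map_piecewise_smul, _root_.smul_apply, smul_eq_mul]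
  congr 1
  change Matrix.det _ = Matrix.det _
  congr 1
  ext (a | a) (b | b)
  · by_cases ha : a ∈ S <;> simp [ha, u, v]
  · by_cases ha : a ∈ S <;> simp [ha, u, v]
  · simp [lower]
  · simp [lower]

end DetExpansion

theorem det_fromBlocks_symplectic :
    (fromBlocks 0 !![0, 1; -1, 0] (-!![0, 1; -1, 0]) 0 :
      Matrix (Fin 2 ⊕ Fin 2) (Fin 2 ⊕ Fin 2) ℂ).det = 1 := by
  rw [← det_submatrix_equiv_self (finSumFinEquiv (m := 2) (n := 2)).symm]
  have h : (fromBlocks 0 !![0, 1; -1, 0] (-!![0, 1; -1, 0]) 0 :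
      Matrix (Fin 2 ⊕ Fin 2) (Fin 2 ⊕ Fin 2) ℂ).submatrix
        (finSumFinEquiv (m := 2) (n := 2)).symm (finSumFinEquiv (m := 2) (n := 2)).symm
      = !![0, 0, 0, 1; 0, 0, -1, 0; 0, -1, 0, 0; 1, 0, 0, 0] := by
    ext a b
    fin_cases a <;> fin_cases b <;> simp [finSumFinEquiv, Fin.addCases]
  rw [h]
  simp [det_succ_row_zero, Fin.sum_univ_succ, Fin.succAbove]
  norm_num

theorem prod_sumElim_const {ι κ R : Type*} [CommMonoid R] (S : Finset (ι ⊕ κ)) (x y : R) :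
    ∏ s ∈ S, Sum.elim (fun _ => x) (fun _ => y) s = x ^ S.toLeft.card * y ^ S.toRight.card := by
  conv_lhs => rw [← Finset.toLeft_disjSum_toRight (u := S)]
  rw [Finset.prod_disjSum]
  simp

/-- A sum over subsets of `Fin 2 ⊕ Fin 2`, weighted by powers of `x` and `y`, has the full subset
as its only contribution to `x² y²`. -/
theorem exists_coeff_sum_finset (g : Finset (Fin 2 ⊕ Fin 2) → ℂ) :
    ∃ c : Fin 3 → Fin 3 → ℂ, c 2 2 = 0 ∧ ∀ x y : ℂ,
      ∑ S, (∏ s ∈ S, Sum.elim (fun _ => x) (fun _ => y) s) * g S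
        = x ^ 2 * y ^ 2 * g Finset.univ
          + ∑ k : Fin 3, ∑ l : Fin 3, c k l * x ^ (k : ℕ) * y ^ (l : ℕ) := by
  have hL (S : Finset (Fin 2 ⊕ Fin 2)) : S.toLeft.card < 3 :=
    Nat.lt_succ_of_le (card_finset_fin_le _)
  have hR (S : Finset (Fin 2 ⊕ Fin 2)) : S.toRight.card < 3 :=
    Nat.lt_succ_of_le (card_finset_fin_le _)
  refine ⟨fun k l => ∑ S ∈ Finset.univ.erase Finset.univ,
    if (⟨_, hL S⟩ : Fin 3) = k then if (⟨_, hR S⟩ : Fin 3) = l then g S else 0 else 0, ?_, ?_⟩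
  · refine Finset.sum_eq_zero fun S hS => ?_
    rw [← ite_and, if_neg]
    rintro ⟨h1, h2⟩
    apply Finset.ne_of_mem_erase hS
    rw [← Finset.card_eq_iff_eq_univ, ← Finset.card_toLeft_add_card_toRight]
    simp only [Fin.ext_iff] at h1 h2
    rw [h1, h2]
    rfl
  · intro x y
    rw [← Finset.add_sum_erase _ _ (Finset.mem_univ Finset.univ)]
    congr 1
    · rw [prod_sumElim_const]
      congr 3
    · simp only [Finset.sum_mul]
      rw [Finset.sum_congr rfl fun k _ => Finset.sum_comm, Finset.sum_comm]
      refine Finset.sum_congr rfl fun S _ => ?_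
      simp only [ite_mul, zero_mul, Finset.sum_ite_irrel, Finset.sum_const_zero,
        Finset.sum_ite_eq, Finset.mem_univ, if_true, prod_sumElim_const]
      ring

theorem exists_coeff_det_fromBlocks {κ : Type*} [Fintype κ] [DecidableEq κ]
    (E A : Matrix (Fin 2 ⊕ Fin 2) (Fin 2 ⊕ Fin 2) ℂ) (B : Matrix (Fin 2 ⊕ Fin 2) κ ℂ)
    (C : Matrix κ (Fin 2 ⊕ Fin 2) ℂ) (D : Matrix κ κ ℂ) :
    ∃ c : Fin 3 → Fin 3 → ℂ, c 2 2 = 0 ∧ ∀ x y : ℂ,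
      (fromBlocks (diagonal (Sum.elim (fun _ => x) fun _ => y) * E + A) B C D).det
        = x ^ 2 * y ^ 2 * (E.det * D.det)
          + ∑ k : Fin 3, ∑ l : Fin 3, c k l * x ^ (k : ℕ) * y ^ (l : ℕ) := by
  obtain ⟨c, hc, hsum⟩ := exists_coeff_sum_finset fun S =>
    (fromBlocks (of fun a b => if a ∈ S then E a b else A a b)
      (of fun a b => if a ∈ S then 0 else B a b) C D).det
  refine ⟨c, hc, fun x y => ?_⟩
  rw [det_fromBlocks_diagonal_mul_add, hsum, ← det_fromBlocks_zero₁₂ E C D]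
  simp only [Finset.mem_univ, if_true]
  rfl

section DeleteTwo

variable {m : ℕ} {i j : Fin (m + 2)}

theorem delTwo_injective (hij : i < j) : Function.Injective (delTwo i j hij) :=
  Fin.succAbove_right_injective.comp Fin.succAbove_right_injective

theorem delTwo_ne_right (hij : i < j) (k : Fin m) : delTwo i j hij k ≠ j :=
  Fin.succAbove_ne _ _

theorem delTwo_ne_left (hij : i < j) (k : Fin m) : delTwo i j hij k ≠ i := by
  have hi : j.succAbove ⟨i, lt_of_lt_of_le hij (Nat.le_of_lt_succ j.isLt)⟩ = i :=
    Fin.succAbove_of_castSucc_lt _ _ hij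
  intro h
  exact Fin.succAbove_ne _ k (Fin.succAbove_right_injective (h.trans hi.symm))

/-- The enumeration of the indices listing `i` and `j` first. -/
def pairSumEquiv (hij : i < j) : Fin 2 ⊕ Fin m ≃ Fin (m + 2) :=
  Equiv.ofBijective (Sum.elim ![i, j] (delTwo i j hij)) <| by
    rw [Fintype.bijective_iff_injective_and_card]
    refine ⟨Function.Injective.sumElim ?_ (delTwo_injective hij) ?_, by simp [add_comm]⟩
    · intro a b
      fin_cases a <;> fin_cases b <;> simp [hij.ne, hij.ne']
    · intro a k
      fin_cases a
      · exact (delTwo_ne_left hij k).symm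
      · exact (delTwo_ne_right hij k).symm

theorem updEntryAsym_submatrix_pairSumEquiv (Z : Matrix (Fin (m + 2)) (Fin (m + 2)) ℂ)
    (hij : i < j) (w : ℂ) :
    (updEntryAsym Z i j w).submatrix (pairSumEquiv hij) (pairSumEquiv hij)
      = fromBlocks (w • !![0, 1; -1, 0] + diagonal ![Z i i, Z j j])
          (Z.submatrix ![i, j] (delTwo i j hij)) (Z.submatrix (delTwo i j hij) ![i, j])
          (Z.submatrix (delTwo i j hij) (delTwo i j hij)) := by
  ext (a | a) (b | b)
  · fin_cases a <;> fin_cases b <;>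
      simp [pairSumEquiv, updEntryAsym, hij.ne, hij.ne', -submatrix_cons_row]
  · simp [pairSumEquiv, updEntryAsym, delTwo_ne_left, delTwo_ne_right, -submatrix_cons_row]
  · simp [pairSumEquiv, updEntryAsym, delTwo_ne_left, delTwo_ne_right, -submatrix_cons_row]
  · simp [pairSumEquiv, updEntryAsym, delTwo_ne_left, -submatrix_cons_row]

end DeleteTwo

theorem det_one_sub_mul_conjTranspose {n : Type*} [Fintype n] [DecidableEq n]
    (A : Matrix n n ℂ) : (1 - A * Aᴴ).det = (fromBlocks 1 A Aᴴ 1).det := by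
  rw [det_fromBlocks_one₂₂]

/-- The Hermitian dilation of a block matrix, with its blocks regrouped. -/
theorem det_one_sub_fromBlocks_mul_conjTranspose {m : ℕ} (P : Matrix (Fin 2) (Fin 2) ℂ)
    (B : Matrix (Fin 2) (Fin m) ℂ) (C : Matrix (Fin m) (Fin 2) ℂ) (D : Matrix (Fin m) (Fin m) ℂ) :
    (1 - fromBlocks P B C D * (fromBlocks P B C D)ᴴ).det
      = (fromBlocks (fromBlocks 1 P Pᴴ 1) (fromBlocks 0 B Cᴴ 0)
          (fromBlocks 0 C Bᴴ 0) (fromBlocks 1 D Dᴴ 1)).det := by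
  rw [det_one_sub_mul_conjTranspose,
    ← det_submatrix_equiv_self (Equiv.sumSumSumComm (Fin 2) (Fin 2) (Fin m) (Fin m))]
  congr 1
  ext ((a | a) | (a | a)) ((b | b) | (b | b)) <;> simp [one_apply]

/-- Lemma 3.1(2): on antisymmetric matrices, the coefficient of `w² (conj w)²` (equivalently of
`(Re z_{ij})⁴`) in `det(I_n − Z Zᴴ)`, viewed as a function of the single entry `w = z_{ij}`,
equals `det(I_{n−2} − Z'' Z''ᴴ)` where `Z''` deletes rows and columns `i, j`. -/
theorem genericNorm_typeII_entry_coefficient (m : ℕ)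
    (Z : Matrix (Fin (m + 2)) (Fin (m + 2)) ℂ) (hZ : Zᵀ = -Z)
    (i j : Fin (m + 2)) (hij : i < j) :
    ∃ c : Fin 3 → Fin 3 → ℂ, c 2 2 = 0 ∧ ∀ w : ℂ,
      (1 - updEntryAsym Z i j w * (updEntryAsym Z i j w)ᴴ).det
        = w ^ 2 * (starRingEnd ℂ) w ^ 2 *
            (1 - Z.submatrix (delTwo i j hij) (delTwo i j hij) *
              (Z.submatrix (delTwo i j hij) (delTwo i j hij))ᴴ).det
          + ∑ k : Fin 3, ∑ l : Fin 3, c k l * w ^ (k : ℕ) * (starRingEnd ℂ) w ^ (l : ℕ) := by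
  obtain ⟨c, hc, hdet⟩ := exists_coeff_det_fromBlocks
    (fromBlocks 0 !![0, 1; -1, 0] (-!![0, 1; -1, 0]) 0)
    (fromBlocks 1 (diagonal ![Z i i, Z j j]) (diagonal ![Z i i, Z j j])ᴴ 1)
    (fromBlocks 0 (Z.submatrix ![i, j] (delTwo i j hij))
      (Z.submatrix (delTwo i j hij) ![i, j])ᴴ 0)
    (fromBlocks 0 (Z.submatrix (delTwo i j hij) ![i, j])
      (Z.submatrix ![i, j] (delTwo i j hij))ᴴ 0)
    (fromBlocks 1 (Z.submatrix (delTwo i j hij) (delTwo i j hij))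
      (Z.submatrix (delTwo i j hij) (delTwo i j hij))ᴴ 1)
  refine ⟨c, hc, fun w => ?_⟩
  have hP : fromBlocks 1 (w • !![0, 1; -1, 0] + diagonal ![Z i i, Z j j])
        (w • !![0, 1; -1, 0] + diagonal ![Z i i, Z j j])ᴴ 1
      = diagonal (Sum.elim (fun _ => w) fun _ => (starRingEnd ℂ) w)
          * fromBlocks 0 !![0, 1; -1, 0] (-!![0, 1; -1, 0]) 0
        + fromBlocks 1 (diagonal ![Z i i, Z j j]) (diagonal ![Z i i, Z j j])ᴴ 1 := by
    ext (a | a) (b | b) <;> fin_cases a <;> fin_cases b <;> simp [diagonal_mul]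
  have hreindex : (1 - updEntryAsym Z i j w * (updEntryAsym Z i j w)ᴴ).submatrix
        (pairSumEquiv hij) (pairSumEquiv hij)
      = 1 - (updEntryAsym Z i j w).submatrix (pairSumEquiv hij) (pairSumEquiv hij) *
          ((updEntryAsym Z i j w).submatrix (pairSumEquiv hij) (pairSumEquiv hij))ᴴ := by
    rw [conjTranspose_submatrix, submatrix_mul_equiv, ← submatrix_one_equiv (pairSumEquiv hij)]
    rfl
  rw [← det_submatrix_equiv_self (pairSumEquiv hij), hreindex,
    updEntryAsym_submatrix_pairSumEquiv, det_one_sub_fromBlocks_mul_conjTranspose, hP, hdet,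
    det_fromBlocks_symplectic, one_mul, ← det_one_sub_mul_conjTranspose]
end
end

section
/- Let r, s ≥ 1 and let σ = (Fin r × Fin s) × Fin 2 index 2rs real variables. In MvPolynomial σ ℂ, let Z be the r×s matrix whose (i,j) entry is X((i,j),0) + i·X((i,j),1) and let Z* be the s×r matrix whose (j,i) entry is X((i,j),0) − i·X((i,j),1), and set D = det(I_r − Z·Z*) ∈ MvPolynomial σ ℂ. Then there exists a (necessarily unique) polynomial P ∈ MvPolynomial σ ℝ whose image under the coefficient ring map ℝ → ℂ equals D, and P is irreducible in MvPolynomial σ ℝ. -/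
open Matrix MvPolynomial

noncomputable section

/-- The formal matrix `Z` of the type I domain, with `(i,j)` entry
`X((i,j),0) + i·X((i,j),1)` (real and imaginary parts as formal variables). -/
def ZpolyI (r s : ℕ) : Matrix (Fin r) (Fin s) (MvPolynomial ((Fin r × Fin s) × Fin 2) ℂ) :=
  Matrix.of fun i j => X ((i, j), 0) + C Complex.I * X ((i, j), 1)

/-- The formal conjugate transpose `Z*`, with `(j,i)` entry `X((i,j),0) − i·X((i,j),1)`. -/
def ZpolyIstar (r s : ℕ) :
    Matrix (Fin s) (Fin r) (MvPolynomial ((Fin r × Fin s) × Fin 2) ℂ) :=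
  Matrix.of fun j i => X ((i, j), 0) - C Complex.I * X ((i, j), 1)

namespace MvPolynomial

variable {σ K : Type*} [Field K]

/-- Multiply the variables in `T` by a new variable. -/
def scaleVars (T : Set σ) [DecidablePred (· ∈ T)] :
    MvPolynomial σ K →ₐ[K] Polynomial (MvPolynomial σ K) :=
  aeval fun x => if x ∈ T then Polynomial.X * Polynomial.C (X x) else Polynomial.C (X x)

/-- Set the variables in `T` to zero. -/
def killVars (T : Set σ) [DecidablePred (· ∈ T)] :
    MvPolynomial σ K →ₐ[K] MvPolynomial σ K :=
  bind₁ fun x => if x ∈ T then 0 else X x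

lemma eval_one_scaleVars (T : Set σ) [DecidablePred (· ∈ T)] (p : MvPolynomial σ K) :
    (scaleVars T p).eval 1 = p := by
  have : ((Polynomial.aeval (1 : MvPolynomial σ K)).restrictScalars K).comp (scaleVars T) =
      AlgHom.id K (MvPolynomial σ K) := by
    ext x : 1
    by_cases hx : x ∈ T <;> simp [scaleVars, hx]
  simpa [Polynomial.coe_aeval_eq_eval] using DFunLike.congr_fun this p

lemma eval_zero_scaleVars (T : Set σ) [DecidablePred (· ∈ T)] (p : MvPolynomial σ K) :
    (scaleVars T p).eval 0 = killVars T p := by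
  have : ((Polynomial.aeval (0 : MvPolynomial σ K)).restrictScalars K).comp (scaleVars T) =
      killVars T := by
    ext x : 1
    by_cases hx : x ∈ T <;> simp [scaleVars, killVars, hx]
  simpa [Polynomial.coe_aeval_eq_eval] using DFunLike.congr_fun this p

lemma scaleVars_ne_zero (T : Set σ) [DecidablePred (· ∈ T)] {p : MvPolynomial σ K}
    (hp : p ≠ 0) : scaleVars T p ≠ 0 := fun h => hp <| by
  simpa [h] using (eval_one_scaleVars T p).symm

lemma disjoint_vars_of_natDegree_scaleVars_eq_zero (T : Set σ) [DecidablePred (· ∈ T)]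
    {p : MvPolynomial σ K} (hp : (scaleVars T p).natDegree = 0) : Disjoint (p.vars : Set σ) T := by
  classical
  have hkill : killVars T p = p := by
    refine (eval_zero_scaleVars T p).symm.trans (.trans ?_ (eval_one_scaleVars T p))
    rw [Polynomial.eq_C_of_natDegree_eq_zero hp, Polynomial.eval_C, Polynomial.eval_C]
  refine Set.disjoint_left.mpr fun x hx hxT => ?_
  rw [← hkill] at hx
  obtain ⟨y, -, hy⟩ := Finset.mem_biUnion.mp (vars_bind₁ _ _ hx)
  by_cases hyT : y ∈ T
  · simp [hyT] at hy
  · simp only [hyT, if_false, vars_X, Finset.mem_singleton] at hy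
    exact hyT (hy ▸ hxT)

lemma disjoint_vars_or_of_natDegree_scaleVars_mul_le_one (T : Set σ) [DecidablePred (· ∈ T)]
    {p q : MvPolynomial σ K} (h0 : p * q ≠ 0) (h : (scaleVars T (p * q)).natDegree ≤ 1) :
    Disjoint (p.vars : Set σ) T ∨ Disjoint (q.vars : Set σ) T := by
  rw [map_mul, Polynomial.natDegree_mul (scaleVars_ne_zero T (left_ne_zero_of_mul h0))
    (scaleVars_ne_zero T (right_ne_zero_of_mul h0))] at h
  obtain h | h : (scaleVars T p).natDegree = 0 ∨ (scaleVars T q).natDegree = 0 := by omega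
  · exact .inl (disjoint_vars_of_natDegree_scaleVars_eq_zero T h)
  · exact .inr (disjoint_vars_of_natDegree_scaleVars_eq_zero T h)

lemma killVars_eq_self (T : Set σ) [DecidablePred (· ∈ T)] {p : MvPolynomial σ K}
    (hp : Disjoint (p.vars : Set σ) T) : killVars T p = p := by
  conv_rhs => rw [← AlgHom.id_apply (R := K) p]
  refine hom_congr_vars (f₁ := (killVars T : MvPolynomial σ K →ₐ[K] _).toRingHom)
    (f₂ := (AlgHom.id K (MvPolynomial σ K)).toRingHom) ?_ ?_ rfl
  · ext; simp
  · intro x hx _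
    have : x ∉ T := Set.disjoint_left.mp hp hx
    simp [killVars, this]

end MvPolynomial

lemma Matrix.natDegree_det_le_one_of_row {n R : Type*} [Fintype n] [DecidableEq n] [CommRing R]
    (M : Matrix n n (Polynomial R)) (i₀ : n) (h₁ : ∀ j, (M i₀ j).natDegree ≤ 1)
    (h₀ : ∀ i j, i ≠ i₀ → (M i j).natDegree = 0) : M.det.natDegree ≤ 1 := by
  rw [← Matrix.det_transpose, Matrix.det_apply]
  simp only [Matrix.transpose_apply]
  refine Polynomial.natDegree_sum_le_of_forall_le _ _ fun τ _ => ?_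
  refine (Polynomial.natDegree_smul_le _ _).trans <| (Polynomial.natDegree_prod_le _ _).trans ?_
  rw [Finset.sum_eq_single i₀ (fun i _ hi => h₀ i _ hi) (by simp)]
  exact h₁ _

lemma Matrix.natDegree_det_one_sub_mul_le_one {m n R : Type*} [Fintype m] [Fintype n]
    [DecidableEq m] [CommRing R] (A : Matrix m n (Polynomial R)) (B : Matrix n m (Polynomial R))
    (i₀ : m) (h₁ : ∀ j, (A i₀ j).natDegree ≤ 1) (h₀ : ∀ i j, i ≠ i₀ → (A i j).natDegree ≤ 0)
    (hB : ∀ i j, (B i j).natDegree ≤ 0) : (1 - A * B).det.natDegree ≤ 1 := by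
  have key (d : ℕ) (i : m) (h : ∀ j, (A i j).natDegree ≤ d) (k : m) :
      ((1 - A * B : Matrix m m _) i k).natDegree ≤ d := by
    rw [Matrix.sub_apply, Matrix.mul_apply, ← max_self d]
    refine Polynomial.natDegree_sub_le_of_le ?_ ?_
    · rw [Matrix.one_apply]
      split_ifs <;> simp
    · exact Polynomial.natDegree_sum_le_of_forall_le _ _ fun j _ =>
        Polynomial.natDegree_mul_le_of_le (h j) (hB j k)
  exact Matrix.natDegree_det_le_one_of_row _ i₀ (key 1 i₀ h₁)
    fun i j hi => Nat.le_zero.mp (key 0 i (fun k => h₀ i k hi) j)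

section genericDet

variable (m n K : Type*) [Fintype m] [Fintype n] [DecidableEq m] [Field K]

/-- `det (1 - Z * W)` for matrices `Z` and `W` of independent variables. -/
def genericDetOneSubMul : MvPolynomial ((m × n) × Fin 2) K :=
  (1 - (Matrix.of fun i j => X ((i, j), 0) : Matrix m n (MvPolynomial ((m × n) × Fin 2) K)) *
    (Matrix.of fun j i => X ((i, j), 1) : Matrix n m (MvPolynomial ((m × n) × Fin 2) K))).det

variable {m n K}

lemma map_genericDetOneSubMul {S : Type*} [CommRing S] [Algebra K S]
    (f : MvPolynomial ((m × n) × Fin 2) K →ₐ[K] S) :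
    f (genericDetOneSubMul m n K) =
      (1 - (Matrix.of fun i j => f (X ((i, j), 0))) *
        (Matrix.of fun j i => f (X ((i, j), 1))) : Matrix m m S).det := by
  rw [genericDetOneSubMul, AlgHom.map_det]
  congr 1
  ext i j
  simp [Matrix.one_apply, Matrix.mul_apply, apply_ite f]

lemma mem_vars_genericDetOneSubMul (i : m) (j : n) :
    ((i, j), 0) ∈ (genericDetOneSubMul m n K).vars := by
  classical
  by_contra h
  let v (c : K) (x : (m × n) × Fin 2) : K := if x.1 = (i, j) then (if x.2 = 0 then c else 1) else 0
  have key : aeval (v 0) (genericDetOneSubMul m n K) = aeval (v 1) (genericDetOneSubMul m n K) := by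
    refine hom_congr_vars (f₁ := (aeval (v 0)).toRingHom) (f₂ := (aeval (v 1)).toRingHom)
      (by ext; simp) ?_ rfl
    rintro ⟨x, k⟩ hx _
    have : ¬ (x = (i, j) ∧ k = 0) := by rintro ⟨rfl, rfl⟩; exact h hx
    simp only [AlgHom.toRingHom_eq_coe, RingHom.coe_coe, aeval_X, v]
    grind
  have h₀ : aeval (v 0) (genericDetOneSubMul m n K) = 1 := by
    have : (Matrix.of fun a b => v 0 ((a, b), 0)) = (0 : Matrix m n K) := by ext; simp [v]
    simp [map_genericDetOneSubMul, this]
  have h₁ : aeval (v 1) (genericDetOneSubMul m n K) = 0 := by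
    rw [map_genericDetOneSubMul]
    refine Matrix.det_eq_zero_of_row_eq_zero i fun k => ?_
    simp only [aeval_X, v, Matrix.sub_apply, Matrix.mul_apply, Matrix.of_apply, Matrix.one_apply]
    by_cases hk : i = k
    · subst hk; simp
    · simp [hk, Ne.symm hk]
  simp [h₀, h₁] at key

lemma natDegree_scaleVars_row (i₀ : m) :
    (scaleVars {x | x.1.1 = i₀ ∧ x.2 = 0} (genericDetOneSubMul m n K)).natDegree ≤ 1 := by
  rw [map_genericDetOneSubMul]
  refine Matrix.natDegree_det_one_sub_mul_le_one _ _ i₀ (fun k => ?_) (fun i k hi => ?_)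
    fun k l => ?_
  · simp [scaleVars]
  · simp [scaleVars, hi]
  · simp [scaleVars]

lemma natDegree_scaleVars_col [DecidableEq n] (j₀ : n) :
    (scaleVars {x | x.1.2 = j₀ ∧ x.2 = 0} (genericDetOneSubMul m n K)).natDegree ≤ 1 := by
  rw [map_genericDetOneSubMul, Matrix.det_one_sub_mul_comm, ← Matrix.det_transpose,
    Matrix.transpose_sub, Matrix.transpose_one, Matrix.transpose_mul]
  refine Matrix.natDegree_det_one_sub_mul_le_one _ _ j₀ (fun k => ?_) (fun i k hi => ?_)
    fun k l => ?_
  · simp [scaleVars]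
  · simp [scaleVars, hi]
  · simp [scaleVars]

lemma killVars_genericDetOneSubMul :
    killVars {x | x.2 = 0} (genericDetOneSubMul m n K) = 1 := by
  have : (Matrix.of fun i j => killVars (K := K) {x : (m × n) × Fin 2 | x.2 = 0} (X ((i, j), 0))) =
    (0 : Matrix m n _) := by ext; simp [killVars]
  simp [map_genericDetOneSubMul, this]

theorem irreducible_genericDetOneSubMul [Nonempty m] [Nonempty n] :
    Irreducible (genericDetOneSubMul m n K) := by
  classical
  have hne : genericDetOneSubMul m n K ≠ 0 := fun h => by
    simpa [h] using killVars_genericDetOneSubMul (m := m) (n := n) (K := K)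
  obtain ⟨i₁⟩ := ‹Nonempty m›
  obtain ⟨j₁⟩ := ‹Nonempty n›
  refine ⟨fun hu => ?_, fun p q hpq => ?_⟩
  · obtain ⟨c, -, hc⟩ := MvPolynomial.isUnit_iff_eq_C_of_isReduced.mp hu
    simpa [hc] using mem_vars_genericDetOneSubMul (K := K) i₁ j₁
  · have hkill := killVars_genericDetOneSubMul (m := m) (n := n) (K := K)
    rw [hpq, map_mul] at hkill
    have hrow (i : m) := disjoint_vars_or_of_natDegree_scaleVars_mul_le_one _ (hpq ▸ hne)
      (hpq ▸ natDegree_scaleVars_row (K := K) (n := n) i)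
    have hcol := disjoint_vars_or_of_natDegree_scaleVars_mul_le_one _ (hpq ▸ hne)
      (hpq ▸ natDegree_scaleVars_col (K := K) (m := m) j₁)
    have hmem (i : m) (j : n) : ((i, j), 0) ∈ p.vars ∨ ((i, j), 0) ∈ q.vars :=
      Finset.mem_union.mp <| vars_mul p q <| hpq ▸ mem_vars_genericDetOneSubMul (K := K) i j
    simp only [Set.disjoint_left, Set.mem_ofPred_eq, Finset.mem_coe, not_and] at hrow hcol
    have : Disjoint (p.vars : Set ((m × n) × Fin 2)) {x | x.2 = 0} ∨
        Disjoint (q.vars : Set ((m × n) × Fin 2)) {x | x.2 = 0} := by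
      simp only [Set.disjoint_left, Set.mem_ofPred_eq, Finset.mem_coe]
      by_contra! ⟨⟨⟨⟨i, j⟩, k⟩, hx, hk⟩, ⟨⟨⟨i', j'⟩, k'⟩, hx', hk'⟩⟩
      have h₁ := hrow i
      have h₂ := hrow i'
      have h₃ := hmem i j₁
      have h₄ := hmem i' j₁
      grind
    rcases this with h | h
    · rw [killVars_eq_self _ h] at hkill
      exact .inl (.of_mul_eq_one _ hkill)
    · rw [killVars_eq_self _ h, mul_comm] at hkill
      exact .inr (.of_mul_eq_one _ hkill)

end genericDet

/-- The change of variables `x ↦ x + i y`, `y ↦ x - i y` on pairs of variables. -/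
def complexCoordinates (τ : Type*) :
    MvPolynomial (τ × Fin 2) ℂ ≃ₐ[ℂ] MvPolynomial (τ × Fin 2) ℂ :=
  have hI : (C Complex.I : MvPolynomial (τ × Fin 2) ℂ) * C Complex.I = -1 := by
    rw [← C_mul, Complex.I_mul_I, C_neg, C_1]
  have hhalf : (C 2⁻¹ : MvPolynomial (τ × Fin 2) ℂ) * 2 = 1 := by
    rw [← map_ofNat C 2, ← C_mul]; norm_num
  AlgEquiv.ofAlgHom
    (aeval fun x => if x.2 = 0 then X (x.1, 0) + C Complex.I * X (x.1, 1)
      else X (x.1, 0) - C Complex.I * X (x.1, 1))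
    (aeval fun x => if x.2 = 0 then C 2⁻¹ * (X (x.1, 0) + X (x.1, 1))
      else C 2⁻¹ * C Complex.I * (X (x.1, 1) - X (x.1, 0)))
    (by
      ext ⟨x, k⟩ : 1
      fin_cases k
      · simp [algHom_C, algebraMap_eq]
        linear_combination (X (x, 0) : MvPolynomial (τ × Fin 2) ℂ) * hhalf
      · simp [algHom_C, algebraMap_eq]
        linear_combination (-2 * C 2⁻¹ * X (x, 1) : MvPolynomial (τ × Fin 2) ℂ) * hI +
          (X (x, 1) : MvPolynomial (τ × Fin 2) ℂ) * hhalf)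
    (by
      ext ⟨x, k⟩ : 1
      fin_cases k
      · simp [algHom_C, algebraMap_eq]
        linear_combination (C 2⁻¹ * (X (x, 1) - X (x, 0)) : MvPolynomial (τ × Fin 2) ℂ) * hI +
          (X (x, 0) : MvPolynomial (τ × Fin 2) ℂ) * hhalf
      · simp [algHom_C, algebraMap_eq]
        linear_combination (C 2⁻¹ * (X (x, 0) - X (x, 1)) : MvPolynomial (τ × Fin 2) ℂ) * hI +
          (X (x, 1) : MvPolynomial (τ × Fin 2) ℂ) * hhalf)

lemma complexCoordinates_X_zero {τ : Type*} (x : τ) :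
    complexCoordinates τ (X (x, 0)) = X (x, 0) + C Complex.I * X (x, 1) := by
  simp [complexCoordinates]

lemma complexCoordinates_X_one {τ : Type*} (x : τ) :
    complexCoordinates τ (X (x, 1)) = X (x, 0) - C Complex.I * X (x, 1) := by
  simp [complexCoordinates]

lemma complexCoordinates_genericDetOneSubMul (r s : ℕ) :
    complexCoordinates _ (genericDetOneSubMul (Fin r) (Fin s) ℂ) =
      (1 - ZpolyI r s * ZpolyIstar r s).det := by
  have hZ : (Matrix.of fun i j => complexCoordinates _ (X ((i, j), 0))) = ZpolyI r s := by
    exact Matrix.ext fun i j => complexCoordinates_X_zero (i, j)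
  have hW : (Matrix.of fun j i => complexCoordinates _ (X ((i, j), 1))) = ZpolyIstar r s := by
    exact Matrix.ext fun j i => complexCoordinates_X_one (i, j)
  rw [← hZ, ← hW]
  exact map_genericDetOneSubMul (complexCoordinates _).toAlgHom

lemma map_conj_det_one_sub_ZpolyI_mul_ZpolyIstar (r s : ℕ) :
    map (starRingEnd ℂ) (1 - ZpolyI r s * ZpolyIstar r s).det =
      (1 - ZpolyI r s * ZpolyIstar r s).det := by
  have hZ : (ZpolyI r s).map (map (starRingEnd ℂ)) = (ZpolyIstar r s)ᵀ := by
    refine Matrix.ext fun i j => ?_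
    simp [ZpolyI, ZpolyIstar, sub_eq_add_neg]
  have hW : (ZpolyIstar r s).map (map (starRingEnd ℂ)) = (ZpolyI r s)ᵀ := by
    refine Matrix.ext fun i j => ?_
    simp [ZpolyI, ZpolyIstar]
  rw [RingHom.map_det, map_sub, map_one, RingHom.mapMatrix_apply, Matrix.map_mul, hZ, hW,
    ← Matrix.transpose_mul, ← Matrix.det_transpose, Matrix.transpose_sub, Matrix.transpose_one,
    Matrix.transpose_transpose]

lemma mem_range_map_of_map_conj_eq {τ : Type*} {p : MvPolynomial τ ℂ}
    (hp : map (starRingEnd ℂ) p = p) : p ∈ Set.range (map (σ := τ) (algebraMap ℝ ℂ)) := by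
  refine mem_range_map_iff_coeffs_subset.mpr fun c hc => ?_
  obtain ⟨d, -, rfl⟩ := mem_coeffs_iff.mp hc
  have h : starRingEnd ℂ (p.coeff d) = p.coeff d := by rw [← coeff_map, hp]
  obtain ⟨a, ha⟩ := Complex.conj_eq_iff_real.mp h
  exact ⟨a, ha.symm⟩

lemma irreducible_of_irreducible_map {τ K L : Type*} [Field K] [Field L] (f : K →+* L)
    {p : MvPolynomial τ K} (hp : Irreducible (map f p)) : Irreducible p := by
  have : IsLocalHom (map (σ := τ) f) := ⟨fun q hq => by
    simpa only [MvPolynomial.isUnit_iff, coeff_map, isUnit_map_iff, isNilpotent_iff_eq_zero,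
      map_eq_zero] using hq⟩
  exact .of_map (f := map (σ := τ) f) hp

/-- Proposition 3.2, type I case: the generic norm `det(I_r − Z Zᴴ)`, viewed as a real
polynomial in the real and imaginary parts of the entries, is irreducible. -/
theorem genericNorm_typeI_irreducible (r s : ℕ) (hr : 1 ≤ r) (hs : 1 ≤ s) :
    ∃ P : MvPolynomial ((Fin r × Fin s) × Fin 2) ℝ,
      MvPolynomial.map (algebraMap ℝ ℂ) P = (1 - ZpolyI r s * ZpolyIstar r s).det ∧
        Irreducible P := by
  have : Nonempty (Fin r) := ⟨⟨0, hr⟩⟩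
  have : Nonempty (Fin s) := ⟨⟨0, hs⟩⟩
  obtain ⟨P, hP⟩ :=
    mem_range_map_of_map_conj_eq (map_conj_det_one_sub_ZpolyI_mul_ZpolyIstar r s)
  refine ⟨P, hP, irreducible_of_irreducible_map (algebraMap ℝ ℂ) ?_⟩
  rw [hP, ← complexCoordinates_genericDetOneSubMul]
  exact (MulEquiv.irreducible_iff (complexCoordinates _)).mpr irreducible_genericDetOneSubMul
end
end
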